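/- Let Φ and Ψ be linear flows on X = ℝ^d such that each of Φ and Ψ is either stable or unstable. Then for every 0 < β < 1: (i) Φ ≃^{β⁻} Ψ ⟺ Φ ~^{β⁻} Ψ ⟺ β² ≤ ρ(Φ,Ψ); and (ii) Φ ≃^{β⁺} Ψ ⟺ Φ ~^{β⁺} Ψ ⟺ β² < ρ(Φ,Ψ). -/

import Mathlib

noncomputable section
namespace LF

open Filter Topology

/-- `ℝ^d` with the Euclidean norm. -/
abbrev Euc (d : ℕ) := EuclideanSpace ℝ (Fin d)

variable {d : ℕ}

/-- The time-`t` map of the linear flow on `ℝ^d` generated by the matrix `A`,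
i.e. `x ↦ exp (t A) x`. -/
def linFlow (A : Matrix (Fin d) (Fin d) ℝ) (t : ℝ) (x : Euc d) : Euc d :=
  Matrix.toEuclideanLin (NormedSpace.exp (t • A)) x

/-- The orbit `{Φ_t x : t ∈ ℝ}` of `x` under the linear flow generated by `A`. -/
def flowOrbit (A : Matrix (Fin d) (Fin d) ℝ) (x : Euc d) : Set (Euc d) :=
  Set.range fun t : ℝ => linFlow A t x

/-- `Φ` is `h`-related to `Ψ`: the homeomorphism `h` maps every orbit of the flow
generated by `A` onto an orbit of the flow generated by `B`. -/
def IsOrbitEquiv (A B : Matrix (Fin d) (Fin d) ℝ) (h : Euc d ≃ₜ Euc d) : Prop :=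
  ∀ x : Euc d, h '' flowOrbit A x = flowOrbit B (h x)

/-- `f` satisfies a `β`-Hölder condition on some ball centred at `0`. -/
def HolderNearZero (β : ℝ) (f : Euc d → Euc d) : Prop :=
  ∃ r > (0 : ℝ), ∃ K : ℝ, ∀ x ∈ Metric.ball (0 : Euc d) r, ∀ y ∈ Metric.ball (0 : Euc d) r,
    dist (f x) (f y) ≤ K * dist x y ^ β

/-- `h ∈ 𝓗_β`: `h 0 = 0` and `h`, `h⁻¹` both satisfy a `β`-Hölder condition near `0`. -/
def MemHolderClass (β : ℝ) (h : Euc d ≃ₜ Euc d) : Prop :=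
  h 0 = 0 ∧ HolderNearZero β ⇑h ∧ HolderNearZero β ⇑h.symm

/-- `h ∈ 𝓗_0`: homeomorphisms fixing `0`. -/
def MemH0 (h : Euc d ≃ₜ Euc d) : Prop := h 0 = 0

/-- `h ∈ 𝓗_{0⁺} = ⋃_{γ>0} 𝓗_γ`. -/
def MemH0plus (h : Euc d ≃ₜ Euc d) : Prop := ∃ γ : ℝ, 0 < γ ∧ MemHolderClass γ h

/-- `h ∈ 𝓗_{1⁻} = ⋂_{0<γ<1} 𝓗_γ`. -/
def MemH1minus (h : Euc d ≃ₜ Euc d) : Prop := ∀ γ : ℝ, 0 < γ → γ < 1 → MemHolderClass γ h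

/-- `h ∈ 𝓗_{β⁻} = ⋂_{0<γ<β} 𝓗_γ`. -/
def MemHBelow (β : ℝ) (h : Euc d ≃ₜ Euc d) : Prop :=
  ∀ γ : ℝ, 0 < γ → γ < β → MemHolderClass γ h

/-- `h ∈ 𝓗_{β⁺} = ⋃_{γ>β} 𝓗_γ`. -/
def MemHAbove (β : ℝ) (h : Euc d ≃ₜ Euc d) : Prop :=
  ∃ γ : ℝ, β < γ ∧ MemHolderClass γ h

/-- `φ ~^⋆ ψ`: `φ` is `h`-related to `ψ` for some `h` in the class `P`. -/
def RelEquivWith (P : (Euc d ≃ₜ Euc d) → Prop) (A B : Matrix (Fin d) (Fin d) ℝ) : Prop :=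
  ∃ h : Euc d ≃ₜ Euc d, P h ∧ IsOrbitEquiv A B h

/-- `φ ≃^⋆ ψ`: there are `h` in the class `P` and `α ≠ 0` with
`h (φ t x) = ψ (α t) (h x)` for all `t`, `x`. -/
def SimEquivWith (P : (Euc d ≃ₜ Euc d) → Prop) (A B : Matrix (Fin d) (Fin d) ℝ) : Prop :=
  ∃ (h : Euc d ≃ₜ Euc d) (α : ℝ), α ≠ 0 ∧ P h ∧
    ∀ (t : ℝ) (x : Euc d), h (linFlow A t x) = linFlow B (α * t) (h x)

/-- The stable set `X_S^Φ = {x : Φ_t x → 0 as t → ∞}`. -/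
def stableSet (A : Matrix (Fin d) (Fin d) ℝ) : Set (Euc d) :=
  {x | Tendsto (fun t : ℝ => linFlow A t x) atTop (𝓝 0)}

/-- The unstable set `X_U^Φ = {x : Φ_t x → 0 as t → -∞}`. -/
def unstableSet (A : Matrix (Fin d) (Fin d) ℝ) : Set (Euc d) :=
  {x | Tendsto (fun t : ℝ => linFlow A t x) atBot (𝓝 0)}

/-- The central set `X_C^Φ = {x : e^{-ε|t|} Φ_t x → 0 as |t| → ∞, for every ε > 0}`. -/
def centralSet (A : Matrix (Fin d) (Fin d) ℝ) : Set (Euc d) :=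
  {x | ∀ ε > (0 : ℝ),
    Tendsto (fun t : ℝ => Real.exp (-(ε * |t|)) • linFlow A t x) (atBot ⊔ atTop) (𝓝 0)}

/-- The stable subspace of the flow generated by `A` (the stable set is a subspace,
so taking its span is innocuous). -/
def XS (A : Matrix (Fin d) (Fin d) ℝ) : Submodule ℝ (Euc d) := Submodule.span ℝ (stableSet A)

/-- The unstable subspace. -/
def XU (A : Matrix (Fin d) (Fin d) ℝ) : Submodule ℝ (Euc d) := Submodule.span ℝ (unstableSet A)

/-- The central subspace. -/
def XC (A : Matrix (Fin d) (Fin d) ℝ) : Submodule ℝ (Euc d) := Submodule.span ℝ (centralSet A)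

/-- The hyperbolic subspace `X_H^Φ = X_S^Φ ⊕ X_U^Φ`. -/
def XH (A : Matrix (Fin d) (Fin d) ℝ) : Submodule ℝ (Euc d) := XS A ⊔ XU A

def dimS (A : Matrix (Fin d) (Fin d) ℝ) : ℕ := Module.finrank ℝ (XS A)
def dimU (A : Matrix (Fin d) (Fin d) ℝ) : ℕ := Module.finrank ℝ (XU A)
def dimHyp (A : Matrix (Fin d) (Fin d) ℝ) : ℕ := Module.finrank ℝ (XH A)

/-- The central-part generators `A^{Φ_C}` and `α A^{Ψ_C}` are similar, i.e.
`Q A_C = (α B_C) Q` for some linear isomorphism `Q : X_C^Φ → X_C^Ψ`. -/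
def IsCentralSimilar (A B : Matrix (Fin d) (Fin d) ℝ) (α : ℝ) : Prop :=
  ∃ (hA : ∀ x ∈ XC A, Matrix.toEuclideanLin A x ∈ XC A)
    (hB : ∀ x ∈ XC B, Matrix.toEuclideanLin B x ∈ XC B)
    (Q : XC A ≃ₗ[ℝ] XC B),
    ∀ x : XC A, Q ((Matrix.toEuclideanLin A).restrict hA x)
      = α • (Matrix.toEuclideanLin B).restrict hB (Q x)

/-- The forward Lyapunov exponent `λ_+^Φ(x) = lim_{t→∞} log ‖Φ_t x‖ / t`
(the limit exists for `x ≠ 0`, so it equals the `limsup` used here). -/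
def lyap (A : Matrix (Fin d) (Fin d) ℝ) (x : Euc d) : ℝ :=
  Filter.limsup (fun t : ℝ => Real.log ‖linFlow A t x‖ / t) atTop

/-- The Lyapunov space `L^Φ(s) = {x : λ_+^Φ(x) ≤ s}` (with `λ_+^Φ(0) = -∞`), as a set. -/
def lyapSet (A : Matrix (Fin d) (Fin d) ℝ) (s : ℝ) : Set (Euc d) :=
  {x | x = 0 ∨ lyap A x ≤ s}

/-- `ℓ^Φ(s) = dim L^Φ(s)` (the Lyapunov set is a subspace, so taking its span is innocuous). -/
def ell (A : Matrix (Fin d) (Fin d) ℝ) (s : ℝ) : ℕ :=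
  Module.finrank ℝ (Submodule.span ℝ (lyapSet A s))

/-- The `(j+1)`-st smallest Lyapunov exponent `λ_{j+1}^Φ`, counted with multiplicity. -/
def lyapExp (A : Matrix (Fin d) (Fin d) ℝ) (j : ℕ) : ℝ :=
  sInf {s : ℝ | j + 1 ≤ ell A s}

/-- The Lyapunov space at `s` of the restriction of the flow to the invariant set `V`. -/
def lyapSetIn (A : Matrix (Fin d) (Fin d) ℝ) (V : Set (Euc d)) (s : ℝ) : Set (Euc d) :=
  {x | x ∈ V ∧ (x = 0 ∨ lyap A x ≤ s)}

def ellIn (A : Matrix (Fin d) (Fin d) ℝ) (V : Set (Euc d)) (s : ℝ) : ℕ :=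
  Module.finrank ℝ (Submodule.span ℝ (lyapSetIn A V s))

/-- The `(j+1)`-st smallest Lyapunov exponent of the flow restricted to `V`. -/
def lyapExpIn (A : Matrix (Fin d) (Fin d) ℝ) (V : Set (Euc d)) (j : ℕ) : ℝ :=
  sInf {s : ℝ | j + 1 ≤ ellIn A V s}

/-- `λ_{j+1}^{Φ_H}`: the `(j+1)`-st smallest Lyapunov exponent of the restriction
of the flow to the hyperbolic subspace. -/
def lyapExpH (A : Matrix (Fin d) (Fin d) ℝ) (j : ℕ) : ℝ :=
  lyapExpIn A (XH A) j

/-- The flow generated by `A` is stable: every orbit tends to `0` as `t → ∞`. -/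
def IsStable (A : Matrix (Fin d) (Fin d) ℝ) : Prop := ∀ x : Euc d, x ∈ stableSet A

/-- The flow generated by `A` is unstable: every orbit tends to `0` as `t → -∞`. -/
def IsUnstable (A : Matrix (Fin d) (Fin d) ℝ) : Prop := ∀ x : Euc d, x ∈ unstableSet A

/-- The flow generated by `A` is hyperbolic: `X = X_S ⊕ X_U`. -/
def IsHyperbolic (A : Matrix (Fin d) (Fin d) ℝ) : Prop := IsCompl (XS A) (XU A)

/-- `ρ_+(Φ,Ψ) = (min_j λ_j^Φ/λ_j^Ψ) / |max_j λ_j^Φ/λ_j^Ψ|`. -/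
def rhoPlus (A B : Matrix (Fin d) (Fin d) ℝ) : ℝ :=
  (⨅ j : Fin d, lyapExp A j / lyapExp B j) / |⨆ j : Fin d, lyapExp A j / lyapExp B j|

/-- The Lyapunov cross ratio `ρ(Φ,Ψ) = max {ρ_+(Φ,Ψ), ρ_+(Φ*,Ψ)}`, where `Φ*` is the
time-reversal of `Φ`, generated by `-A`. -/
def rho (A B : Matrix (Fin d) (Fin d) ℝ) : ℝ := max (rhoPlus A B) (rhoPlus (-A) B)

/-- The minimal period `T_x^Φ = inf {t > 0 : Φ_t x = x} ∈ [0,∞]` (with `inf ∅ = ∞`). -/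
def minPeriod (A : Matrix (Fin d) (Fin d) ℝ) (x : Euc d) : EReal :=
  sInf {T : EReal | ∃ t : ℝ, 0 < t ∧ linFlow A t x = x ∧ T = (t : EReal)}

/-- The set of complex eigenvalues of the real matrix `A`. -/
def cSpec {n : ℕ} (A : Matrix (Fin n) (Fin n) ℝ) : Set ℂ :=
  spectrum ℂ (A.map Complex.ofReal)

/-- `x` is a fixed point of the flow generated by `A`. -/
def IsFixedPt (A : Matrix (Fin d) (Fin d) ℝ) (x : Euc d) : Prop :=
  ∀ t : ℝ, linFlow A t x = x

/-- The nilpotent `m × m` Jordan block `J_m` (ones on the superdiagonal). -/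
def jordanNil (m : ℕ) : Matrix (Fin m) (Fin m) ℝ :=
  Matrix.of fun i j => if (i : ℕ) + 1 = (j : ℕ) then 1 else 0

section PieceD0a
open Filter Topology Set

/-- Lagrange interpolation for `det (1 + t M)`. -/
theorem det_interp (m : ℕ) (v : Fin (m+1) → ℝ) (hv : Function.Injective v) :
    ∃ w : Fin (m+1) → ℝ, ∑ i, w i = 1 ∧
      ∀ M : EuclideanSpace ℝ (Fin m) →L[ℝ] EuclideanSpace ℝ (Fin m),
        (ContinuousLinearMap.id ℝ _ + M).det =
          ∑ i, w i * (ContinuousLinearMap.id ℝ _ + v i • M).det := by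
  classical
  refine ⟨fun i => (Lagrange.basis Finset.univ v i).eval 1, ?_, ?_⟩
  · have := Lagrange.sum_basis (s := Finset.univ) (v := v) hv.injOn ⟨0, Finset.mem_univ _⟩
    rw [← Polynomial.eval_finsetSum, this, Polynomial.eval_one]
  · intro M
    set b := (EuclideanSpace.basisFun (Fin m) ℝ).toBasis
    set A := LinearMap.toMatrix b b (M : EuclideanSpace ℝ (Fin m) →ₗ[ℝ] EuclideanSpace ℝ (Fin m))
      with hA
    set p : Polynomial ℝ :=
      Matrix.det ((Polynomial.X : Polynomial ℝ) • A.map Polynomial.C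
        + (1 : Matrix (Fin m) (Fin m) ℝ).map Polynomial.C) with hp
    have hdeg : p.degree < (Finset.univ : Finset (Fin (m+1))).card := by
      refine lt_of_le_of_lt Polynomial.degree_le_natDegree ?_
      have := Polynomial.natDegree_det_X_add_C_le A 1
      rw [Fintype.card_fin] at this
      rw [Finset.card_univ, Fintype.card_fin]
      exact_mod_cast Nat.lt_succ_of_le this
    have hev : ∀ t : ℝ, p.eval t = (ContinuousLinearMap.id ℝ _ + t • M).det := by
      intro t
      rw [ContinuousLinearMap.det, ← LinearMap.det_toMatrix b, ← Polynomial.coe_evalRingHom, hp,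
        RingHom.map_det]
      congr 1
      have e1 : LinearMap.toMatrix b b ((ContinuousLinearMap.id ℝ _ + t • M :
          EuclideanSpace ℝ (Fin m) →L[ℝ] EuclideanSpace ℝ (Fin m)) :
          EuclideanSpace ℝ (Fin m) →ₗ[ℝ] EuclideanSpace ℝ (Fin m)) = 1 + t • A := by
        rw [ContinuousLinearMap.toLinearMap_add, ContinuousLinearMap.toLinearMap_smul, map_add,
          map_smul, ContinuousLinearMap.coe_id, LinearMap.toMatrix_id]
      rw [e1]
      ext i j
      by_cases hij : i = j <;> simp [hij, add_comm] <;> ring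
    have := congrArg (Polynomial.eval 1) (Lagrange.eq_interpolate (s := Finset.univ) hv.injOn hdeg)
    rw [hev, one_smul, Lagrange.interpolate_apply, Polynomial.eval_finsetSum] at this
    rw [this]
    refine Finset.sum_congr rfl fun i _ => ?_
    rw [Polynomial.eval_mul, Polynomial.eval_C, hev, mul_comm]

/-- radial projection to the closed unit ball -/
noncomputable def radProj {E : Type*} [NormedAddCommGroup E] [NormedSpace ℝ E] (x : E) : E :=
  (max 1 ‖x‖)⁻¹ • x

theorem radProj_of_le {E : Type*} [NormedAddCommGroup E] [NormedSpace ℝ E] {x : E}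
    (h : ‖x‖ ≤ 1) : radProj x = x := by
  simp [radProj, max_eq_left h]

theorem norm_radProj_le {E : Type*} [NormedAddCommGroup E] [NormedSpace ℝ E] (x : E) :
    ‖radProj x‖ ≤ 1 := by
  have h : 0 < max 1 ‖x‖ := lt_of_lt_of_le one_pos (le_max_left _ _)
  rw [radProj, norm_smul, norm_inv, Real.norm_of_nonneg h.le, inv_mul_le_one₀ h]
  exact le_max_right _ _

theorem norm_radProj_eq {E : Type*} [NormedAddCommGroup E] [NormedSpace ℝ E] {x : E}
    (h : 1 ≤ ‖x‖) : ‖radProj x‖ = 1 := by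
  have h' : 0 < ‖x‖ := lt_of_lt_of_le one_pos h
  rw [radProj, norm_smul, norm_inv, max_eq_right h, norm_norm, inv_mul_cancel₀ h'.ne']

theorem radProj_lipschitz {E : Type*} [NormedAddCommGroup E] [NormedSpace ℝ E] :
    LipschitzWith 2 (radProj : E → E) := by
  refine LipschitzWith.of_dist_le_mul fun x y => ?_
  rw [dist_eq_norm, dist_eq_norm]
  set a := max 1 ‖x‖ with ha
  set b := max 1 ‖y‖ with hb
  have ha1 : 1 ≤ a := le_max_left _ _
  have hb1 : 1 ≤ b := le_max_left _ _
  have hyb : ‖y‖ ≤ b := le_max_right _ _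
  have ha0 : 0 < a := by linarith
  have hb0 : 0 < b := by linarith
  have hab : |b - a| ≤ ‖x - y‖ := by
    have := abs_max_sub_max_le_abs (1:ℝ) 1 ‖y‖ 
    have h2 : |max 1 ‖y‖ - max 1 ‖x‖| ≤ |‖y‖ - ‖x‖| := by
      rw [max_comm 1, max_comm 1]; exact abs_max_sub_max_le_abs _ _ _
    refine h2.trans ?_
    rw [abs_sub_comm]; exact abs_norm_sub_norm_le x y
  have e : radProj x - radProj y = a⁻¹ • (x - y) + (a⁻¹ - b⁻¹) • y := by
    simp only [radProj, ← ha, ← hb]; module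
  rw [e]
  refine (norm_add_le _ _).trans ?_
  have h1 : ‖a⁻¹ • (x - y)‖ ≤ ‖x - y‖ := by
    rw [norm_smul, norm_inv, Real.norm_of_nonneg ha0.le]
    exact mul_le_of_le_one_left (norm_nonneg _) (inv_le_one_of_one_le₀ ha1)
  have h2 : ‖(a⁻¹ - b⁻¹) • y‖ ≤ ‖x - y‖ := by
    rw [norm_smul, inv_sub_inv ha0.ne' hb0.ne', norm_div, Real.norm_eq_abs, Real.norm_eq_abs,
      abs_of_pos (mul_pos ha0 hb0), div_mul_eq_mul_div, div_le_iff₀ (mul_pos ha0 hb0)]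
    have : |b - a| * ‖y‖ ≤ ‖x - y‖ * b := mul_le_mul hab hyb (norm_nonneg _) (norm_nonneg _)
    nlinarith [norm_nonneg (x - y), mul_nonneg (norm_nonneg (x-y)) hb0.le]
  norm_num
  linarith
end PieceD0a

section PieceD0b
open Filter Topology Set MeasureTheory

abbrev EF (m : ℕ) := EuclideanSpace ℝ (Fin m)

theorem det_id_add_pos {E : Type*} [NormedAddCommGroup E] [NormedSpace ℝ E] [FiniteDimensional ℝ E]
    (M : E →L[ℝ] E) (hM : ‖M‖ < 1) : 0 < (ContinuousLinearMap.id ℝ E + M).det := by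
  by_contra hneg
  push Not at hneg
  have hc : ContinuousOn (fun s : ℝ => (ContinuousLinearMap.id ℝ E + s • M).det) (Icc 0 1) := by
    apply Continuous.continuousOn
    exact ContinuousLinearMap.continuous_det.comp (by fun_prop)
  have h0 : (0:ℝ) ∈ Icc ((ContinuousLinearMap.id ℝ E + (1:ℝ) • M).det)
      ((ContinuousLinearMap.id ℝ E + (0:ℝ) • M).det) := by
    constructor
    · simpa using hneg
    · rw [zero_smul, add_zero]; simp [ContinuousLinearMap.det]
  obtain ⟨s, hs, hs0⟩ := intermediate_value_Icc' (zero_le_one) hc h0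
  have hu : IsUnit (1 + s • M) := by
    have : ‖-(s • M)‖ < 1 := by
      rw [norm_neg, norm_smul, Real.norm_of_nonneg hs.1]
      exact lt_of_le_of_lt (mul_le_of_le_one_left (norm_nonneg _) hs.2) hM
    simpa using isUnit_one_sub_of_norm_lt_one this
  have hu2 : IsUnit ((1 + s • M).det) := by
    have h1 := hu.map (ContinuousLinearMap.toLinearMapRingHom (R₁ := ℝ) (M₁ := E))
    exact (h1.map (LinearMap.det : (E →ₗ[ℝ] E) →* ℝ))
  exact hu2.ne_zero hs0

theorem no_retract_smooth (m : ℕ) (G : EF m → EF m)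
    (hG : ContDiff ℝ 1 G) (h1 : ∀ x, 1 ≤ ‖x‖ → G x = x) (h0 : ∀ x, G x ≠ 0) : False := by
  have hnt : Nontrivial (EF m) := ⟨⟨G 0, 0, h0 0⟩⟩
  set r : (EF m) → (EF m) := fun x => ‖G x‖⁻¹ • G x with hr
  have hrn : ∀ x, ‖r x‖ = 1 := fun x => by
    have := norm_ne_zero_iff.2 (h0 x)
    simp [hr, norm_smul, this]
  have hrs : ∀ x, ‖x‖ = 1 → r x = x := fun x hx => by
    simp [hr, h1 x hx.ge, hx]
  have hrc : ContDiff ℝ 1 r := ((hG.norm ℝ h0).inv (fun x => norm_ne_zero_iff.2 (h0 x))).smul hG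
  have hrd : ∀ x, HasFDerivAt r (fderiv ℝ r x) x := fun x =>
    (hrc.differentiable one_ne_zero x).hasFDerivAt
  set M : (EF m) → (EF m) →L[ℝ] (EF m) := fun x => fderiv ℝ r x - ContinuousLinearMap.id ℝ (EF m) with hM
  have hMc : Continuous M := (hrc.continuous_fderiv one_ne_zero).sub continuous_const
  obtain ⟨C, hC⟩ := (isCompact_closedBall (0:(EF m)) 1).exists_bound_of_continuousOn hMc.continuousOn
  set K : NNReal := ⟨max C 0, le_max_right _ _⟩ with hK
  have hMK : ∀ x ∈ Metric.closedBall (0:(EF m)) 1, ‖M x‖ ≤ K := fun x hx => (hC x hx).trans (le_max_left _ _)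
  have hLip : LipschitzOnWith K (fun x => r x - x) (Metric.closedBall (0:(EF m)) 1) := by
    refine Convex.lipschitzOnWith_of_nnnorm_hasFDerivWithin_le (𝕜 := ℝ) (f' := M)
      (fun x _ => ((hrd x).sub (hasFDerivAt_id x)).hasFDerivWithinAt) (fun x hx => hMK x hx)
      (convex_closedBall _ _)
  set g : (EF m) → (EF m) := fun x => r (radProj x) - radProj x with hg
  have hgLip : LipschitzWith (K * 2) g := by
    rw [← lipschitzOnWith_univ]
    exact hLip.comp (radProj_lipschitz.lipschitzOnWith) (fun x _ => by
      simpa using norm_radProj_le x)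
  have hg0 : ∀ x, 1 ≤ ‖x‖ → g x = 0 := fun x hx => by
    simp [hg, hrs _ (norm_radProj_eq hx)]
  have hg1 : ∀ x, ‖x‖ ≤ 1 → g x = r x - x := fun x hx => by
    simp [hg, radProj_of_le hx]
  -- volume identity for small t
  have key : ∀ t : ℝ, 0 ≤ t → t * (K * 2) < 1 →
      ∫ x in Metric.ball (0:(EF m)) 1, (ContinuousLinearMap.id ℝ (EF m) + t • M x).det = 
        (volume : Measure (EF m)).real (Metric.ball (0:(EF m)) 1) := by
    intro t ht htK
    set f : (EF m) → (EF m) := fun x => x + t • g x with hf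
    have happ : ApproximatesLinearOn f ((ContinuousLinearEquiv.refl ℝ (EF m) : (EF m) ≃L[ℝ] (EF m)) : (EF m) →L[ℝ] (EF m))
        univ (t.toNNReal * (K*2)) := by
      intro x _ y _
      have : f x - f y - ((ContinuousLinearEquiv.refl ℝ (EF m) : (EF m) ≃L[ℝ] (EF m)) : (EF m) →L[ℝ] (EF m)) (x - y)
        = t • (g x - g y) := by
          simp [hf]; module
      rw [this, norm_smul, Real.norm_of_nonneg ht, ← dist_eq_norm, ← dist_eq_norm]
      have := hgLip.dist_le_mul x y
      calc t * dist (g x) (g y) ≤ t * (((K * 2 : NNReal) : ℝ) * dist x y) := by gcongr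
        _ = _ := by push_cast; rw [Real.coe_toNNReal t ht]; ring
    have hlt : (t.toNNReal * (K*2) : NNReal) < 1 := by
      rw [← NNReal.coe_lt_coe]; push_cast; rw [Real.coe_toNNReal t ht]; exact htK
    have hcc : Subsingleton (EF m) ∨ (t.toNNReal * (K*2) : NNReal) <
       ‖((ContinuousLinearEquiv.refl ℝ (EF m) : (EF m) ≃L[ℝ] (EF m)).symm : (EF m) →L[ℝ] (EF m))‖₊⁻¹ := by
      right
      refine lt_of_lt_of_le hlt ?_
      have : ‖((ContinuousLinearEquiv.refl ℝ (EF m) : (EF m) ≃L[ℝ] (EF m)).symm : (EF m) →L[ℝ] (EF m))‖₊ = 1 := by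
        simp 
      rw [this, inv_one]
    have hinj : Function.Injective f := by
      have := happ.injOn hcc
      exact Set.injOn_univ.1 this 
    have hsurj := happ.surjective hcc
    have himg : f '' Metric.ball (0:(EF m)) 1 = Metric.ball (0:(EF m)) 1 := by
      have hout : ∀ x, 1 ≤ ‖x‖ → f x = x := fun x hx => by simp [hf, hg0 x hx]
      ext y
      simp only [mem_image, Metric.mem_ball, dist_zero_right]
      constructor
      · rintro ⟨x, hx, rfl⟩
        by_contra hy
        push Not at hy
        have := hinj (hout (f x) hy)
        rw [this] at hy; linarith
      · intro hy
        obtain ⟨x, rfl⟩ := hsurj y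
        refine ⟨x, ?_, rfl⟩
        by_contra hx
        push Not at hx
        rw [hout x hx] at hy; linarith
    have hfd : ∀ x ∈ Metric.ball (0:(EF m)) 1, HasFDerivWithinAt f
        (ContinuousLinearMap.id ℝ (EF m) + t • M x) (Metric.ball (0:(EF m)) 1) x := by
      intro x hx
      have h2 : HasFDerivAt (fun x => x + t • (r x - x)) (ContinuousLinearMap.id ℝ (EF m) + t • M x) x :=
        (hasFDerivAt_id x).add (((hrd x).sub (hasFDerivAt_id x)).const_smul t)
      refine h2.hasFDerivWithinAt.congr (fun y hy => ?_) ?_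
      · simp only [hf]; rw [hg1 y (by simpa using (Metric.mem_ball.1 hy).le)]
      · simp only [hf]; rw [hg1 x (by simpa using (Metric.mem_ball.1 hx).le)]
    have hInt1 := integral_image_eq_integral_abs_det_fderiv_smul (volume : Measure (EF m))
      measurableSet_ball hfd hinj.injOn (fun _ => (1:ℝ))
    rw [himg] at hInt1
    rw [integral_const, Measure.real, Measure.restrict_apply_univ] at hInt1
    simp only [smul_eq_mul, mul_one] at hInt1
    rw [Measure.real, hInt1]
    refine setIntegral_congr_fun measurableSet_ball fun x hx => ?_
    refine (abs_of_pos (det_id_add_pos _ ?_)).symm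
    rw [norm_smul, Real.norm_of_nonneg ht]
    have := hMK x (Metric.ball_subset_closedBall hx)
    have h2 : (0:ℝ) ≤ K := K.2
    nlinarith
  -- interpolation
  set δ : ℝ := 1 / ((K * 2 + 1) * (m + 1)) with hδ
  have hK0 : (0:ℝ) ≤ K := K.2
  have hδ0 : 0 < δ := by positivity
  set v : Fin (m+1) → ℝ := fun i => δ * (i : ℕ) with hv
  have hvinj : Function.Injective v := by
    intro i j hij
    have := mul_left_cancel₀ hδ0.ne' hij
    exact Fin.ext (by exact_mod_cast this)
  obtain ⟨w, hw1, hw⟩ := det_interp m v hvinj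
  have hvk : ∀ i, v i * (K * 2) < 1 := by
    intro i
    have hi : ((i:ℕ):ℝ) < m + 1 := by exact_mod_cast i.2
    have : v i * (K*2) = (K * 2) * (i:ℕ) / ((K * 2 + 1) * (m + 1)) := by
      simp only [hv, hδ]; ring
    rw [this, div_lt_one (by positivity)]
    have : (0:ℝ) ≤ (i:ℕ) := Nat.cast_nonneg _
    nlinarith
  have hintg : ∀ i, IntegrableOn (fun x => w i * (ContinuousLinearMap.id ℝ (EF m) + v i • M x).det)
      (Metric.ball (0:(EF m)) 1) := by
    intro i
    have hc : Continuous (fun x => w i * (ContinuousLinearMap.id ℝ (EF m) + v i • M x).det) :=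
      continuous_const.mul (ContinuousLinearMap.continuous_det.comp (by fun_prop))
    exact (hc.continuousOn.integrableOn_compact (isCompact_closedBall (0:(EF m)) 1)).mono_set
      Metric.ball_subset_closedBall
  have hfin : ∫ x in Metric.ball (0:(EF m)) 1, (ContinuousLinearMap.id ℝ (EF m) + M x).det = 
        (volume : Measure (EF m)).real (Metric.ball (0:(EF m)) 1) := by
    rw [integral_congr_ae (Filter.Eventually.of_forall (fun x => hw (M x)))]
    rw [integral_finsetSum _ (fun i _ => hintg i)]
    simp_rw [integral_const_mul]
    rw [Finset.sum_congr rfl (fun i _ => by rw [key (v i) (by positivity) (hvk i)]),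
      ← Finset.sum_mul, hw1, one_mul]
  have hzero : ∀ x, (ContinuousLinearMap.id ℝ (EF m) + M x).det = 0 := by
    intro x
    have e : ContinuousLinearMap.id ℝ (EF m) + M x = fderiv ℝ r x := by simp [hM]
    rw [e]
    by_contra hdet
    have hb := (LinearMap.equivOfDetNeZero (fderiv ℝ r x : (EF m) →ₗ[ℝ] (EF m)) hdet).surjective (r x)
    obtain ⟨z, hz⟩ := hb
    have hz' : fderiv ℝ r x z = r x := hz
    have hns : HasFDerivAt (fun y => ‖r y‖^2) (2 • (innerSL ℝ (r x)).comp (fderiv ℝ r x)) x :=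
      (hrd x).norm_sq
    have hcst : (fun y => ‖r y‖^2) = fun _ => (1:ℝ) := by
      ext y; rw [hrn]; norm_num
    rw [hcst] at hns
    have := hns.unique (hasFDerivAt_const (1:ℝ) x)
    have h3 := congrArg (fun L => L z) this
    simp [hz', real_inner_self_eq_norm_sq, hrn] at h3
  have : (volume : Measure (EF m)).real (Metric.ball (0:(EF m)) 1) = 0 := by
    rw [← hfin]; simp [hzero]
  have hpos : 0 < (volume : Measure (EF m)).real (Metric.ball (0:(EF m)) 1) := by
    rw [Measure.real]
    exact ENNReal.toReal_pos (Metric.measure_ball_pos _ _ one_pos).ne' measure_ball_lt_top.ne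
  linarith
end PieceD0b

section PieceD0c
open Filter Topology Set MeasureTheory

theorem exists_zero_near_id (m : ℕ) (F : EF m → EF m) (hF : Continuous F)
    (h : ∀ x, ‖x‖ ≤ 1 → ‖F x - x‖ ≤ 1/2) : ∃ x, ‖x‖ ≤ 1 ∧ F x = 0 := by
  by_contra hne
  push Not at hne
  set χ : EF m → ℝ := fun x => max 0 (min 1 (9 - 10 * ‖x‖)) with hχ
  have hχc : Continuous χ := by fun_prop
  set G : EF m → EF m := fun x => x + χ x • (F x - x) with hG
  have hGc : Continuous G := by fun_prop
  have hχ0 : ∀ x, 0 ≤ χ x := fun x => le_max_left _ _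
  have hχ1 : ∀ x, χ x ≤ 1 := fun x => max_le zero_le_one (min_le_left _ _)
  have hGo : ∀ x, (0.9:ℝ) ≤ ‖x‖ → G x = x := by
    intro x hx
    have : χ x = 0 := by
      simp only [hχ]
      apply max_eq_left
      exact (min_le_right _ _).trans (by linarith)
    simp [hG, this]
  have hG0 : ∀ x, G x ≠ 0 := by
    intro x hx
    rcases le_or_gt ‖x‖ 0.8 with h8 | h8
    · have : χ x = 1 := by
        simp only [hχ]
        rw [min_eq_left (by linarith)]; norm_num
      simp only [hG, this, one_smul, add_sub_cancel] at hx
      exact hne x (by linarith) hx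
    · rcases le_or_gt ‖x‖ 1 with h9 | h9
      · have h3 : x = -(χ x • (F x - x)) := by
          simp only [hG] at hx; exact eq_neg_of_add_eq_zero_left hx
        have h4 : ‖x‖ ≤ 1/2 := by
          rw [h3, norm_neg, norm_smul, Real.norm_of_nonneg (hχ0 x)]
          have := h x h9
          nlinarith [hχ0 x, hχ1 x, norm_nonneg (F x - x)]
        linarith
      · rw [hGo x (by linarith)] at hx
        rw [hx, norm_zero] at h8; linarith
  have hS : IsClosed {x : EF m | 1 ≤ ‖x‖} := isClosed_le continuous_const continuous_norm
  have hUo : IsOpen {x : EF m | (0.9:ℝ) < ‖x‖} := isOpen_lt continuous_const continuous_norm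
  have hU : {x : EF m | (0.9:ℝ) < ‖x‖} ∈ 𝓝ˢ {x : EF m | 1 ≤ ‖x‖} :=
    hUo.mem_nhdsSet.2 (fun x hx => by simp only [mem_setOf_eq] at *; linarith)
  obtain ⟨g, hg1, hg2, hg3, -⟩ := hGc.exists_contDiff_approx_and_eqOn 1 hGc.norm
    (fun x => norm_pos_iff.2 (hG0 x)) hS hU
    (contDiffOn_id.congr (fun x hx => hGo x (le_of_lt hx)))
  refine no_retract_smooth m g hg1 (fun x hx => ?_) (fun x hx => ?_)
  · rw [hg3 hx]; exact hGo x (by linarith)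
  · have := hg2 x
    rw [hx, dist_zero_left] at this
    exact lt_irrefl _ this

theorem dim_le_aux (m n : ℕ) (f : EF m → EF n) (hc : ContinuousOn f (Metric.closedBall 0 1))
    (hi : InjOn f (Metric.closedBall 0 1)) : m ≤ n := by
  by_contra hlt
  push Not at hlt
  have hcr : Continuous ((Metric.closedBall (0:EF m) 1).restrict f) := continuousOn_iff_continuous_restrict.1 hc
  have : CompactSpace (Metric.closedBall (0:EF m) 1) :=
    isCompact_iff_compactSpace.1 (isCompact_closedBall _ _)
  have he : IsClosedEmbedding ((Metric.closedBall (0:EF m) 1).restrict f) :=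
    hcr.isClosedEmbedding (injOn_iff_injective.1 hi)
  obtain ⟨g, hg⟩ := ContinuousMap.exists_extension' he (⟨Subtype.val, continuous_subtype_val⟩ : C(Metric.closedBall (0:EF m) 1, EF m))
  have hgf : ∀ x, ‖x‖ ≤ 1 → g (f x) = x := by
    intro x hx
    exact congrFun hg ⟨x, by simpa using hx⟩
  obtain ⟨P, hP1, hP2, -⟩ := g.continuous.exists_contDiff_approx 1 (continuous_const (y := (1/4:ℝ)))
    (fun x => by norm_num)
  have hd : Dense (range P)ᶜ := hP1.dense_compl_range_of_finrank_lt_finrank (by simpa using hlt)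
  obtain ⟨c, hc1, hc2⟩ := hd.exists_dist_lt 0 (show (0:ℝ) < 1/4 by norm_num)
  rw [dist_zero_left] at hc2
  have hfr : Continuous (fun x => f (radProj x)) :=
    hc.comp_continuous radProj_lipschitz.continuous (fun x => by simpa using norm_radProj_le x)
  obtain ⟨x, hx, hx0⟩ := exists_zero_near_id m (fun x => P (f (radProj x)) - c)
    ((hP1.continuous.comp hfr).sub continuous_const) (fun x hx => by
      rw [radProj_of_le hx]
      have h2 := hP2 (f x)
      rw [hgf x hx, dist_eq_norm] at h2
      have : P (f x) - c - x = (P (f x) - x) - c := by abel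
      rw [this]
      exact (norm_sub_le _ _).trans (by linarith))
  exact hc1 ⟨_, sub_eq_zero.1 hx0⟩

/-- Invariance of dimension: a continuous injection of a ball cannot lower dimension. -/
theorem dim_le_of_injOn {E F : Type*} [NormedAddCommGroup E] [NormedSpace ℝ E] [FiniteDimensional ℝ E]
    [NormedAddCommGroup F] [NormedSpace ℝ F] [FiniteDimensional ℝ F] (f : E → F) (x0 : E) (r : ℝ)
    (hr : 0 < r) (hc : ContinuousOn f (Metric.closedBall x0 r))
    (hi : InjOn f (Metric.closedBall x0 r)) : Module.finrank ℝ E ≤ Module.finrank ℝ F := by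
  have eE : E ≃L[ℝ] EF (Module.finrank ℝ E) := ContinuousLinearEquiv.ofFinrankEq (by simp)
  have eF : F ≃L[ℝ] EF (Module.finrank ℝ F) := ContinuousLinearEquiv.ofFinrankEq (by simp)
  set L : EF (Module.finrank ℝ E) →L[ℝ] E := eE.symm.toContinuousLinearMap with hL
  set δ := r / (‖L‖ + 1) with hδ
  have hδ0 : 0 < δ := by positivity
  have hmap : MapsTo (fun z => x0 + δ • L z) (Metric.closedBall 0 1) (Metric.closedBall x0 r) := by
    intro z hz
    simp only [Metric.mem_closedBall, dist_zero_right, dist_self_add_left] at *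
    rw [norm_smul, Real.norm_of_nonneg hδ0.le, hδ, div_mul_eq_mul_div, div_le_iff₀ (by positivity)]
    have := L.le_opNorm z
    have h2 : ‖L‖ * ‖z‖ ≤ ‖L‖ * 1 := by gcongr
    nlinarith
  refine dim_le_aux _ _ (fun z => eF (f (x0 + δ • L z))) ?_ ?_
  · exact eF.continuous.comp_continuousOn (hc.comp (by fun_prop) hmap)
  · intro z hz w hw h
    have h1 := hi (hmap hz) (hmap hw) (eF.injective h)
    have h2 := smul_right_injective E hδ0.ne' (add_left_cancel h1)
    exact eE.symm.injective h2
end PieceD0c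

section PieceN1
set_option linter.unusedSectionVars false
open Filter Topology

section
variable {E : Type*} [NormedAddCommGroup E] [NormedSpace ℝ E] [CompleteSpace E]

/-- the flow generated by a bounded operator -/
def Fl (a : E →L[ℝ] E) (t : ℝ) : E →L[ℝ] E := NormedSpace.exp (t • a)

theorem Fl_zero (a : E →L[ℝ] E) : Fl a 0 = 1 := by simp [Fl]

theorem Fl_add' (a : E →L[ℝ] E) (s t : ℝ) : Fl a (s + t) = Fl a s * Fl a t := by
  let _ : NormedAlgebra ℚ (E →L[ℝ] E) := NormedAlgebra.restrictScalars ℚ ℝ _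
  rw [Fl, add_smul, NormedSpace.exp_add_of_commute ((Commute.refl _).smul_left _ |>.smul_right _)]
  rfl

theorem Fl_add (a : E →L[ℝ] E) (s t : ℝ) (x : E) :
    Fl a (s + t) x = Fl a s (Fl a t x) := by rw [Fl_add']; rfl

theorem Fl_neg_cancel (a : E →L[ℝ] E) (t : ℝ) (x : E) :
    Fl a (-t) (Fl a t x) = x := by rw [← Fl_add, neg_add_cancel, Fl_zero]; rfl

theorem Fl_neg (a : E →L[ℝ] E) (t : ℝ) : Fl (-a) t = Fl a (-t) := by
  rw [Fl, Fl, smul_neg, neg_smul]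

theorem Fl_hasDerivAt (a : E →L[ℝ] E) (t : ℝ) :
    HasDerivAt (Fl a) (Fl a t * a) t :=
  hasDerivAt_exp_smul_const (𝕂 := ℝ) (𝔸 := E →L[ℝ] E) a t

theorem Fl_continuous (a : E →L[ℝ] E) : Continuous (Fl a) :=
  continuous_iff_continuousAt.2 fun t => (Fl_hasDerivAt a t).continuousAt

theorem Fl_lip (a : E →L[ℝ] E) :
    ∃ C, ∀ u : ℝ, |u| ≤ 1 → ‖Fl a u - 1‖ ≤ C * |u| := by
  obtain ⟨C, hC⟩ := (isCompact_Icc (a := (-1:ℝ)) (b := 1)).exists_bound_of_continuousOn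
    (f := fun t => Fl a t * a)
    ((Fl_continuous a).mul continuous_const).continuousOn
  refine ⟨C, fun u hu => ?_⟩
  have := (convex_Icc (-1:ℝ) 1).norm_image_sub_le_of_norm_hasDerivWithin_le
    (fun x _ => (Fl_hasDerivAt a x).hasDerivWithinAt) hC
    (x := 0) (by simp) (y := u) (abs_le.1 hu)
  rw [Fl_zero, sub_zero] at this
  exact this

/-- vectors of forward growth at most `s` -/
def W (a : E →L[ℝ] E) (s : ℝ) : Submodule ℝ E where
  carrier := {x | ∀ ε > 0, ∃ C, ∀ t ≥ 0, ‖Fl a t x‖ ≤ C * Real.exp ((s + ε) * t)}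
  zero_mem' := fun ε _ => ⟨0, fun t _ => by simp⟩
  add_mem' := by
    intro x y hx hy ε hε
    obtain ⟨C, hC⟩ := hx ε hε
    obtain ⟨D, hD⟩ := hy ε hε
    refine ⟨C + D, fun t ht => ?_⟩
    rw [map_add, add_mul]
    exact (norm_add_le _ _).trans (add_le_add (hC t ht) (hD t ht))
  smul_mem' := by
    intro c x hx ε hε
    obtain ⟨C, hC⟩ := hx ε hε
    refine ⟨‖c‖ * C, fun t ht => ?_⟩
    rw [map_smul, norm_smul, mul_assoc]
    exact mul_le_mul_of_nonneg_left (hC t ht) (norm_nonneg _)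

theorem mem_W {a : E →L[ℝ] E} {s : ℝ} {x : E} :
    x ∈ W a s ↔ ∀ ε > 0, ∃ C, ∀ t ≥ 0, ‖Fl a t x‖ ≤ C * Real.exp ((s + ε) * t) := Iff.rfl

theorem W_mono (a : E →L[ℝ] E) {s s' : ℝ} (h : s ≤ s') : W a s ≤ W a s' := by
  intro x hx ε hε
  obtain ⟨C, hC⟩ := hx ε hε
  refine ⟨C, fun t ht => (hC t ht).trans ?_⟩
  have hC0 : 0 ≤ C := by
    have := (norm_nonneg _).trans (hC 0 le_rfl)
    simpa using this
  gcongr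

theorem W_inv (a : E →L[ℝ] E) {s : ℝ} {x : E} (hx : x ∈ W a s) (u : ℝ) : Fl a u x ∈ W a s := by
  intro ε hε
  obtain ⟨C, hC⟩ := hx ε hε
  refine ⟨‖Fl a u‖ * C, fun t ht => ?_⟩
  rw [← Fl_add, add_comm, Fl_add, mul_assoc]
  exact ((Fl a u).le_opNorm _).trans (mul_le_mul_of_nonneg_left (hC t ht) (norm_nonneg _))

variable [FiniteDimensional ℝ E]

theorem W_unif (a : E →L[ℝ] E) (s ε : ℝ) (hε : 0 < ε) :
    ∃ C, 0 ≤ C ∧ ∀ x ∈ W a s, ∀ t ≥ 0, ‖Fl a t x‖ ≤ C * Real.exp ((s + ε) * t) * ‖x‖ := by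
  have := banach_steinhaus (E := W a s) (F := E) (ι := {t : ℝ // 0 ≤ t}) (σ₁₂ := RingHom.id ℝ)
    (g := fun t => Real.exp (-((s + ε) * t)) • ((Fl a t).comp (W a s).subtypeL)) (by
      intro x
      obtain ⟨C, hC⟩ := x.2 ε hε
      refine ⟨C, fun t => ?_⟩
      have := hC t t.2
      simp only [FunLike.coe_smul, Pi.smul_apply, ContinuousLinearMap.comp_apply,
        Submodule.subtypeL_apply, norm_smul, Real.norm_eq_abs, Real.abs_exp]
      rw [Real.exp_neg, inv_mul_le_iff₀ (Real.exp_pos _)]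
      linarith)
  obtain ⟨C, hC⟩ := this
  refine ⟨max C 0, le_max_right _ _, fun x hx t ht => ?_⟩
  have h1 := (ContinuousLinearMap.le_opNorm _ (⟨x, hx⟩ : W a s)).trans
    (mul_le_mul_of_nonneg_right (hC ⟨t, ht⟩) (norm_nonneg _))
  simp only [FunLike.coe_smul, Pi.smul_apply, ContinuousLinearMap.comp_apply,
        Submodule.subtypeL_apply, norm_smul, Real.norm_eq_abs, Real.abs_exp] at h1
  rw [Real.exp_neg, inv_mul_le_iff₀ (Real.exp_pos _)] at h1
  refine h1.trans ?_
  have : C ≤ max C 0 := le_max_left _ _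
  have h2 : ‖(⟨x, hx⟩ : W a s)‖ = ‖x‖ := rfl
  rw [h2, mul_comm (max C 0), mul_assoc]
  gcongr

theorem W_disjoint (a : E →L[ℝ] E) {s s' : ℝ} (h : s < s') {x : E} (hx : x ∈ W a s)
    (hx' : x ∈ W (-a) (-s')) : x = 0 := by
  set ε := (s' - s) / 3 with hε
  have hε0 : 0 < ε := by rw [hε]; linarith
  obtain ⟨C, hC0, hC⟩ := W_unif (-a) (-s') ε hε0
  obtain ⟨D, hD⟩ := hx ε hε0
  have hb : ∀ t ≥ 0, ‖x‖ ≤ C * D * Real.exp (-(ε * t)) := by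
    intro t ht
    have h1 := hC (Fl a t x) (by
      have := W_inv (-a) hx' (-t)
      rwa [Fl_neg, neg_neg] at this) t ht
    rw [Fl_neg, Fl_neg_cancel] at h1
    refine h1.trans ((mul_le_mul_of_nonneg_left (hD t ht) (by positivity)).trans (le_of_eq ?_))
    have : C * Real.exp ((-s' + ε) * t) * (D * Real.exp ((s + ε) * t))
      = C * D * (Real.exp ((-s' + ε) * t) * Real.exp ((s + ε) * t)) := by ring
    rw [this, ← Real.exp_add]
    congr 2
    have : s' = s + 3 * ε := by rw [hε]; ring
    rw [this]; ring
  have ht : Tendsto (fun t : ℝ => C * D * Real.exp (-(ε * t))) atTop (𝓝 (C * D * 0)) := by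
    refine Tendsto.const_mul _ (Real.tendsto_exp_neg_atTop_nhds_zero.comp ?_)
    exact tendsto_id.const_mul_atTop hε0
  have := ge_of_tendsto ht ((eventually_ge_atTop 0).mono hb)
  rw [mul_zero] at this
  exact norm_le_zero_iff.1 this
end

variable {d : ℕ}

/-- the generator as a continuous linear map on `Fin d → ℝ` -/
def Gen (A : Matrix (Fin d) (Fin d) ℝ) : (Fin d → ℝ) →L[ℝ] (Fin d → ℝ) :=
  (Matrix.toLin' A).toContinuousLinearMap

/-- coordinates -/
def eqv (d : ℕ) : Euc d ≃L[ℝ] (Fin d → ℝ) := EuclideanSpace.equiv (Fin d) ℝ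

theorem Gen_neg (A : Matrix (Fin d) (Fin d) ℝ) : Gen (-A) = - Gen A := by
  ext; simp [Gen]

theorem eqv_linFlow (A : Matrix (Fin d) (Fin d) ℝ) (t : ℝ) (x : Euc d) :
    eqv d (linFlow A t x) = Fl (Gen A) t (eqv d x) := by
  let _ : NormedRing (Matrix (Fin d) (Fin d) ℝ) := Matrix.linftyOpNormedRing
  let _ : NormedAlgebra ℝ (Matrix (Fin d) (Fin d) ℝ) := Matrix.linftyOpNormedAlgebra
  let _ : NormedAlgebra ℚ (Matrix (Fin d) (Fin d) ℝ) := NormedAlgebra.restrictScalars ℚ ℝ _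
  let f : Matrix (Fin d) (Fin d) ℝ →ₐ[ℝ] ((Fin d → ℝ) →L[ℝ] (Fin d → ℝ)) :=
    AlgHom.ofLinearMap (LinearMap.toContinuousLinearMap.toLinearMap.comp
      (Matrix.toLin' (R := ℝ) (m := Fin d) (n := Fin d)).toLinearMap)
      (by ext; simp) (by intro x y; ext; simp [Matrix.toLin'_mul])
  have hc : Continuous f := f.toLinearMap.continuous_of_finiteDimensional
  have h := NormedSpace.map_exp f hc (t • A)
  have h2 : f (t • A) = t • Gen A := by rw [map_smul]; rfl
  rw [Fl, ← h2, ← h]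
  rfl
end PieceN1

section PieceN2
open Filter Topology
variable {d : ℕ}

/-- real part of complex vectors -/
def reL (d : ℕ) : (Fin d → ℂ) →L[ℝ] (Fin d → ℝ) :=
  ContinuousLinearMap.pi fun i => Complex.reCLM.comp (ContinuousLinearMap.proj i)

theorem reL_apply (v : Fin d → ℂ) (i : Fin d) : reL d v i = (v i).re := rfl

theorem norm_reL_le (v : Fin d → ℂ) : ‖reL d v‖ ≤ ‖v‖ := by
  refine (pi_norm_le_iff_of_nonneg (norm_nonneg _)).2 fun i => ?_
  exact (Complex.abs_re_le_norm (v i)).trans (norm_le_pi_norm v i)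

/-- complexified generator -/
def GenC (A : Matrix (Fin d) (Fin d) ℝ) : (Fin d → ℂ) →L[ℂ] (Fin d → ℂ) :=
  (Matrix.toLin' (A.map Complex.ofReal)).toContinuousLinearMap

theorem reL_GenC (A : Matrix (Fin d) (Fin d) ℝ) (v : Fin d → ℂ) :
    reL d (GenC A v) = Gen A (reL d v) := by
  ext i
  simp [reL_apply, GenC, Gen, Matrix.mulVec, dotProduct]

theorem exp_apply_hasSum {𝕜 V : Type*} [RCLike 𝕜] [NormedAddCommGroup V] [NormedSpace 𝕜 V]
    [CompleteSpace V] (a : V →L[𝕜] V) (v : V) :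
    HasSum (fun n : ℕ => ((n.factorial : 𝕜)⁻¹) • (a ^ n) v) (NormedSpace.exp a v) := by
  have := NormedSpace.exp_series_hasSum_exp' (𝕂 := 𝕜) a
  have h2 := this.mapL (ContinuousLinearMap.apply 𝕜 V v)
  simpa only [ContinuousLinearMap.apply_apply, FunLike.coe_smul, Pi.smul_apply] using h2

theorem reL_exp (A : Matrix (Fin d) (Fin d) ℝ) (t : ℝ) (v : Fin d → ℂ) :
    reL d (NormedSpace.exp ((t:ℂ) • GenC A) v) = Fl (Gen A) t (reL d v) := by
  have h1 := (reL d).hasSum (exp_apply_hasSum (𝕜 := ℂ) ((t:ℂ) • GenC A) v)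
  have h2 := exp_apply_hasSum (𝕜 := ℝ) (t • Gen A) (reL d v)
  refine h1.unique ?_
  have hfun : (fun b : ℕ => reL d (((b.factorial : ℂ))⁻¹ • ((((t:ℂ) • GenC A) ^ b) v)))
      = (fun n : ℕ => ((n.factorial : ℝ)⁻¹) • ((t • Gen A) ^ n) (reL d v)) := ?_
  · rw [hfun]; exact h2
  ext1 n
  have h3 : ∀ (c : ℝ) (w : Fin d → ℂ), reL d ((c:ℂ) • w) = c • reL d w := by
    intro c w; ext i; simp [reL_apply]
  have h4 : ∀ n : ℕ, reL d ((((t:ℂ) • GenC A) ^ n) v) = ((t • Gen A)^n) (reL d v) := by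
    intro n
    induction n with
    | zero => simp
    | succ n ih =>
      rw [pow_succ', pow_succ', mul_apply_eq_comp, mul_apply_eq_comp, ← ih]
      simp only [FunLike.coe_smul, Pi.smul_apply]
      rw [h3, reL_GenC]
  have := h3 ((n.factorial : ℝ)⁻¹) ((((t:ℂ) • GenC A) ^ n) v)
  rw [h4] at this
  simpa using this

theorem gen_growth {V : Type*} [NormedAddCommGroup V] [NormedSpace ℂ V]
    [CompleteSpace V] (a : V →L[ℂ] V) (μ : ℂ) (v : V) (k : ℕ)
    (hv : ((a - μ • 1) ^ k) v = 0) (ε : ℝ) (hε : 0 < ε) :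
    ∃ C, ∀ t : ℝ, ‖NormedSpace.exp ((t:ℂ) • a) v‖ ≤ C * Real.exp (μ.re * t + ε * |t|) := by
  set N := a - μ • 1 with hN
  have hN0 : ∀ n, k ≤ n → (N ^ n) v = 0 := by
    intro n hn
    obtain ⟨j, rfl⟩ := Nat.exists_eq_add_of_le hn
    rw [add_comm, pow_add, mul_apply_eq_comp, hv, map_zero]
  refine ⟨∑ n ∈ Finset.range k, ε⁻¹ ^ n * ‖(N ^ n) v‖, fun t => ?_⟩
  have e1 : (t:ℂ) • a = (t * μ) • 1 + (t:ℂ) • N := by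
    rw [hN, smul_sub, smul_smul]; abel
  have e2 : NormedSpace.exp ((t:ℂ) • a) v
      = Complex.exp (t * μ) • NormedSpace.exp ((t:ℂ) • N) v := by
    let _ : NormedAlgebra ℚ (V →L[ℂ] V) := NormedAlgebra.restrictScalars ℚ ℂ _
    rw [e1, NormedSpace.exp_add_of_commute ((Commute.one_left _).smul_left _)]
    have : NormedSpace.exp (((t:ℂ) * μ) • (1 : V →L[ℂ] V))
        = Complex.exp (t * μ) • 1 := by
      rw [← Algebra.algebraMap_eq_smul_one, ← NormedSpace.algebraMap_exp_comm,
        Algebra.algebraMap_eq_smul_one, Complex.exp_eq_exp_ℂ]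
    rw [this]; simp
  have e3 : NormedSpace.exp ((t:ℂ) • N) v
      = ∑ n ∈ Finset.range k, ((n.factorial : ℂ)⁻¹) • (((t:ℂ) • N) ^ n) v := by
    refine (exp_apply_hasSum (𝕜 := ℂ) ((t:ℂ) • N) v).unique (hasSum_sum_of_ne_finset_zero ?_)
    intro n hn
    rw [smul_pow, FunLike.coe_smul, Pi.smul_apply, hN0 n (by simpa using hn), smul_zero, smul_zero]
  rw [e2, norm_smul, Complex.norm_exp, Real.exp_add]
  have e4 : ((t:ℂ) * μ).re = μ.re * t := by simp [mul_comm]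
  rw [e4]
  have e5 : ‖NormedSpace.exp ((t:ℂ) • N) v‖ ≤
      (∑ n ∈ Finset.range k, ε⁻¹ ^ n * ‖(N ^ n) v‖) * Real.exp (ε * |t|) := by
    rw [e3, Finset.sum_mul]
    refine (norm_sum_le _ _).trans (Finset.sum_le_sum fun n _ => ?_)
    rw [smul_pow, FunLike.coe_smul, Pi.smul_apply, norm_smul, norm_smul, norm_pow, norm_inv,
      Complex.norm_real, Complex.norm_natCast, Real.norm_eq_abs]
    have h := Real.pow_div_factorial_le_exp (ε * |t|) (by positivity) n
    have h2 : (n.factorial:ℝ)⁻¹ * (|t| ^ n * ‖(N^n) v‖)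
      = (ε⁻¹ ^ n * ‖(N ^ n) v‖) * ((ε * |t|)^n / n.factorial) := by
      rw [mul_pow, inv_pow]; field_simp
    rw [h2]
    exact mul_le_mul_of_nonneg_left h (by positivity)
  calc _ ≤ Real.exp (μ.re * t) * ((∑ n ∈ Finset.range k, ε⁻¹ ^ n * ‖(N ^ n) v‖) * Real.exp (ε * |t|)) := by gcongr
    _ = _ := by ring

/-- two-sided growth -/
def Gr {E : Type*} [NormedAddCommGroup E] [NormedSpace ℝ E] [CompleteSpace E]
    (a : E →L[ℝ] E) (s : ℝ) (x : E) : Prop := x ∈ W a s ∧ x ∈ W (-a) (-s)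

theorem gr_re (A : Matrix (Fin d) (Fin d) ℝ) (μ : ℂ) (v : Fin d → ℂ) (k : ℕ)
    (hv : ((GenC A - μ • 1) ^ k) v = 0) : Gr (Gen A) μ.re (reL d v) := by
  constructor
  · intro ε hε
    obtain ⟨C, hC⟩ := gen_growth (GenC A) μ v k hv ε hε
    refine ⟨C, fun t ht => ?_⟩
    rw [← reL_exp]
    refine (norm_reL_le _).trans ((hC t).trans (le_of_eq ?_))
    rw [abs_of_nonneg ht]; ring_nf
  · intro ε hε
    obtain ⟨C, hC⟩ := gen_growth (GenC A) μ v k hv ε hε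
    refine ⟨C, fun t ht => ?_⟩
    rw [Fl_neg, ← reL_exp]
    refine (norm_reL_le _).trans ((hC (-t)).trans (le_of_eq ?_))
    rw [abs_neg, abs_of_nonneg ht]; ring_nf

theorem span_gr (A : Matrix (Fin d) (Fin d) ℝ) :
    Submodule.span ℝ {x | ∃ s, Gr (Gen A) s x} = ⊤ := by
  rw [eq_top_iff]
  intro x _
  have key : ∀ v : Fin d → ℂ, reL d v ∈ Submodule.span ℝ {x | ∃ s, Gr (Gen A) s x} := by
    intro v
    have hv : v ∈ ⨆ μ, Module.End.maxGenEigenspace (GenC A : (Fin d → ℂ) →ₗ[ℂ] (Fin d → ℂ)) μ := by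
      rw [Module.End.iSup_maxGenEigenspace_eq_top]; trivial
    refine Submodule.iSup_induction _ (motive := fun v => reL d v ∈
      Submodule.span ℝ {x | ∃ s, Gr (Gen A) s x}) hv ?_ ?_ ?_
    · intro μ w hw
      rw [Module.End.mem_maxGenEigenspace] at hw
      obtain ⟨k, hk⟩ := hw
      refine Submodule.subset_span ⟨μ.re, gr_re A μ w k ?_⟩
      have : ∀ n : ℕ, ∀ w, ((GenC A - μ • 1) ^ n) w
        = (((GenC A : (Fin d → ℂ) →ₗ[ℂ] (Fin d → ℂ)) - μ • 1) ^ n) w := by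
        intro n
        induction n with
        | zero => intro w; simp
        | succ n ih =>
          intro w
          rw [pow_succ, pow_succ, mul_apply_eq_comp, Module.End.mul_apply, ih]
          simp
      rw [this, hk]
    · rw [map_zero]; exact Submodule.zero_mem _
    · intro v w hv hw; rw [map_add]; exact Submodule.add_mem _ hv hw
  have h := key (fun i => (x i : ℂ))
  have e : reL d (fun i => (x i : ℂ)) = x := by ext i; simp [reL_apply]
  rwa [e] at h
end PieceN2

section PieceN3
open Filter Topology
variable {d : ℕ}

theorem limsup_iff (N : ℝ → ℝ) (hc : Continuous N) (hpos : ∀ t, 0 < N t) (c C K : ℝ) (hc0 : 0 < c)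
    (hlow : ∀ t ≥ 0, c * Real.exp (-(K * t)) ≤ N t) (hup : ∀ t ≥ 0, N t ≤ C * Real.exp (K * t)) (s : ℝ) :
    limsup (fun t => Real.log (N t) / t) atTop ≤ s ↔
      ∀ ε > 0, ∃ D, ∀ t ≥ 0, N t ≤ D * Real.exp ((s + ε) * t) := by
  have hC0 : 0 < C := by
    have := (hpos 0).trans_le (hup 0 le_rfl); simpa using this
  have general : ∀ D r δ : ℝ, 0 < D → 0 < δ → (∀ t ≥ 0, N t ≤ D * Real.exp (r * t)) →
      ∀ᶠ t in atTop, Real.log (N t) / t ≤ r + δ := by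
    intro D r δ hD hδ h
    filter_upwards [eventually_ge_atTop (max 1 (Real.log D / δ))] with t ht
    have ht1 : 1 ≤ t := (le_max_left _ _).trans ht
    have ht2 : Real.log D / δ ≤ t := (le_max_right _ _).trans ht
    rw [div_le_iff₀ hδ] at ht2
    rw [div_le_iff₀ (by linarith)]
    have := Real.log_le_log (hpos t) (h t (by linarith))
    rw [Real.log_mul hD.ne' (Real.exp_pos _).ne', Real.log_exp] at this
    nlinarith
  have hlow' : ∀ᶠ t in atTop, -(K + 1) ≤ Real.log (N t) / t := by
    filter_upwards [eventually_ge_atTop (max 1 (-Real.log c))] with t ht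
    have ht1 : 1 ≤ t := (le_max_left _ _).trans ht
    have ht2 : -Real.log c ≤ t := (le_max_right _ _).trans ht
    rw [le_div_iff₀ (by linarith)]
    have := Real.log_le_log (by positivity) (hlow t (by linarith))
    rw [Real.log_mul hc0.ne' (Real.exp_pos _).ne', Real.log_exp] at this
    nlinarith
  have hcob : IsCoboundedUnder (· ≤ ·) atTop (fun t => Real.log (N t) / t) :=
    IsBoundedUnder.isCoboundedUnder_le ⟨-(K+1), by simpa using hlow'⟩
  have hbd : IsBoundedUnder (· ≤ ·) atTop (fun t => Real.log (N t) / t) :=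
    ⟨K + 1, by simpa using general C K 1 hC0 one_pos hup⟩
  constructor
  · intro h ε hε
    have h1 : ∀ᶠ t in atTop, Real.log (N t) / t < s + ε :=
      eventually_lt_of_limsup_lt (lt_of_le_of_lt h (by linarith)) hbd
    obtain ⟨T, hT⟩ := eventually_atTop.1 h1
    obtain ⟨B, hB⟩ := (isCompact_Icc (a := (0:ℝ)) (b := max T 1)).exists_bound_of_continuousOn
      (f := fun t => N t * Real.exp (-((s + ε) * t))) (by fun_prop)
    refine ⟨max B 1, fun t ht => ?_⟩
    have hexp : 0 < Real.exp ((s + ε) * t) := Real.exp_pos _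
    rcases le_or_gt t (max T 1) with h2 | h2
    · have h3 := (le_abs_self _).trans (hB t ⟨ht, h2⟩)
      rw [Real.exp_neg, ← div_eq_mul_inv, div_le_iff₀ hexp] at h3
      exact h3.trans (mul_le_mul_of_nonneg_right (le_max_left _ _) hexp.le)
    · have h4 := hT t ((le_max_left _ _).trans h2.le)
      have ht0 : 0 < t := lt_of_lt_of_le one_pos ((le_max_right _ _).trans h2.le)
      rw [div_lt_iff₀ ht0] at h4
      have := (Real.log_le_iff_le_exp (hpos t)).1 h4.le
      refine this.trans ?_
      exact le_mul_of_one_le_left hexp.le (le_max_right _ _)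
  · intro h
    refine le_of_forall_pos_le_add fun ε hε => ?_
    obtain ⟨D, hD⟩ := h (ε/2) (by linarith)
    have hD0 : 0 < D := by
      have := (hpos 0).trans_le (hD 0 le_rfl); simpa using this
    refine limsup_le_of_le hcob ?_
    filter_upwards [general D (s + ε/2) (ε/2) hD0 (by linarith) hD] with t ht
    linarith

section
variable {E : Type*} [NormedAddCommGroup E] [NormedSpace ℝ E] [CompleteSpace E]
  [FiniteDimensional ℝ E]

theorem NF_neg {a : E →L[ℝ] E} {b : Module.Basis (Fin d) ℝ E} {l : Fin d → ℝ}
    (h : ∀ i, Gr a (l i) (b i)) : ∀ i, Gr (-a) ((fun i => - l i) i) (b i) := fun i => by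
  refine ⟨(h i).2, ?_⟩
  simpa using (h i).1

theorem NF_mem_W {a : E →L[ℝ] E} {b : Module.Basis (Fin d) ℝ E} {l : Fin d → ℝ}
    (h : ∀ i, Gr a (l i) (b i)) (s : ℝ) (x : E) :
    x ∈ W a s ↔ ∀ i, s < l i → b.repr x i = 0 := by
  classical
  have hsub : ∀ y : E, (∀ i, s < l i → b.repr y i = 0) → y ∈ W a s := by
    intro y hy
    rw [← b.sum_repr y]
    refine Submodule.sum_mem _ fun i _ => ?_
    by_cases hi : s < l i
    · rw [hy i hi, zero_smul]; exact Submodule.zero_mem _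
    · exact Submodule.smul_mem _ _ (W_mono a (not_lt.1 hi) (h i).1)
  refine ⟨fun hx i hi => ?_, hsub x⟩
  set J := Finset.univ.filter (fun k => s < l k) with hJ
  have hne : J.Nonempty := ⟨i, by simp [hJ, hi]⟩
  set s' := J.inf' hne l with hs'
  have hss : s < s' := by
    rw [hs', Finset.lt_inf'_iff]; intro k hk; simpa [hJ] using hk
  set z : E := ∑ k, (if s < l k then 0 else b.repr x k) • b k with hz
  have hzr : ∀ k, b.repr z k = if s < l k then 0 else b.repr x k := by
    intro k; rw [hz, b.repr_sum_self]
  have hzW : z ∈ W a s := hsub z fun k hk => by rw [hzr, if_pos hk]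
  have hyW : x - z ∈ W (-a) (-s') := by
    rw [← b.sum_repr (x - z)]
    refine Submodule.sum_mem _ fun k _ => ?_
    by_cases hk : s < l k
    · refine Submodule.smul_mem _ _ (W_mono (-a) ?_ (h k).2)
      rw [neg_le_neg_iff]
      exact Finset.inf'_le _ (by simp [hJ, hk])
    · rw [map_sub, Finsupp.sub_apply, hzr, if_neg hk, sub_self, zero_smul]
      exact Submodule.zero_mem _
  have h0 := W_disjoint a hss (Submodule.sub_mem _ hx hzW) hyW
  rw [sub_eq_zero.1 h0, hzr, if_pos hi]

theorem NF_mem_Wneg {a : E →L[ℝ] E} {b : Module.Basis (Fin d) ℝ E} {l : Fin d → ℝ}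
    (h : ∀ i, Gr a (l i) (b i)) (s : ℝ) (x : E) :
    x ∈ W (-a) (-s) ↔ ∀ i, l i < s → b.repr x i = 0 := by
  rw [NF_mem_W (NF_neg h)]
  simp

theorem NF_finrank {a : E →L[ℝ] E} {b : Module.Basis (Fin d) ℝ E} {l : Fin d → ℝ}
    (h : ∀ i, Gr a (l i) (b i)) (s : ℝ) :
    Module.finrank ℝ (W a s) = Fintype.card {i // l i ≤ s} := by
  have e : W a s = Submodule.span ℝ (Set.range (fun i : {i // l i ≤ s} => b i)) := by
    apply le_antisymm
    · intro x hx
      rw [NF_mem_W h] at hx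
      rw [← b.sum_repr x]
      refine Submodule.sum_mem _ fun i _ => ?_
      by_cases hi : s < l i
      · rw [hx i hi, zero_smul]; exact Submodule.zero_mem _
      · exact Submodule.smul_mem _ _ (Submodule.subset_span ⟨⟨i, not_lt.1 hi⟩, rfl⟩)
    · rw [Submodule.span_le]
      rintro _ ⟨i, rfl⟩
      exact W_mono a i.2 (h i).1
  rw [e, finrank_span_eq_card]
  exact b.linearIndependent.comp _ Subtype.val_injective

theorem NF_top {a : E →L[ℝ] E} {b : Module.Basis (Fin d) ℝ E} {l : Fin d → ℝ}
    (h : ∀ i, Gr a (l i) (b i)) : ∃ S, ∀ x, x ∈ W a S := by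
  refine ⟨∑ i, |l i|, fun x => (NF_mem_W h _ _).2 fun i hi => ?_⟩
  have := Finset.single_le_sum (f := fun i => |l i|) (fun i _ => abs_nonneg _) (Finset.mem_univ i)
  have h2 := le_abs_self (l i)
  linarith
end

theorem exists_NF (A : Matrix (Fin d) (Fin d) ℝ) :
    ∃ (b : Module.Basis (Fin d) ℝ (Fin d → ℝ)) (l : Fin d → ℝ), Monotone l ∧
      ∀ i, Gr (Gen A) (l i) (b i) := by
  have hs := span_gr A
  let b0 := Module.Basis.ofSpan hs.ge
  have hb0 : ∀ i, ∃ s, Gr (Gen A) s (b0 i) := by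
    intro i
    have := Module.Basis.ofSpan_subset hs.ge (Set.mem_range_self i)
    exact this
  have : Fintype _ := FiniteDimensional.fintypeBasisIndex b0
  have hcard := Module.finrank_eq_card_basis b0
  rw [Module.finrank_fin_fun] at hcard
  let b1 := b0.reindex (Fintype.equivFinOfCardEq hcard.symm)
  have hb1 : ∀ i, ∃ s, Gr (Gen A) s (b1 i) := fun i => by
    simp only [b1, Module.Basis.reindex_apply]; exact hb0 _
  choose l hl using hb1
  let σ := Tuple.sort l
  refine ⟨b1.reindex σ.symm, l ∘ σ, Tuple.monotone_sort l, fun i => ?_⟩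
  rw [Module.Basis.reindex_apply]
  exact hl _

theorem lyapSet_iff (A : Matrix (Fin d) (Fin d) ℝ) (s : ℝ) (x : Euc d) :
    x ∈ lyapSet A s ↔ eqv d x ∈ W (Gen A) s := by
  by_cases hx : x = 0
  · subst hx
    rw [map_zero]
    exact iff_of_true (Or.inl rfl) (Submodule.zero_mem _)
  have hx' : eqv d x ≠ 0 := by simpa using hx
  obtain ⟨b, l, -, hbl⟩ := exists_NF A
  obtain ⟨S1, hS1⟩ := NF_top hbl
  obtain ⟨S2, hS2⟩ := NF_top (NF_neg hbl)
  obtain ⟨C1, hC1, h1⟩ := W_unif (Gen A) S1 1 one_pos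
  obtain ⟨C2, hC2, h2⟩ := W_unif (-Gen A) S2 1 one_pos
  obtain ⟨p, hp, hp2⟩ : ∃ p > 0, ∀ y : Euc d, ‖y‖ ≤ p * ‖eqv d y‖ := by
    refine ⟨‖((eqv d).symm : (Fin d → ℝ) →L[ℝ] Euc d)‖ + 1, by positivity, fun y => ?_⟩
    have := ((eqv d).symm : (Fin d → ℝ) →L[ℝ] Euc d).le_opNorm (eqv d y)
    simp only [ContinuousLinearEquiv.coe_coe, ContinuousLinearEquiv.symm_apply_apply] at this
    nlinarith [norm_nonneg (eqv d y)]
  obtain ⟨q, hq, hq2⟩ : ∃ q > 0, ∀ y : Euc d, ‖eqv d y‖ ≤ q * ‖y‖ := by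
    refine ⟨‖((eqv d) : Euc d →L[ℝ] (Fin d → ℝ))‖ + 1, by positivity, fun y => ?_⟩
    have := ((eqv d) : Euc d →L[ℝ] (Fin d → ℝ)).le_opNorm y
    simp only [ContinuousLinearEquiv.coe_coe] at this
    nlinarith [norm_nonneg y]
  have hlf : ∀ t, linFlow A t x = (eqv d).symm (Fl (Gen A) t (eqv d x)) := fun t => by
    rw [← eqv_linFlow, ContinuousLinearEquiv.symm_apply_apply]
  have hcont : Continuous (fun t => ‖linFlow A t x‖) := by
    simp_rw [hlf]
    exact ((eqv d).symm.continuous.comp ((Fl_continuous _).clm_apply continuous_const)).norm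
  have hpos : ∀ t, 0 < ‖linFlow A t x‖ := by
    intro t
    rw [norm_pos_iff, hlf]
    intro h0
    rw [map_eq_zero_iff _ (eqv d).symm.injective] at h0
    have := Fl_neg_cancel (Gen A) t (eqv d x)
    rw [h0, map_zero] at this
    exact hx' this.symm
  set K := max (S1 + 1) (S2 + 1) with hK
  have key := limsup_iff (fun t => ‖linFlow A t x‖) hcont hpos (‖eqv d x‖ / ((C2 + 1) * q))
    (p * (C1 * ‖eqv d x‖)) K (by have := norm_pos_iff.2 hx'; positivity) (by
      intro t ht
      rw [div_mul_eq_mul_div, div_le_iff₀ (by positivity), Real.exp_neg, ← div_eq_mul_inv,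
        div_le_iff₀ (Real.exp_pos _)]
      have := h2 (Fl (Gen A) t (eqv d x)) (hS2 _) t ht
      rw [Fl_neg, Fl_neg_cancel, ← eqv_linFlow] at this
      refine this.trans ?_
      have h3 := hq2 (linFlow A t x)
      have h4 : Real.exp ((S2 + 1) * t) ≤ Real.exp (K * t) := by
        gcongr; exact le_max_right _ _
      calc C2 * Real.exp ((S2 + 1) * t) * ‖eqv d (linFlow A t x)‖ ≤
          (C2 + 1) * Real.exp (K * t) * (q * ‖linFlow A t x‖) := by gcongr; linarith
        _ = _ := by ring) (by
      intro t ht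
      refine (hp2 _).trans ?_
      rw [eqv_linFlow]
      have := h1 (eqv d x) (hS1 _) t ht
      have h4 : Real.exp ((S1 + 1) * t) ≤ Real.exp (K * t) := by
        gcongr; exact le_max_left _ _
      calc p * ‖(Fl (Gen A) t) (eqv d x)‖ ≤ p * (C1 * Real.exp (K * t) * ‖eqv d x‖) := by
            gcongr; exact this.trans (by gcongr)
        _ = _ := by ring) s
  have e1 : x ∈ lyapSet A s ↔ limsup (fun t => Real.log ‖linFlow A t x‖ / t) atTop ≤ s := by
    constructor
    · rintro (h | h)
      · exact absurd h hx
      · exact h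
    · intro h; exact Or.inr h
  rw [e1, key, mem_W]
  constructor
  · intro h ε hε
    obtain ⟨D, hD⟩ := h ε hε
    refine ⟨q * D, fun t ht => ?_⟩
    rw [← eqv_linFlow, mul_assoc]
    exact (hq2 _).trans (mul_le_mul_of_nonneg_left (hD t ht) hq.le)
  · intro h ε hε
    obtain ⟨D, hD⟩ := h ε hε
    refine ⟨p * D, fun t ht => ?_⟩
    rw [mul_assoc]
    refine (hp2 _).trans (mul_le_mul_of_nonneg_left ?_ hp.le)
    rw [eqv_linFlow]; exact hD t ht

theorem lyapExp_NF (A : Matrix (Fin d) (Fin d) ℝ) (b : Module.Basis (Fin d) ℝ (Fin d → ℝ))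
    (l : Fin d → ℝ) (hm : Monotone l) (h : ∀ i, Gr (Gen A) (l i) (b i)) (j : Fin d) :
    lyapExp A j = l j := by
  have hell : ∀ s, ell A s = Fintype.card {i // l i ≤ s} := by
    intro s
    rw [← NF_finrank h s, ell]
    have e : Submodule.span ℝ (lyapSet A s) = (W (Gen A) s).comap ((eqv d).toLinearEquiv : Euc d →ₗ[ℝ] (Fin d → ℝ)) := by
      have : lyapSet A s = ((W (Gen A) s).comap ((eqv d).toLinearEquiv : Euc d →ₗ[ℝ] (Fin d → ℝ)) : Set (Euc d)) := by
        ext x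
        rw [lyapSet_iff]; rfl
      rw [this, Submodule.span_eq]
    rw [e]
    exact LinearEquiv.finrank_eq ((eqv d).toLinearEquiv.ofSubmodule' _)
  have hset : {s : ℝ | (j : ℕ) + 1 ≤ ell A s} = Set.Ici (l j) := by
    ext s
    simp only [Set.mem_ofPred_eq, Set.mem_Ici, hell]
    rw [Fintype.card_subtype]
    constructor
    · intro hcard
      by_contra hlt
      push Not at hlt
      have hsub : Finset.univ.filter (fun i => l i ≤ s) ⊆ Finset.univ.filter (fun i : Fin d => i < j) := by
        intro i hi
        simp only [Finset.mem_filter, Finset.mem_univ, true_and] at hi ⊢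
        by_contra hij
        have := hm (not_lt.1 hij)
        linarith
      have h2 := Finset.card_le_card hsub
      have h3 : (Finset.univ.filter (fun i : Fin d => i < j)).card = j := by
        rw [show Finset.univ.filter (fun i : Fin d => i < j) = Finset.Iio j by ext; rw [Finset.mem_filter, Finset.mem_Iio]; simp only [Finset.mem_univ, true_and], Fin.card_Iio]
      omega
    · intro hs
      have hsub : Finset.univ.filter (fun i : Fin d => i ≤ j) ⊆ Finset.univ.filter (fun i => l i ≤ s) := by
        intro i hi
        simp only [Finset.mem_filter, Finset.mem_univ, true_and] at hi ⊢
        exact (hm hi).trans hs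
      have h2 := Finset.card_le_card hsub
      have h3 : (Finset.univ.filter (fun i : Fin d => i ≤ j)).card = j + 1 := by
        rw [show Finset.univ.filter (fun i : Fin d => i ≤ j) = Finset.Iic j by ext; rw [Finset.mem_filter, Finset.mem_Iic]; simp only [Finset.mem_univ, true_and], Fin.card_Iic]
      omega
  rw [lyapExp, hset, csInf_Ici]

theorem lyapExp_neg (A : Matrix (Fin d) (Fin d) ℝ) (j : Fin d) :
    lyapExp (-A) j = - lyapExp A (Fin.rev j : Fin d) := by
  obtain ⟨b, l, hm, h⟩ := exists_NF A
  rw [lyapExp_NF A b l hm h]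
  refine lyapExp_NF (-A) (b.reindex Fin.revPerm) (fun i => - l (Fin.rev i)) ?_ ?_ j
  · intro i k hik
    exact neg_le_neg (hm (Fin.rev_le_rev.2 hik))
  · intro i
    rw [Gen_neg, Module.Basis.reindex_apply]
    exact NF_neg h (Fin.rev i)
end PieceN3

section PieceN4
open Filter Topology
variable {d : ℕ}

/-- coordinate projector on the block with exponent `s` -/
def Pr (l : Fin d → ℝ) (s : ℝ) (x : Fin d → ℝ) : Fin d → ℝ := fun k => if l k = s then x k else 0

theorem Pr_sub (l : Fin d → ℝ) (s : ℝ) (x y : Fin d → ℝ) : Pr l s (x - y) = Pr l s x - Pr l s y := by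
  ext k; simp only [Pr, Pi.sub_apply]; split_ifs <;> simp

theorem Pr_add (l : Fin d → ℝ) (s : ℝ) (x y : Fin d → ℝ) : Pr l s (x + y) = Pr l s x + Pr l s y := by
  ext k; simp only [Pr, Pi.add_apply]; split_ifs <;> simp

theorem Pr_smul (l : Fin d → ℝ) (s c : ℝ) (x : Fin d → ℝ) : Pr l s (c • x) = c • Pr l s x := by
  ext k; simp only [Pr, Pi.smul_apply]; split_ifs <;> simp

theorem Pr_Pr (l : Fin d → ℝ) (s : ℝ) (x : Fin d → ℝ) : Pr l s (Pr l s x) = Pr l s x := by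
  ext k; simp only [Pr]; split_ifs <;> simp

theorem Pr_norm (l : Fin d → ℝ) (s : ℝ) (x : Fin d → ℝ) : ‖Pr l s x‖ ≤ ‖x‖ := by
  rw [pi_norm_le_iff_of_nonneg (norm_nonneg _)]
  intro k
  simp only [Pr]
  split_ifs
  · exact norm_le_pi_norm x k
  · simp

structure SFlow (F : ℝ → (Fin d → ℝ) →L[ℝ] (Fin d → ℝ)) (l : Fin d → ℝ) : Prop where
  zero : ∀ x, F 0 x = x
  add : ∀ s t x, F (s + t) x = F s (F t x)
  lip : ∃ C, 0 ≤ C ∧ ∀ u x, |u| ≤ 1 → ‖F u x - x‖ ≤ C * |u| * ‖x‖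
  comm : ∀ t s x, F t (Pr l s x) = Pr l s (F t x)
  gr : ∀ ε > 0, ∃ C > 0, ∀ t s x, ‖F t (Pr l s x)‖ ≤ C * Real.exp (s * t + ε * |t|) * ‖Pr l s x‖

theorem exists_SFlow (A : Matrix (Fin d) (Fin d) ℝ) :
    ∃ (T : Euc d ≃L[ℝ] (Fin d → ℝ)) (F : ℝ → (Fin d → ℝ) →L[ℝ] (Fin d → ℝ)) (l : Fin d → ℝ),
      Monotone l ∧ (∀ j : Fin d, lyapExp A j = l j) ∧ SFlow F l ∧
      ∀ t x, T (linFlow A t x) = F t (T x) := by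
  obtain ⟨b, l, hm, h⟩ := exists_NF A
  set a := Gen A with ha
  let S : (Fin d → ℝ) ≃L[ℝ] (Fin d → ℝ) := b.equivFunL
  have hS : ∀ x k, S x k = b.repr x k := fun x k => rfl
  let F : ℝ → (Fin d → ℝ) →L[ℝ] (Fin d → ℝ) := fun t =>
    (S : (Fin d → ℝ) →L[ℝ] (Fin d → ℝ)).comp ((Fl a t).comp (S.symm : (Fin d → ℝ) →L[ℝ] (Fin d → ℝ)))
  have hF : ∀ t x, F t x = S (Fl a t (S.symm x)) := fun t x => rfl
  have hFlneg : ∀ t, Fl a t = Fl (-a) (-t) := fun t => by rw [Fl_neg, neg_neg]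
  have memW : ∀ s x, S.symm (Pr l s x) ∈ W a s := fun s x => by
    rw [NF_mem_W h]
    intro i hi
    rw [← hS, ContinuousLinearEquiv.apply_symm_apply]
    simp only [Pr]; rw [if_neg (by linarith)]
  have memW' : ∀ s x, S.symm (Pr l s x) ∈ W (-a) (-s) := fun s x => by
    rw [NF_mem_Wneg h]
    intro i hi
    rw [← hS, ContinuousLinearEquiv.apply_symm_apply]
    simp only [Pr]; rw [if_neg (by linarith)]
  have supp : ∀ t s x j, l j ≠ s → F t (Pr l s x) j = 0 := by
    intro t s x j hj
    rw [hF, hS]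
    rcases lt_or_gt_of_ne hj with h1 | h1
    · refine (NF_mem_Wneg h s _).1 ?_ j h1
      rw [hFlneg]
      exact W_inv (-a) (memW' s x) _
    · exact (NF_mem_W h s _).1 (W_inv a (memW s x) t) j h1
  obtain ⟨q, hq, hq2⟩ : ∃ q > 0, ∀ y, ‖S y‖ ≤ q * ‖y‖ := by
    refine ⟨‖(S : (Fin d → ℝ) →L[ℝ] (Fin d → ℝ))‖ + 1, by positivity, fun y => ?_⟩
    have := (S : (Fin d → ℝ) →L[ℝ] (Fin d → ℝ)).le_opNorm y
    simp only [ContinuousLinearEquiv.coe_coe] at this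
    nlinarith [norm_nonneg y]
  obtain ⟨p, hp, hp2⟩ : ∃ q > 0, ∀ y, ‖S.symm y‖ ≤ q * ‖y‖ := by
    refine ⟨‖(S.symm : (Fin d → ℝ) →L[ℝ] (Fin d → ℝ))‖ + 1, by positivity, fun y => ?_⟩
    have := (S.symm : (Fin d → ℝ) →L[ℝ] (Fin d → ℝ)).le_opNorm y
    simp only [ContinuousLinearEquiv.coe_coe] at this
    nlinarith [norm_nonneg y]
  refine ⟨(eqv d).trans S, F, l, hm, lyapExp_NF A b l hm h, ?_, ?_⟩
  swap
  · intro t x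
    rw [hF]
    simp only [ContinuousLinearEquiv.trans_apply, ContinuousLinearEquiv.symm_apply_apply]
    rw [eqv_linFlow]
  refine ⟨?_, ?_, ?_, ?_, ?_⟩
  · intro x
    rw [hF, Fl_zero]; simp
  · intro s t x
    rw [hF, hF, hF, Fl_add, ContinuousLinearEquiv.symm_apply_apply]
  · obtain ⟨C, hC⟩ := Fl_lip a
    refine ⟨q * (|C| * p), by positivity, fun u x hu => ?_⟩
    have e : F u x - x = S ((Fl a u - 1) (S.symm x)) := by
      rw [hF]; simp
    rw [e]
    calc ‖S ((Fl a u - 1) (S.symm x))‖ ≤ q * ‖(Fl a u - 1) (S.symm x)‖ := hq2 _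
      _ ≤ q * (‖Fl a u - 1‖ * ‖S.symm x‖) := by gcongr; exact ContinuousLinearMap.le_opNorm _ _
      _ ≤ q * ((|C| * |u|) * (p * ‖x‖)) := by
          gcongr
          · exact (hC u hu).trans (mul_le_mul_of_nonneg_right (le_abs_self _) (abs_nonneg _))
          · exact hp2 _
      _ = _ := by ring
  · intro t s x
    have hx : x = ∑ k, x k • (Pi.single k (1:ℝ) : Fin d → ℝ) := by
      ext j; simp [Finset.sum_apply, Pi.single_apply]
    let L1 : (Fin d → ℝ) →ₗ[ℝ] (Fin d → ℝ) :=
      { toFun := fun x => F t (Pr l s x)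
        map_add' := fun x y => by rw [Pr_add, map_add]
        map_smul' := fun c x => by rw [Pr_smul, map_smul]; rfl }
    let L2 : (Fin d → ℝ) →ₗ[ℝ] (Fin d → ℝ) :=
      { toFun := fun x => Pr l s (F t x)
        map_add' := fun x y => by rw [map_add, Pr_add]
        map_smul' := fun c x => by rw [map_smul, Pr_smul]; rfl }
    have : L1 = L2 := by
      refine (Pi.basisFun ℝ (Fin d)).ext fun k => ?_
      rw [Pi.basisFun_apply]
      show F t (Pr l s (Pi.single k 1)) = Pr l s (F t (Pi.single k 1))
      have e1 : Pr l (l k) (Pi.single k (1:ℝ)) = Pi.single k 1 := by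
        ext j; simp only [Pr, Pi.single_apply]
        by_cases hj : j = k
        · subst hj; simp
        · simp [hj]
      by_cases hk : l k = s
      · subst hk
        rw [e1]
        ext j
        simp only [Pr]
        split_ifs with hj
        · rfl
        · rw [← e1]; exact supp t _ _ _ hj
      · have e2 : Pr l s (Pi.single k (1:ℝ)) = 0 := by
          ext j; simp only [Pr, Pi.single_apply]
          by_cases hj : j = k
          · subst hj; simp [hk]
          · simp [hj]
        rw [e2, map_zero]
        ext j
        simp only [Pr]
        split_ifs with hj
        · rw [← e1, supp]
          · rfl
          · rw [hj]; exact Ne.symm hk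
        · rfl
    exact LinearMap.congr_fun this x
  · intro ε hε
    have key : ∀ s, ∃ C > 0, ∀ t x, ‖F t (Pr l s x)‖ ≤ C * Real.exp (s * t + ε * |t|) * ‖Pr l s x‖ := by
      intro s
      obtain ⟨C1, hC1, h1⟩ := W_unif a s ε hε
      obtain ⟨C2, hC2, h2⟩ := W_unif (-a) (-s) ε hε
      refine ⟨q * ((C1 + C2 + 1) * p), by positivity, fun t x => ?_⟩
      rw [hF]
      have hb : ‖Fl a t (S.symm (Pr l s x))‖ ≤
          (C1 + C2 + 1) * Real.exp (s * t + ε * |t|) * ‖S.symm (Pr l s x)‖ := by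
        rcases le_total 0 t with ht | ht
        · refine (h1 _ (memW s x) t ht).trans ?_
          rw [abs_of_nonneg ht]
          have : (s + ε) * t = s * t + ε * t := by ring
          rw [this]
          gcongr; linarith
        · rw [hFlneg]
          refine (h2 _ (memW' s x) (-t) (by linarith)).trans ?_
          rw [abs_of_nonpos ht]
          have : (-s + ε) * -t = s * t + ε * -t := by ring
          rw [this]
          gcongr; linarith
      calc _ ≤ q * ‖Fl a t (S.symm (Pr l s x))‖ := hq2 _
        _ ≤ q * ((C1 + C2 + 1) * Real.exp (s * t + ε * |t|) * (p * ‖Pr l s x‖)) := by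
          gcongr
          exact hb.trans (by gcongr; exact hp2 _)
        _ = _ := by ring
    choose C hC hC2 using key
    refine ⟨∑ i, C (l i) + 1, ?_, fun t s x => ?_⟩
    · have : 0 ≤ ∑ i, C (l i) := Finset.sum_nonneg fun i _ => (hC _).le
      linarith
    by_cases hs : ∃ i, l i = s
    · obtain ⟨i, rfl⟩ := hs
      refine (hC2 (l i) t x).trans ?_
      gcongr
      have := Finset.single_le_sum (f := fun i => C (l i)) (fun i _ => (hC _).le) (Finset.mem_univ i)
      linarith
    · have : Pr l s x = 0 := by
        ext k; simp only [Pr]; rw [if_neg (fun hk => hs ⟨k, hk⟩)]; rfl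
      rw [this, map_zero]; simp

theorem SFlow_neg {F : ℝ → (Fin d → ℝ) →L[ℝ] (Fin d → ℝ)} {l : Fin d → ℝ} (hF : SFlow F l)
    (hs : ∀ x, Tendsto (fun t => F t x) atTop (𝓝 0)) (i : Fin d) : l i < 0 := by
  by_contra hi
  push Not at hi
  have h1 : Tendsto (fun t => ∑ k, ‖F t (Pi.single k 1)‖) atTop (𝓝 0) := by
    have : Tendsto (fun t => ∑ k, ‖F t (Pi.single k 1)‖) atTop (𝓝 (∑ k : Fin d, 0)) :=
      tendsto_finsetSum _ fun k _ => by simpa using (hs (Pi.single k 1)).norm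
    simpa using this
  obtain ⟨T, hT, hT1⟩ := ((h1.eventually (gt_mem_nhds (show (0:ℝ) < 1/2 by norm_num))).and
    (eventually_ge_atTop 1)).exists
  have h2 : ∀ x, ‖F T x‖ ≤ 1/2 * ‖x‖ := by
    intro x
    have hx : x = ∑ k, x k • (Pi.single k (1:ℝ) : Fin d → ℝ) := by
      ext j; simp [Finset.sum_apply, Pi.single_apply]
    calc ‖F T x‖ = ‖∑ k, x k • F T (Pi.single k (1:ℝ))‖ := by
          conv_lhs => rw [hx]
          rw [map_sum]; simp only [map_smul]
      _ ≤ ∑ k, ‖x k • F T (Pi.single k (1:ℝ))‖ := norm_sum_le _ _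
      _ ≤ ∑ k, ‖x‖ * ‖F T (Pi.single k (1:ℝ))‖ := by
          gcongr with k
          rw [norm_smul]
          gcongr
          exact norm_le_pi_norm x k
      _ = ‖x‖ * ∑ k, ‖F T (Pi.single k (1:ℝ))‖ := by rw [Finset.mul_sum]
      _ ≤ ‖x‖ * (1/2) := by gcongr
      _ = _ := by ring
  have h3 : ∀ (n : ℕ) x, ‖F (n * T) x‖ ≤ (1/2)^n * ‖x‖ := by
    intro n
    induction n with
    | zero => intro x; simp [hF.zero]
    | succ n ih =>
      intro x
      have : ((n + 1 : ℕ) : ℝ) * T = T + n * T := by push_cast; ring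
      rw [this, hF.add]
      refine (h2 _).trans ?_
      rw [pow_succ]
      linarith [ih x]
  set e : Fin d → ℝ := Pi.single i 1 with he
  have hPe : Pr l (l i) e = e := by
    ext j; simp only [Pr, he, Pi.single_apply]
    by_cases hj : j = i
    · subst hj; simp
    · simp [hj]
  have hT0 : 0 < T := by linarith
  have hl2 : 0 < Real.log 2 := Real.log_pos (by norm_num)
  obtain ⟨C, hC, h4⟩ := hF.gr (Real.log 2 / (2 * T)) (by positivity)
  have h5 : ∀ n : ℕ, ‖e‖ ≤ C * Real.exp (-(Real.log 2 / 2) * n) * ‖e‖ := by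
    intro n
    have e1 : F (-(n * T)) (Pr l (l i) (F (n * T) e)) = e := by
      rw [← hF.comm, hPe, ← hF.add, neg_add_cancel, hF.zero]
    have h6 := h4 (-(n * T)) (l i) (F (n * T) e)
    rw [e1, ← hF.comm, hPe] at h6
    have hn : (0:ℝ) ≤ n * T := by positivity
    rw [abs_neg, abs_of_nonneg hn] at h6
    have h7 : Real.log 2 / (2 * T) * (n * T) = Real.log 2 / 2 * n := by field_simp
    rw [h7] at h6
    have h8 : ((1:ℝ)/2)^n = Real.exp (-(Real.log 2) * n) := by
      rw [← Real.exp_log (show (0:ℝ) < 1/2 by norm_num), ← Real.exp_nat_mul]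
      congr 1
      rw [Real.log_div (by norm_num) (by norm_num), Real.log_one]; ring
    have h9 := h3 n e
    rw [h8] at h9
    calc ‖e‖ ≤ _ := h6
      _ ≤ C * Real.exp (Real.log 2 / 2 * n) * (Real.exp (-(Real.log 2) * n) * ‖e‖) := by
        gcongr
        nlinarith
      _ = C * (Real.exp (Real.log 2 / 2 * n) * Real.exp (-(Real.log 2) * n)) * ‖e‖ := by ring
      _ = _ := by rw [← Real.exp_add]; congr 3; ring
  have hepos : 0 < ‖e‖ := by
    rw [norm_pos_iff, he]; intro h0
    have := congrFun h0 i; simp at this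
  have h6 : Tendsto (fun n : ℕ => C * Real.exp (-(Real.log 2 / 2) * n) * ‖e‖) atTop (𝓝 (C * 0 * ‖e‖)) := by
    refine (Tendsto.const_mul _ ?_).mul_const _
    refine Real.tendsto_exp_atBot.comp ?_
    exact tendsto_natCast_atTop_atTop.const_mul_atTop_of_neg (by linarith)
  have := ge_of_tendsto' h6 h5
  simp at this
  exact (norm_pos_iff.1 hepos) this
end PieceN4

section PieceN5
set_option linter.unusedSectionVars false
open Filter Topology
section
variable {E : Type*} [NormedAddCommGroup E] [NormedSpace ℝ E]

/-- adapted norm -/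
def AN (F : ℝ → E → E) (η : ℝ) (x : E) : ℝ := ⨆ t : {t : ℝ // 0 ≤ t}, Real.exp (η * t) * ‖F t x‖

structure PreF (F : ℝ → E → E) (η C : ℝ) : Prop where
  zero : ∀ x, F 0 x = x
  add : ∀ s t x, F (s + t) x = F s (F t x)
  sub : ∀ t x y, F t (x - y) = F t x - F t y
  smul : ∀ t (c : ℝ) x, F t (c • x) = c • F t x
  bd : ∀ t, 0 ≤ t → ∀ x, Real.exp (η * t) * ‖F t x‖ ≤ C * ‖x‖

variable {F : ℝ → E → E} {η C : ℝ}

theorem AN_bdd (h : PreF F η C) (x : E) :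
    BddAbove (Set.range fun t : {t : ℝ // 0 ≤ t} => Real.exp (η * t) * ‖F t x‖) :=
  ⟨C * ‖x‖, by rintro _ ⟨t, rfl⟩; exact h.bd t t.2 x⟩

theorem AN_ge (h : PreF F η C) (x : E) {t : ℝ} (ht : 0 ≤ t) : Real.exp (η * t) * ‖F t x‖ ≤ AN F η x :=
  le_ciSup (AN_bdd h x) ⟨t, ht⟩

theorem AN_le {x : E} {a : ℝ} (ha : ∀ t, 0 ≤ t → Real.exp (η * t) * ‖F t x‖ ≤ a) : AN F η x ≤ a := by
  have : Nonempty {t : ℝ // 0 ≤ t} := ⟨⟨0, le_rfl⟩⟩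
  exact ciSup_le fun t => ha t t.2

theorem AN_norm (h : PreF F η C) (x : E) : ‖x‖ ≤ AN F η x := by
  simpa [h.zero] using AN_ge h x le_rfl

theorem AN_up (h : PreF F η C) (x : E) : AN F η x ≤ C * ‖x‖ := AN_le fun t ht => h.bd t ht x

theorem AN_tri (h : PreF F η C) (x y : E) : AN F η x ≤ AN F η y + C * ‖x - y‖ := by
  refine AN_le fun t ht => ?_
  have e : F t x = F t y + F t (x - y) := by rw [h.sub]; abel
  rw [e]
  calc _ ≤ Real.exp (η * t) * (‖F t y‖ + ‖F t (x - y)‖) := by gcongr; exact norm_add_le _ _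
    _ = Real.exp (η * t) * ‖F t y‖ + Real.exp (η * t) * ‖F t (x - y)‖ := by ring
    _ ≤ _ := add_le_add (AN_ge h y ht) (h.bd t ht _)

theorem AN_dec (h : PreF F η C) (x : E) {τ : ℝ} (hτ : 0 ≤ τ) :
    AN F η (F τ x) ≤ Real.exp (-(η * τ)) * AN F η x := by
  refine AN_le fun t ht => ?_
  rw [← h.add]
  have := AN_ge h x (add_nonneg ht hτ)
  rw [mul_add, Real.exp_add] at this
  rw [Real.exp_neg, ← div_eq_inv_mul, le_div_iff₀ (Real.exp_pos _)]
  linarith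

theorem AN_smul (h : PreF F η C) (x : E) {c : ℝ} (hc : 0 < c) : AN F η (c • x) ≤ c * AN F η x := by
  refine AN_le fun t ht => ?_
  rw [h.smul, norm_smul, Real.norm_of_nonneg hc.le]
  have := AN_ge h x ht
  nlinarith [mul_le_mul_of_nonneg_left this hc.le]

/-- `N` is an adapted norm for `F`. -/
structure Adp (N : E → ℝ) (F : ℝ → E → E) (η C : ℝ) : Prop where
  low : ∀ x, ‖x‖ ≤ N x
  up : ∀ x, N x ≤ C * ‖x‖
  tri : ∀ x y, N x ≤ N y + C * ‖x - y‖
  dec : ∀ x τ, 0 ≤ τ → N (F τ x) ≤ Real.exp (-(η * τ)) * N x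

/-- flows with a single growth rate -/
structure GF (F : ℝ → E → E) (s : ℝ) : Prop where
  zero : ∀ x, F 0 x = x
  add : ∀ s t x, F (s + t) x = F s (F t x)
  sub : ∀ t x y, F t (x - y) = F t x - F t y
  lip : ∃ C, 0 ≤ C ∧ ∀ u x, |u| ≤ 1 → ‖F u x - x‖ ≤ C * |u| * ‖x‖
  gr : ∀ ε > 0, ∃ C > 0, ∀ t x, ‖F t x‖ ≤ C * Real.exp (s * t + ε * |t|) * ‖x‖

theorem GF.F0 {s : ℝ} (h : GF F s) (t : ℝ) : F t 0 = 0 := by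
  have := h.sub t 0 0
  simpa using this

theorem GF.cancel {s : ℝ} (h : GF F s) (t : ℝ) (x : E) : F (-t) (F t x) = x := by
  rw [← h.add, neg_add_cancel, h.zero]

theorem GF.cancel' {s : ℝ} (h : GF F s) (t : ℝ) (x : E) : F t (F (-t) x) = x := by
  rw [← h.add, add_neg_cancel, h.zero]

theorem GF.cont {s : ℝ} (h : GF F s) (t : ℝ) : Continuous (F t) := by
  obtain ⟨C, hC, hb⟩ := h.gr 1 one_pos
  refine continuous_iff_continuousAt.2 fun x => ?_
  rw [ContinuousAt, tendsto_iff_norm_sub_tendsto_zero]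
  refine squeeze_zero (fun _ => norm_nonneg _)
    (g := fun y => C * Real.exp (s * t + 1 * |t|) * ‖y - x‖) (fun y => ?_) ?_
  · rw [← h.sub]; exact hb t _
  · have : Continuous fun y => C * Real.exp (s * t + 1 * |t|) * ‖y - x‖ := by fun_prop
    have := this.tendsto x
    simpa using this

theorem GF.cont_t {s : ℝ} (h : GF F s) (x : E) : Continuous (fun t => F t x) := by
  obtain ⟨C, hC, hb⟩ := h.lip
  refine continuous_iff_continuousAt.2 fun t => ?_
  rw [ContinuousAt, tendsto_iff_norm_sub_tendsto_zero]
  refine squeeze_zero' (Eventually.of_forall fun _ => norm_nonneg _)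
    (g := fun u => C * |u - t| * ‖F t x‖) ?_ ?_
  · filter_upwards [Metric.ball_mem_nhds t one_pos] with u hu
    have e : F u x = F (u - t) (F t x) := by rw [← h.add]; congr 1; ring
    rw [e]
    apply hb
    rw [Metric.mem_ball, Real.dist_eq] at hu; exact hu.le
  · have : Continuous fun u => C * |u - t| * ‖F t x‖ := by fun_prop
    have := this.tendsto t
    simpa using this

theorem Adp.cont {N : E → ℝ} (h : Adp N F η C) : Continuous N := by
  refine continuous_iff_continuousAt.2 fun x => ?_
  rw [ContinuousAt, tendsto_iff_norm_sub_tendsto_zero]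
  refine squeeze_zero (fun _ => norm_nonneg _) (g := fun y => C * ‖y - x‖) (fun y => ?_) ?_
  · rw [Real.norm_eq_abs, abs_le]
    have h1 := h.tri y x
    have h2 := h.tri x y
    rw [norm_sub_rev x y] at h2
    constructor <;> linarith
  · have : Continuous fun y => C * ‖y - x‖ := by fun_prop
    have := this.tendsto x
    simpa using this

theorem Adp.strict {N : E → ℝ} {s : ℝ} (h : Adp N F η C) (hF : GF F s) (hη : 0 < η) {x : E}
    (hx : x ≠ 0) : StrictMono fun t => N (F (-t) x) := by
  intro t t' htt
  have hne : F (-t') x ≠ 0 := by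
    intro h0
    have := hF.cancel' t' x
    rw [h0, hF.F0] at this
    exact hx this.symm
  have hpos : 0 < N (F (-t') x) := (norm_pos_iff.2 hne).trans_le (h.low _)
  have := h.dec (F (-t') x) (t' - t) (by linarith)
  rw [← hF.add] at this
  have e : t' - t + -t' = -t := by ring
  rw [e] at this
  have hlt : Real.exp (-(η * (t' - t))) < 1 := by
    rw [Real.exp_lt_one_iff]; nlinarith
  show N (F (-t) x) < N (F (-t') x)
  nlinarith

theorem Adp.exists_t {N : E → ℝ} {s : ℝ} (h : Adp N F η C) (hF : GF F s) (hη : 0 < η) {x : E}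
    (hx : x ≠ 0) : ∃ t, N (F (-t) x) = 1 := by
  have hc : Continuous fun t => N (F (-t) x) := h.cont.comp ((hF.cont_t x).comp continuous_neg)
  have hpos : 0 < N x := (norm_pos_iff.2 hx).trans_le (h.low _)
  set T := |Real.log (N x)| / η with hT
  have hT0 : 0 ≤ T := by positivity
  have hηT : η * T = |Real.log (N x)| := by rw [hT]; field_simp
  have h1 : N (F (- -T) x) ≤ 1 := by
    rw [neg_neg]
    refine (h.dec x T hT0).trans ?_
    rw [hηT]
    nth_rw 2 [← Real.exp_log hpos]
    rw [← Real.exp_add, Real.exp_le_one_iff]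
    linarith [le_abs_self (Real.log (N x))]
  have h2 : 1 ≤ N (F (-T) x) := by
    have := h.dec (F (-T) x) T hT0
    rw [hF.cancel', hηT] at this
    have h3 : 1 ≤ Real.exp |Real.log (N x)| * N x := by
      nth_rw 2 [← Real.exp_log hpos]
      rw [← Real.exp_add, Real.one_le_exp_iff]
      linarith [neg_abs_le (Real.log (N x))]
    rw [Real.exp_neg, ← div_eq_inv_mul, le_div_iff₀ (Real.exp_pos _)] at this
    linarith
  exact mem_range_of_exists_le_of_exists_ge hc ⟨-T, h1⟩ ⟨T, h2⟩

open Classical in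
/-- hitting time of the unit sphere of `N` -/
def hitT (N : E → ℝ) (F : ℝ → E → E) (x : E) : ℝ := if h : ∃ t, N (F (-t) x) = 1 then h.choose else 0

theorem hitT_spec {N : E → ℝ} {s : ℝ} (h : Adp N F η C) (hF : GF F s) (hη : 0 < η) {x : E}
    (hx : x ≠ 0) : N (F (-hitT N F x) x) = 1 := by
  have := h.exists_t hF hη hx
  rw [hitT, dif_pos this]
  exact this.choose_spec

theorem hitT_unique {N : E → ℝ} {s : ℝ} (h : Adp N F η C) (hF : GF F s) (hη : 0 < η) {x : E}
    (hx : x ≠ 0) {t : ℝ} (ht : N (F (-t) x) = 1) : hitT N F x = t :=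
  (h.strict hF hη hx).injective ((hitT_spec h hF hη hx).trans ht.symm)

open Classical in
/-- the conjugacy between `F` and `F'` -/
def cj (N : E → ℝ) (F F' : ℝ → E → E) (x : E) : E :=
  if x = 0 then 0 else F' (hitT N F x) (F (-hitT N F x) x)

variable {F' : ℝ → E → E} {N : E → ℝ} {s : ℝ}

theorem cj_zero : cj N F F' 0 = 0 := by simp [cj]

theorem cj_of {x : E} (hx : x ≠ 0) : cj N F F' x = F' (hitT N F x) (F (-hitT N F x) x) := by
  simp [cj, hx]

theorem F_ne (hF : GF F s) (t : ℝ) {x : E} (hx : x ≠ 0) : F t x ≠ 0 := by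
  intro h0
  have := hF.cancel t x
  rw [h0, hF.F0] at this
  exact hx this.symm

theorem cj_inv (h : Adp N F η C) (hF : GF F s) (h' : Adp N F' η C) (hF' : GF F' s) (hη : 0 < η)
    (x : E) : cj N F' F (cj N F F' x) = x := by
  by_cases hx : x = 0
  · rw [hx, cj_zero, cj_zero]
  have hne : cj N F F' x ≠ 0 := by
    rw [cj_of hx]; exact F_ne hF' _ (F_ne hF _ hx)
  have ht : hitT N F' (cj N F F' x) = hitT N F x := by
    apply hitT_unique h' hF' hη hne
    rw [cj_of hx, hF'.cancel]
    exact hitT_spec h hF hη hx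
  rw [cj_of hne, ht, cj_of hx, hF'.cancel, hF.cancel']

theorem cj_conj (h : Adp N F η C) (hF : GF F s) (hF' : GF F' s) (hη : 0 < η)
    (u : ℝ) (x : E) : cj N F F' (F u x) = F' u (cj N F F' x) := by
  by_cases hx : x = 0
  · rw [hx, hF.F0, cj_zero, hF'.F0]
  have hne := F_ne hF u hx
  have ht : hitT N F (F u x) = u + hitT N F x := by
    apply hitT_unique h hF hη hne
    rw [← hF.add]
    have : -(u + hitT N F x) + u = -hitT N F x := by ring
    rw [this]
    exact hitT_spec h hF hη hx
  rw [cj_of hne, ht, cj_of hx, ← hF.add, ← hF'.add]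
  congr 2
  ring
end
end PieceN5

section PieceN6
open Filter Topology
section
variable {E : Type*} [NormedAddCommGroup E] [NormedSpace ℝ E]
variable {F F' : ℝ → E → E} {N : E → ℝ} {η C s : ℝ}

set_option maxHeartbeats 1000000 in
theorem cj_holder (hC : 1 ≤ C) (h : Adp N F η C) (hF : GF F s) (hF' : GF F' s) (hη : 0 < η)
    (hs : s < 0) {γ : ℝ} (hγ0 : 0 < γ) (hγ1 : γ < 1) :
    ∃ K, 0 ≤ K ∧ ∀ x y, N x ≤ 1 → N y ≤ 1 → ‖cj N F F' x - cj N F F' y‖ ≤ K * ‖x - y‖ ^ γ := by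
  set ε := -s * (1 - γ) / (1 + γ) with hε
  set σ := -s + ε with hσ
  have hε0 : 0 < ε := by
    rw [hε]; apply div_pos (mul_pos (by linarith) (by linarith)) (by linarith)
  have hσ0 : 0 < σ := by linarith
  have hσγ : s + ε = -(γ * σ) := by
    rw [hσ, hε]; field_simp; ring
  obtain ⟨K1, hK1, g1⟩ := hF.gr ε hε0
  obtain ⟨K2, hK2, g2⟩ := hF'.gr ε hε0
  obtain ⟨L1, hL1, l1⟩ := hF.lip
  obtain ⟨L2, hL2, l2⟩ := hF'.lip
  have b1 : ∀ t z, 0 ≤ t → ‖F (-t) z‖ ≤ K1 * Real.exp (σ * t) * ‖z‖ := by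
    intro t z ht
    have := g1 (-t) z
    rw [abs_neg, abs_of_nonneg ht, show s * -t + ε * t = σ * t by rw [hσ]; ring] at this
    exact this
  have b2 : ∀ t z, 0 ≤ t → ‖F' t z‖ ≤ K2 * Real.exp (-(γ * σ) * t) * ‖z‖ := by
    intro t z ht
    have := g2 t z
    rw [abs_of_nonneg ht, show s * t + ε * t = -(γ * σ) * t by rw [← hσγ]; ring] at this
    exact this
  set θ0 := min (1/2) (η/2) with hθ0
  have hθ0p : 0 < θ0 := lt_min (by norm_num) (by linarith)
  have hθ1 : θ0 ≤ 1/2 := min_le_left _ _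
  have hθ2 : θ0 ≤ η/2 := min_le_right _ _
  set M := 1 + 2 * (L1 + L2) / η with hM
  have hM0 : 0 < M := by positivity
  set c1 := θ0 / (C * K1) with hc1
  have hCp : 0 < C := by linarith
  have hc1p : 0 < c1 := by positivity
  set Ka := K2 * M * (C * K1) * c1 ^ (1 - γ) with hKa
  set Kb := 2 * K2 * c1 ^ (-γ) with hKb
  have hKa0 : 0 ≤ Ka := by positivity
  have hKb0 : 0 ≤ Kb := by positivity
  have tpos : ∀ x, x ≠ 0 → N x ≤ 1 → 0 ≤ hitT N F x := by
    intro x hx hN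
    by_contra hlt
    push Not at hlt
    have h1 := (h.strict hF hη hx) hlt
    have h2 := hitT_spec h hF hη hx
    simp only [neg_zero, hF.zero] at h1
    linarith
  have hz : ∀ x, x ≠ 0 → ‖F (-hitT N F x) x‖ ≤ 1 := fun x hx =>
    (h.low _).trans (hitT_spec h hF hη hx).le
  have hδ : ∀ t δ : ℝ, 0 ≤ δ → δ ^ γ = (Real.exp (σ * t) * δ) ^ γ * Real.exp (-(γ * σ) * t) := by
    intro t δ hδ
    rw [Real.mul_rpow (Real.exp_pos _).le hδ, ← Real.exp_mul]
    have : Real.exp (σ * t * γ) * Real.exp (-(γ * σ) * t) = 1 := by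
      rw [← Real.exp_add, Real.exp_eq_one_iff]; ring
    linear_combination (-(δ ^ γ)) * this
  have hbd : ∀ x, x ≠ 0 → N x ≤ 1 → ‖cj N F F' x‖ ≤ K2 * Real.exp (-(γ * σ) * hitT N F x) := by
    intro x hx hN
    rw [cj_of hx]
    refine (b2 _ _ (tpos x hx hN)).trans ?_
    exact mul_le_of_le_one_right (by positivity) (hz x hx)
  -- case two
  have case2 : ∀ t δ : ℝ, 0 ≤ δ → c1 ≤ Real.exp (σ * t) * δ →
      2 * (K2 * Real.exp (-(γ * σ) * t)) ≤ Kb * δ ^ γ := by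
    intro t δ hδ0 hge
    rw [hδ t δ hδ0, hKb]
    have h1 : c1 ^ γ ≤ (Real.exp (σ * t) * δ) ^ γ := Real.rpow_le_rpow hc1p.le hge hγ0.le
    have h2 : c1 ^ (-γ) * c1 ^ γ = 1 := by
      rw [← Real.rpow_add hc1p]; simp
    have h3 : 1 ≤ c1 ^ (-γ) * (Real.exp (σ * t) * δ) ^ γ := by
      rw [← h2]; gcongr
    calc 2 * (K2 * Real.exp (-(γ * σ) * t)) = (2 * K2 * Real.exp (-(γ * σ) * t)) * 1 := by ring
      _ ≤ (2 * K2 * Real.exp (-(γ * σ) * t)) * (c1 ^ (-γ) * (Real.exp (σ * t) * δ) ^ γ) := by gcongr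
      _ = _ := by ring
  have main0 : ∀ x, x ≠ 0 → N x ≤ 1 → ‖cj N F F' x‖ ≤ Kb * ‖x‖ ^ γ := by
    intro x hx hN
    have h1 := h.up (F (-hitT N F x) x)
    rw [hitT_spec h hF hη hx] at h1
    have h2 := b1 (hitT N F x) x (tpos x hx hN)
    have h3 : c1 ≤ Real.exp (σ * hitT N F x) * ‖x‖ := by
      rw [hc1, div_le_iff₀ (by positivity)]
      nlinarith
    have h4 := case2 _ _ (norm_nonneg x) h3
    have h5 := hbd x hx hN
    have : 0 ≤ K2 * Real.exp (-(γ * σ) * hitT N F x) := by positivity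
    linarith
  have main1 : ∀ x y, x ≠ 0 → y ≠ 0 → N x ≤ 1 → N y ≤ 1 → hitT N F x ≤ hitT N F y →
      ‖cj N F F' x - cj N F F' y‖ ≤ (Ka + Kb) * ‖x - y‖ ^ γ := by
    intro x y hx hy hNx hNy htt
    have hpow : 0 ≤ ‖x - y‖ ^ γ := Real.rpow_nonneg (norm_nonneg _) _
    have ht0 := tpos x hx hNx
    rcases le_or_gt c1 (Real.exp (σ * hitT N F x) * ‖x - y‖) with hc | hc
    · have h1 := case2 _ _ (norm_nonneg (x - y)) hc
      have h2 := hbd x hx hNx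
      have h3 := hbd y hy hNy
      have h4 : Real.exp (-(γ * σ) * hitT N F y) ≤ Real.exp (-(γ * σ) * hitT N F x) := by
        apply Real.exp_le_exp.2
        have : 0 < γ * σ := by positivity
        nlinarith
      have h5 := norm_sub_le (cj N F F' x) (cj N F F' y)
      have h6 := mul_le_mul_of_nonneg_left h4 hK2.le
      have h7 := mul_nonneg hKa0 hpow
      linarith
    · set t := hitT N F x with ht
      set t' := hitT N F y with ht'
      set D := Real.exp (σ * t) * ‖x - y‖ with hD
      have hD0 : 0 ≤ D := by positivity
      set θ := C * K1 * D with hθ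
      have hθθ : θ ≤ θ0 := by
        rw [hc1, lt_div_iff₀ (by positivity)] at hc
        rw [hθ]; linarith
      have hθnn : 0 ≤ θ := by positivity
      set u := t' - t with hu
      have hu0 : 0 ≤ u := by linarith
      set ξ := F (-t) x with hξ
      set ζ := F (-t') y with hζ
      have hζ1 : ‖ζ‖ ≤ 1 := hz y hy
      have hξy : F u ζ = F (-t) y := by
        rw [hζ, ← hF.add]; congr 1; rw [hu]; ring
      have hdiff : ‖ξ - F u ζ‖ ≤ K1 * D := by
        rw [hξy, hξ, ← hF.sub]
        refine (b1 t _ ht0).trans ?_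
        rw [hD, mul_assoc]
      have hN1 : N ξ = 1 := hitT_spec h hF hη hx
      have hN2 : N ζ = 1 := hitT_spec h hF hη hy
      have h1 : 1 ≤ N (F u ζ) + θ := by
        have := h.tri ξ (F u ζ)
        rw [hN1] at this
        have h2 := mul_le_mul_of_nonneg_left hdiff hCp.le
        rw [hθ]; linarith
      have h2 : N (F u ζ) ≤ Real.exp (-(η * u)) := by
        have := h.dec ζ u hu0
        rwa [hN2, mul_one] at this
      have h3 : η * u ≤ 2 * θ := by
        have h4 : 1 - θ ≤ Real.exp (-(η * u)) := by linarith
        have h5 := Real.add_one_le_exp (η * u)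
        have h6 : Real.exp (-(η * u)) * Real.exp (η * u) = 1 := by
          rw [← Real.exp_add]; simp
        have h7 : (1 - θ) * (η * u + 1) ≤ 1 := by
          have : 0 ≤ η * u := by positivity
          calc (1 - θ) * (η * u + 1) ≤ Real.exp (-(η * u)) * Real.exp (η * u) := by gcongr
            _ = 1 := h6
        have : 0 ≤ η * u := by positivity
        nlinarith
      have hu1 : u ≤ 2 * θ / η := by rw [le_div_iff₀ hη]; linarith
      have hu2 : u ≤ 1 := by
        have : η * u ≤ η * 1 := by linarith
        exact le_of_mul_le_mul_left this hη
      have hl1 : ‖F u ζ - ζ‖ ≤ L1 * u := by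
        have := l1 u ζ (by rw [abs_of_nonneg hu0]; exact hu2)
        rw [abs_of_nonneg hu0] at this
        exact this.trans (mul_le_of_le_one_right (by positivity) hζ1)
      have hl2 : ‖F' u ζ - ζ‖ ≤ L2 * u := by
        have := l2 u ζ (by rw [abs_of_nonneg hu0]; exact hu2)
        rw [abs_of_nonneg hu0] at this
        exact this.trans (mul_le_of_le_one_right (by positivity) hζ1)
      have hsum : ‖ξ - F' u ζ‖ ≤ M * θ := by
        have e : ξ - F' u ζ = (ξ - F u ζ) + (F u ζ - ζ) - (F' u ζ - ζ) := by abel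
        rw [e]
        have k1 := norm_sub_le ((ξ - F u ζ) + (F u ζ - ζ)) (F' u ζ - ζ)
        have k2 := norm_add_le (ξ - F u ζ) (F u ζ - ζ)
        have k3 : K1 * D ≤ θ := by
          rw [hθ]; have : 0 ≤ K1 * D := by positivity
          nlinarith
        have k4 : (L1 + L2) * u ≤ (L1 + L2) * (2 * θ / η) := by gcongr
        have k5 : M * θ = θ + (L1 + L2) * (2 * θ / η) := by rw [hM]; field_simp
        rw [k5]; linarith
      have hfin : ‖cj N F F' x - cj N F F' y‖ ≤ K2 * Real.exp (-(γ * σ) * t) * (M * θ) := by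
        have e : cj N F F' x - cj N F F' y = F' t (ξ - F' u ζ) := by
          rw [cj_of hx, cj_of hy, hF'.sub, ← hF'.add]
          congr 2
          rw [hu]; ring
        rw [e]
        exact (b2 t _ ht0).trans (by gcongr)
      have hDD : D ≤ c1 ^ (1 - γ) * D ^ γ := by
        rcases hD0.eq_or_lt with h0 | h0
        · rw [← h0]; positivity
        · calc D = D ^ (1 - γ) * D ^ γ := by rw [← Real.rpow_add h0]; simp
            _ ≤ _ := by gcongr
      have hlast : K2 * Real.exp (-(γ * σ) * t) * (M * θ) ≤ Ka * ‖x - y‖ ^ γ := by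
        rw [hδ t _ (norm_nonneg (x - y)), hθ, hKa]
        calc K2 * Real.exp (-(γ * σ) * t) * (M * (C * K1 * D)) ≤
            K2 * Real.exp (-(γ * σ) * t) * (M * (C * K1 * (c1 ^ (1 - γ) * D ^ γ))) := by gcongr
          _ = _ := by rw [← hD]; ring
      have h7 := mul_nonneg hKb0 hpow
      linarith
  refine ⟨Ka + Kb, by positivity, fun x y hx hy => ?_⟩
  have hpow : 0 ≤ ‖x - y‖ ^ γ := Real.rpow_nonneg (norm_nonneg _) _
  by_cases x0 : x = 0
  · by_cases y0 : y = 0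
    · rw [x0, y0, sub_self, norm_zero]; positivity
    · have := main0 y y0 hy
      rw [x0, cj_zero, zero_sub, zero_sub, norm_neg, norm_neg]
      refine this.trans ?_
      gcongr; linarith
  · by_cases y0 : y = 0
    · have := main0 x x0 hx
      rw [y0, cj_zero, sub_zero, sub_zero]
      refine this.trans ?_
      gcongr; linarith
    · rcases le_total (hitT N F x) (hitT N F y) with hh | hh
      · exact main1 x y x0 y0 hx hy hh
      · rw [norm_sub_rev, norm_sub_rev x y]
        exact main1 y x y0 x0 hy hx hh

theorem cj_cont (hC : 1 ≤ C) (h : Adp N F η C) (hF : GF F s) (hF' : GF F' s) (hη : 0 < η)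
    (hs : s < 0) : Continuous (cj N F F') := by
  obtain ⟨K, hK, hh⟩ := cj_holder hC h hF hF' hη hs (γ := 1/2) (by norm_num) (by norm_num)
  have loc : ∀ x, N x < 1 → ContinuousAt (cj N F F') x := by
    intro x hx
    rw [ContinuousAt, tendsto_iff_norm_sub_tendsto_zero]
    refine squeeze_zero' (Eventually.of_forall fun _ => norm_nonneg _)
      (g := fun y => K * ‖y - x‖ ^ (1/2 : ℝ)) ?_ ?_
    · filter_upwards [(h.cont.tendsto x).eventually (gt_mem_nhds hx)] with y hy
      exact hh y x hy.le hx.le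
    · have : Continuous fun y => K * ‖y - x‖ ^ (1/2 : ℝ) := by
        refine continuous_const.mul (Continuous.rpow_const (by fun_prop) fun _ => Or.inr (by norm_num))
      have := this.tendsto x
      simpa using this
  refine continuous_iff_continuousAt.2 fun x => ?_
  obtain ⟨u, hu⟩ : ∃ u, N (F u x) < 1 := by
    by_cases hx : x = 0
    · refine ⟨0, ?_⟩
      have := h.up 0
      rw [hF.zero, hx]; simp at this; linarith
    · have h1 := hitT_spec h hF hη hx
      have h2 := h.strict hF hη hx (show hitT N F x - 1 < hitT N F x by linarith)
      exact ⟨_, h2.trans_le h1.le⟩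
  have e : cj N F F' = fun y => F' (-u) (cj N F F' (F u y)) := by
    ext y
    rw [cj_conj h hF hF' hη, hF'.cancel]
  rw [e]
  exact (hF'.cont _).continuousAt.comp (ContinuousAt.comp (loc _ hu) (hF.cont u).continuousAt)
end
end PieceN6

section PieceN7
open Filter Topology
variable {d : ℕ}

/-- local Hölder condition near zero, for general normed spaces -/
def HolZ {E E' : Type*} [NormedAddCommGroup E] [NormedAddCommGroup E'] (γ : ℝ) (f : E → E') : Prop :=
  ∃ r > 0, ∃ K : ℝ, ∀ x ∈ Metric.ball (0 : E) r, ∀ y ∈ Metric.ball (0 : E) r,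
    dist (f x) (f y) ≤ K * dist x y ^ γ

theorem abs_exp_sub_one (y : ℝ) : |Real.exp y - 1| ≤ Real.exp |y| * |y| := by
  have h1 := Real.add_one_le_exp y
  have h2 := Real.add_one_le_exp (-y)
  have h3 : Real.exp (-y) * Real.exp y = 1 := by rw [← Real.exp_add]; simp
  rcases le_total 0 y with h | h
  · rw [abs_of_nonneg h, abs_of_nonneg (by linarith)]
    nlinarith [Real.exp_pos y]
  · rw [abs_of_nonpos h, abs_of_nonpos (by have := Real.exp_le_one_iff.2 h; linarith)]
    have : 1 ≤ Real.exp (-y) := Real.one_le_exp (by linarith)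
    nlinarith

/-- scalar flow -/
def Sc {E : Type*} [NormedAddCommGroup E] [NormedSpace ℝ E] (s : ℝ) (t : ℝ) (x : E) : E :=
  Real.exp (s * t) • x

theorem Sc_lip (s : ℝ) : ∃ C, 0 ≤ C ∧ ∀ u, |u| ≤ 1 → |Real.exp (s * u) - 1| ≤ C * |u| := by
  refine ⟨Real.exp |s| * |s|, by positivity, fun u hu => (abs_exp_sub_one _).trans ?_⟩
  rw [abs_mul, mul_assoc]
  gcongr
  exact mul_le_of_le_one_right (abs_nonneg _) hu

theorem Sc_GF {E : Type*} [NormedAddCommGroup E] [NormedSpace ℝ E] (s : ℝ) :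
    GF (Sc s : ℝ → E → E) s where
  zero x := by simp [Sc]
  add u t x := by simp only [Sc]; rw [smul_smul, ← Real.exp_add]; congr 2; ring
  sub t x y := by simp [Sc, smul_sub]
  lip := by
    obtain ⟨C, hC, h⟩ := Sc_lip s
    refine ⟨C, hC, fun u x hu => ?_⟩
    have : Sc s u x - x = (Real.exp (s * u) - 1) • x := by rw [Sc, sub_smul, one_smul]
    rw [this, norm_smul]
    exact mul_le_mul_of_nonneg_right (h u hu) (norm_nonneg _)
  gr ε hε := by
    refine ⟨1, one_pos, fun t x => ?_⟩
    rw [Sc, norm_smul, Real.norm_of_nonneg (Real.exp_pos _).le, one_mul]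
    gcongr
    have : 0 ≤ ε * |t| := by positivity
    linarith

/-- block flow -/
def Fb (F : ℝ → (Fin d → ℝ) →L[ℝ] (Fin d → ℝ)) (l : Fin d → ℝ) (s t : ℝ) (x : Fin d → ℝ) :
    Fin d → ℝ := F t (Pr l s x) + Real.exp (s * t) • (x - Pr l s x)

variable {F : ℝ → (Fin d → ℝ) →L[ℝ] (Fin d → ℝ)} {l : Fin d → ℝ}

theorem Pr_Fb (hF : SFlow F l) (s t : ℝ) (x : Fin d → ℝ) : Pr l s (Fb F l s t x) = F t (Pr l s x) := by
  rw [Fb, Pr_add, Pr_smul, Pr_sub, Pr_Pr, sub_self, smul_zero, add_zero, ← hF.comm, Pr_Pr]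

theorem Fb_Pr (s t : ℝ) (x : Fin d → ℝ) : Fb F l s t (Pr l s x) = F t (Pr l s x) := by
  rw [Fb, Pr_Pr, sub_self, smul_zero, add_zero]

theorem Fb_smul (t s c : ℝ) (x : Fin d → ℝ) : Fb F l s t (c • x) = c • Fb F l s t x := by
  rw [Fb, Fb, Pr_smul, map_smul, smul_add, smul_comm c (Real.exp (s * t)), ← smul_sub c]

theorem sub_Pr_norm (s : ℝ) (x : Fin d → ℝ) : ‖x - Pr l s x‖ ≤ ‖x‖ := by
  rw [pi_norm_le_iff_of_nonneg (norm_nonneg _)]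
  intro k
  simp only [Pr, Pi.sub_apply]
  split_ifs
  · simp
  · simpa using norm_le_pi_norm x k

theorem Fb_GF (hF : SFlow F l) (s : ℝ) : GF (Fb F l s) s where
  zero x := by simp [Fb, hF.zero]
  add u t x := by
    have e : Fb F l s u (Fb F l s t x) = F u (Pr l s (Fb F l s t x)) +
      Real.exp (s * u) • (Fb F l s t x - Pr l s (Fb F l s t x)) := rfl
    rw [e, Pr_Fb hF, Fb, Fb, ← hF.add, add_sub_cancel_left, smul_smul, ← Real.exp_add, mul_add]
  sub t x y := by
    simp only [Fb]; rw [Pr_sub, map_sub]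
    rw [show x - y - (Pr l s x - Pr l s y) = (x - Pr l s x) - (y - Pr l s y) by abel, smul_sub]
    abel
  lip := by
    obtain ⟨C, hC, h⟩ := Sc_lip s
    obtain ⟨L, hL, h2⟩ := hF.lip
    refine ⟨L + C, by positivity, fun u x hu => ?_⟩
    have : Fb F l s u x - x = (F u (Pr l s x) - Pr l s x) + (Real.exp (s * u) - 1) • (x - Pr l s x) := by
      rw [Fb, sub_smul, one_smul]; abel
    rw [this]
    refine (norm_add_le _ _).trans ?_
    rw [norm_smul, add_mul, add_mul]
    refine add_le_add ((h2 u _ hu).trans ?_) ?_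
    · gcongr; exact Pr_norm _ _ _
    · exact mul_le_mul (h u hu) (sub_Pr_norm _ _) (norm_nonneg _) (by positivity)
  gr ε hε := by
    obtain ⟨C, hC, h⟩ := hF.gr ε hε
    refine ⟨C + 1, by positivity, fun t x => ?_⟩
    rw [Fb]
    refine (norm_add_le _ _).trans ?_
    rw [norm_smul, add_mul, add_mul, Real.norm_of_nonneg (Real.exp_pos _).le]
    refine add_le_add ((h t s x).trans ?_) ?_
    · gcongr; exact Pr_norm _ _ _
    · rw [one_mul]
      refine mul_le_mul ?_ (sub_Pr_norm _ _) (norm_nonneg _) (by positivity)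
      gcongr
      have : 0 ≤ ε * |t| := by positivity
      linarith

theorem Fb_PreF (hF : SFlow F l) {s : ℝ} (hs : s < 0) : ∃ C, 1 ≤ C ∧ PreF (Fb F l s) (-s/2) C := by
  have G := Fb_GF hF s
  obtain ⟨C, hC, h⟩ := G.gr (-s/2) (by linarith)
  refine ⟨max C 1, le_max_right _ _, G.zero, G.add, G.sub, fun t c x => Fb_smul t s c x, ?_⟩
  intro t ht x
  have := h t x
  rw [abs_of_nonneg ht] at this
  calc Real.exp (-s/2 * t) * ‖Fb F l s t x‖ ≤
      Real.exp (-s/2 * t) * (C * Real.exp (s * t + -s/2 * t) * ‖x‖) := by gcongr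
    _ = C * (Real.exp (-s/2 * t) * Real.exp (s * t + -s/2 * t)) * ‖x‖ := by ring
    _ = C * ‖x‖ := by
      rw [← Real.exp_add, show -s/2 * t + (s * t + -s/2 * t) = 0 by ring, Real.exp_zero, mul_one]
    _ ≤ _ := by gcongr; exact le_max_left _ _

theorem AN_nonneg {E : Type*} [NormedAddCommGroup E] [NormedSpace ℝ E] {F : ℝ → E → E} {η C : ℝ}
    (h : PreF F η C) (x : E) : 0 ≤ AN F η x := (norm_nonneg _).trans (AN_norm h x)

/-- the block conjugacy -/
theorem block (hF : SFlow F l) {s : ℝ} (hs : s < 0) :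
    ∃ k k' : (Fin d → ℝ) → (Fin d → ℝ), Continuous k ∧ Continuous k' ∧ k 0 = 0 ∧ k' 0 = 0 ∧
      (∀ x, k' (k x) = x) ∧ (∀ x, k (k' x) = x) ∧
      (∀ t x, k (F t (Pr l s x)) = Real.exp (s * t) • k (Pr l s x)) ∧
      (∀ x, Pr l s (k (Pr l s x)) = k (Pr l s x)) ∧ (∀ x, Pr l s (k' (Pr l s x)) = k' (Pr l s x)) ∧
      ∀ γ, 0 < γ → γ < 1 → HolZ γ k ∧ HolZ γ k' := by
  obtain ⟨C, hC, hp⟩ := Fb_PreF hF hs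
  set η := -s/2 with hη
  have hη0 : 0 < η := by linarith
  set N := AN (Fb F l s) η with hN
  have a1 : Adp N (Fb F l s) η C :=
    ⟨AN_norm hp, AN_up hp, AN_tri hp, fun x τ hτ => AN_dec hp x hτ⟩
  have a2 : Adp N (Sc s) η C := by
    refine ⟨AN_norm hp, AN_up hp, AN_tri hp, fun x τ hτ => ?_⟩
    rw [Sc]
    refine (AN_smul hp x (Real.exp_pos _)).trans ?_
    refine mul_le_mul_of_nonneg_right (Real.exp_le_exp.2 ?_) (AN_nonneg hp x)
    rw [hη]; nlinarith
  have g1 := Fb_GF hF s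
  have g2 : GF (Sc s : ℝ → (Fin d → ℝ) → (Fin d → ℝ)) s := Sc_GF s
  have hball : ∀ x ∈ Metric.ball (0 : Fin d → ℝ) (1 / C), N x ≤ 1 := by
    intro x hx
    rw [mem_ball_zero_iff, lt_div_iff₀ (by linarith)] at hx
    have := a1.up x
    linarith
  refine ⟨cj N (Fb F l s) (Sc s), cj N (Sc s) (Fb F l s), cj_cont hC a1 g1 g2 hη0 hs,
    cj_cont hC a2 g2 g1 hη0 hs, cj_zero, cj_zero, cj_inv a1 g1 a2 g2 hη0, cj_inv a2 g2 a1 g1 hη0,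
    ?_, ?_, ?_, ?_⟩
  · intro t x
    rw [← Fb_Pr, cj_conj a1 g1 g2 hη0]; rfl
  · intro x
    by_cases hx : Pr l s x = 0
    · rw [hx, cj_zero]; ext; simp [Pr]
    · rw [cj_of hx, Sc, Pr_smul, Pr_Fb hF, Pr_Pr, Fb_Pr]
  · intro x
    by_cases hx : Pr l s x = 0
    · rw [hx, cj_zero]; ext; simp [Pr]
    · rw [cj_of hx, Pr_Fb hF]
      simp only [Sc]
      rw [Pr_smul, Pr_Pr, ← Pr_smul, Fb_Pr]
  · intro γ h0 h1
    obtain ⟨K, -, hK⟩ := cj_holder hC a1 g1 g2 hη0 hs h0 h1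
    obtain ⟨K', -, hK'⟩ := cj_holder hC a2 g2 g1 hη0 hs h0 h1
    refine ⟨⟨1 / C, by positivity, K, fun x hx y hy => ?_⟩, ⟨1 / C, by positivity, K', fun x hx y hy => ?_⟩⟩
    · rw [dist_eq_norm, dist_eq_norm]; exact hK x y (hball x hx) (hball y hy)
    · rw [dist_eq_norm, dist_eq_norm]; exact hK' x y (hball x hx) (hball y hy)

theorem Pr_cont (s : ℝ) : Continuous (Pr l s) := by
  refine continuous_pi fun k => ?_
  simp only [Pr]
  split_ifs <;> fun_prop

theorem holZ_pi {ι : Type*} [Fintype ι] {E : Type*} [NormedAddCommGroup E] {γ : ℝ} (hγ : 0 < γ)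
    {f : E → ι → ℝ} (h : ∀ i, HolZ γ (fun x => f x i)) : HolZ γ f := by
  choose r hr K hK using h
  obtain ⟨r0, hr0, hle⟩ : ∃ r0 > 0, ∀ i, r0 ≤ r i := by
    by_cases hn : Nonempty ι
    · refine ⟨Finset.univ.inf' Finset.univ_nonempty r, ?_, fun i => Finset.inf'_le _ (Finset.mem_univ i)⟩
      rw [gt_iff_lt, Finset.lt_inf'_iff]; exact fun i _ => hr i
    · exact ⟨1, one_pos, fun i => absurd ⟨i⟩ hn⟩
  refine ⟨r0, hr0, ∑ i, |K i|, fun x hx y hy => ?_⟩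
  have hnn : 0 ≤ dist x y ^ γ := Real.rpow_nonneg dist_nonneg _
  rw [dist_pi_le_iff (by positivity)]
  intro i
  refine (hK i x (Metric.ball_subset_ball (hle i) hx) y (Metric.ball_subset_ball (hle i) hy)).trans ?_
  gcongr
  exact (le_abs_self _).trans (Finset.single_le_sum (f := fun i => |K i|) (fun i _ => abs_nonneg _) (Finset.mem_univ i))

theorem holZ_block {γ : ℝ} (hγ : 0 < γ) {k : (Fin d → ℝ) → (Fin d → ℝ)} (s : ℝ) (i : Fin d)
    (h : HolZ γ k) : HolZ γ (fun x => k (Pr l s x) i) := by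
  obtain ⟨r, hr, K, hK⟩ := h
  refine ⟨r, hr, |K|, fun x hx y hy => ?_⟩
  rw [mem_ball_zero_iff] at hx hy
  have h1 := hK (Pr l s x) (by rw [mem_ball_zero_iff]; exact (Pr_norm _ _ _).trans_lt hx)
    (Pr l s y) (by rw [mem_ball_zero_iff]; exact (Pr_norm _ _ _).trans_lt hy)
  refine (dist_le_pi_dist _ _ i).trans (h1.trans ?_)
  have h2 : dist (Pr l s x) (Pr l s y) ≤ dist x y := by
    rw [dist_eq_norm, dist_eq_norm, ← Pr_sub]; exact Pr_norm _ _ _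
  have : dist (Pr l s x) (Pr l s y) ^ γ ≤ dist x y ^ γ := Real.rpow_le_rpow dist_nonneg h2 hγ.le
  exact mul_le_mul (le_abs_self _) this (Real.rpow_nonneg dist_nonneg _) (abs_nonneg _)

theorem diagonalize (hF : SFlow F l) (hl : ∀ i, l i < 0) :
    ∃ k : (Fin d → ℝ) ≃ₜ (Fin d → ℝ), k 0 = 0 ∧
      (∀ γ, 0 < γ → γ < 1 → HolZ γ k ∧ HolZ γ k.symm) ∧
      ∀ t x i, k (F t x) i = Real.exp (l i * t) * k x i := by
  have hb := fun i => block hF (hl i)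
  have hb' : ∀ s, ∃ k k' : (Fin d → ℝ) → (Fin d → ℝ), s < 0 → (Continuous k ∧ Continuous k' ∧ k 0 = 0 ∧ k' 0 = 0 ∧
      (∀ x, k' (k x) = x) ∧ (∀ x, k (k' x) = x) ∧
      (∀ t x, k (F t (Pr l s x)) = Real.exp (s * t) • k (Pr l s x)) ∧
      (∀ x, Pr l s (k (Pr l s x)) = k (Pr l s x)) ∧ (∀ x, Pr l s (k' (Pr l s x)) = k' (Pr l s x)) ∧
      ∀ γ, 0 < γ → γ < 1 → HolZ γ k ∧ HolZ γ k') := by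
    intro s
    by_cases hs : s < 0
    · obtain ⟨k, k', h⟩ := block hF hs
      exact ⟨k, k', fun _ => h⟩
    · exact ⟨id, id, fun h => absurd h hs⟩
  choose k k' hk using hb'
  have e1 : ∀ i x, Pr l (l i) (fun i => k (l i) (Pr l (l i) x) i) = k (l i) (Pr l (l i) x) := by
    intro i x
    obtain ⟨-, -, -, -, -, -, -, h8, -, -⟩ := hk (l i) (hl i)
    ext j
    simp only [Pr]
    split_ifs with hj
    · rw [hj]
    · have := congrFun (h8 x) j
      simp only [Pr, if_neg hj] at this
      exact this
  have e2 : ∀ i x, Pr l (l i) (fun i => k' (l i) (Pr l (l i) x) i) = k' (l i) (Pr l (l i) x) := by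
    intro i x
    obtain ⟨-, -, -, -, -, -, -, -, h9, -⟩ := hk (l i) (hl i)
    ext j
    simp only [Pr]
    split_ifs with hj
    · rw [hj]
    · have := congrFun (h9 x) j
      simp only [Pr, if_neg hj] at this
      exact this
  have pri : ∀ i x, Pr l (l i) x i = x i := fun i x => by simp [Pr]
  let kk : (Fin d → ℝ) ≃ₜ (Fin d → ℝ) :=
    { toFun := fun x i => k (l i) (Pr l (l i) x) i
      invFun := fun x i => k' (l i) (Pr l (l i) x) i
      left_inv := fun x => by
        ext i
        obtain ⟨-, -, -, -, h5, -⟩ := hk (l i) (hl i)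
        show k' (l i) (Pr l (l i) (fun i => k (l i) (Pr l (l i) x) i)) i = x i
        rw [e1, h5, pri]
      right_inv := fun x => by
        ext i
        obtain ⟨-, -, -, -, -, h6, -⟩ := hk (l i) (hl i)
        show k (l i) (Pr l (l i) (fun i => k' (l i) (Pr l (l i) x) i)) i = x i
        rw [e2, h6, pri]
      continuous_toFun := continuous_pi fun i =>
        (continuous_apply i).comp ((hk (l i) (hl i)).1.comp (Pr_cont _))
      continuous_invFun := continuous_pi fun i =>
        (continuous_apply i).comp ((hk (l i) (hl i)).2.1.comp (Pr_cont _)) }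
  refine ⟨kk, ?_, ?_, ?_⟩
  · ext i
    obtain ⟨-, -, h3, -⟩ := hk (l i) (hl i)
    show k (l i) (Pr l (l i) 0) i = 0
    have : Pr l (l i) 0 = 0 := by ext; simp [Pr]
    rw [this, h3]; rfl
  · intro γ h0 h1
    refine ⟨holZ_pi h0 fun i => ?_, holZ_pi h0 fun i => ?_⟩
    · obtain ⟨-, -, -, -, -, -, -, -, -, h10⟩ := hk (l i) (hl i)
      exact holZ_block h0 (l i) i (h10 γ h0 h1).1
    · obtain ⟨-, -, -, -, -, -, -, -, -, h10⟩ := hk (l i) (hl i)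
      exact holZ_block h0 (l i) i (h10 γ h0 h1).2
  · intro t x i
    obtain ⟨-, -, -, -, -, -, h7, -⟩ := hk (l i) (hl i)
    show k (l i) (Pr l (l i) (F t x)) i = Real.exp (l i * t) * k (l i) (Pr l (l i) x) i
    rw [← hF.comm, h7]; rfl
end PieceN7

section PieceN8
open Filter Topology
variable {d : ℕ}

/-- signed power -/
def pw (p x : ℝ) : ℝ := SignType.sign x * |x| ^ p

theorem pw_nonneg {p x : ℝ} (hp : p ≠ 0) (hx : 0 ≤ x) : pw p x = x ^ p := by
  rcases hx.eq_or_lt with h | h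
  · rw [pw, ← h]; simp [Real.zero_rpow hp]
  · rw [pw, sign_pos h, abs_of_pos h]; simp

theorem pw_neg (p x : ℝ) : pw p (-x) = - pw p x := by
  rw [pw, pw, Left.sign_neg, abs_neg]; simp

theorem pw_pw {p q : ℝ} (hp : p ≠ 0) (hpq : p * q = 1) (x : ℝ) : pw q (pw p x) = x := by
  have hq : q ≠ 0 := by rintro rfl; simp at hpq
  have h0 : ∀ y, 0 ≤ y → pw q (pw p y) = y := by
    intro y hy
    rw [pw_nonneg hp hy, pw_nonneg hq (Real.rpow_nonneg hy _), ← Real.rpow_mul hy, hpq, Real.rpow_one]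
  rcases le_total 0 x with h | h
  · exact h0 x h
  · have := h0 (-x) (by linarith)
    rw [pw_neg, pw_neg] at this
    linarith

theorem pw_exp (p l t x : ℝ) : pw p (Real.exp (l * t) * x) = Real.exp (p * l * t) * pw p x := by
  rw [pw, pw, abs_mul, abs_of_pos (Real.exp_pos _), sign_mul, sign_pos (Real.exp_pos _),
    Real.mul_rpow (Real.exp_pos _).le (abs_nonneg _), ← Real.exp_mul]
  rw [one_mul, show l * t * p = p * l * t by ring]
  ring

theorem pw_cont {p : ℝ} (hp : 0 < p) : Continuous (pw p) := by
  have e : pw p = fun x => (max x 0) ^ p - (max (-x) 0) ^ p := by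
    ext x
    rcases le_total 0 x with h | h
    · rw [pw_nonneg hp.ne' h, max_eq_left h, max_eq_right (by linarith), Real.zero_rpow hp.ne', sub_zero]
    · have := pw_neg p (-x)
      rw [neg_neg, pw_nonneg hp.ne' (show 0 ≤ -x by linarith)] at this
      rw [this, max_eq_right h, max_eq_left (by linarith), Real.zero_rpow hp.ne', zero_sub]
  rw [e]
  exact ((continuous_id.max continuous_const).rpow_const fun _ => Or.inr hp.le).sub
    ((continuous_neg.max continuous_const).rpow_const fun _ => Or.inr hp.le)

theorem rpow_diff {p β a b : ℝ} (hβ : 0 < β) (hβ1 : β ≤ 1) (hp : β ≤ p) (hb : 0 ≤ b) (hab : b ≤ a)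
    (ha : a ≤ 1) : a ^ p - b ^ p ≤ max p 1 * (a - b) ^ β := by
  have hd0 : 0 ≤ a - b := by linarith
  have hd1 : a - b ≤ 1 := by linarith
  have hpw : 0 ≤ (a - b) ^ β := Real.rpow_nonneg hd0 _
  have hp0 : 0 < p := by linarith
  rcases le_total p 1 with h | h
  · have h1 := Real.rpow_add_le_add_rpow hb hd0 hp0.le h
    rw [add_sub_cancel] at h1
    have h2 : (a - b) ^ p ≤ (a - b) ^ β := by
      rcases hd0.eq_or_lt with h0 | h0
      · rw [← h0, Real.zero_rpow hp0.ne', Real.zero_rpow hβ.ne']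
      · exact Real.rpow_le_rpow_of_exponent_ge h0 hd1 hp
    rw [max_eq_right h]; linarith
  · rw [max_eq_left h]
    have h2 : a - b ≤ (a - b) ^ β := by
      rcases hd0.eq_or_lt with h0 | h0
      · rw [← h0, Real.zero_rpow hβ.ne']
      · calc a - b = (a - b) ^ (1:ℝ) := (Real.rpow_one _).symm
          _ ≤ _ := Real.rpow_le_rpow_of_exponent_ge h0 hd1 hβ1
    have ha0 : 0 ≤ a := hb.trans hab
    rcases ha0.eq_or_lt with h0 | h0
    · have : b = 0 := by linarith
      rw [this, ← h0]; simp [Real.zero_rpow hp0.ne', Real.zero_rpow hβ.ne']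
    have h3 := one_add_mul_self_le_rpow_one_add (s := b / a - 1)
      (by have : 0 ≤ b / a := by positivity
          linarith) h
    rw [add_sub_cancel, Real.div_rpow hb ha0, le_div_iff₀ (by positivity)] at h3
    have h4 : a ^ p ≤ a := by
      calc a ^ p ≤ a ^ (1:ℝ) := Real.rpow_le_rpow_of_exponent_ge h0 ha h
        _ = a := Real.rpow_one _
    have h5 : a ^ p * (1 - b / a) ≤ a - b := by
      have : 0 ≤ 1 - b / a := by rw [sub_nonneg, div_le_one h0]; exact hab
      calc a ^ p * (1 - b / a) ≤ a * (1 - b / a) := by gcongr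
        _ = a - b := by field_simp
    have h6 : a ^ p - b ^ p ≤ p * (a ^ p * (1 - b / a)) := by linarith
    have h7 : p * (a ^ p * (1 - b / a)) ≤ p * (a - b) ^ β := by gcongr; linarith
    linarith

theorem pw_diff {p β x y : ℝ} (hβ : 0 < β) (hβ1 : β ≤ 1) (hp : β ≤ p) (hx : |x| ≤ 1) (hy : |y| ≤ 1) :
    |pw p x - pw p y| ≤ 2 * max p 1 * |x - y| ^ β := by
  have hp0 : p ≠ 0 := by linarith
  have hm : 0 < max p 1 := lt_of_lt_of_le one_pos (le_max_right _ _)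
  -- wlog by symmetry: y ≤ x
  have key : ∀ x y : ℝ, |x| ≤ 1 → |y| ≤ 1 → 0 ≤ x → |y| ≤ x → |pw p x - pw p y| ≤ 2 * max p 1 * |x - y| ^ β := by
    intro x y hx hy h0 hxy
    have hx1 := (le_abs_self x).trans hx
    have hpn : 0 ≤ |x - y| ^ β := Real.rpow_nonneg (abs_nonneg _) _
    have hmp : 0 ≤ max p 1 * |x - y| ^ β := by positivity
    rcases le_total 0 y with h | h
    · rw [abs_of_nonneg h] at hxy
      rw [pw_nonneg hp0 h0, pw_nonneg hp0 h]
      have h1 := rpow_diff hβ hβ1 hp h hxy hx1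
      have h2 : y ^ p ≤ x ^ p := Real.rpow_le_rpow h hxy (by linarith)
      rw [abs_of_nonneg (by linarith)]
      rw [abs_of_nonneg (show 0 ≤ x - y by linarith)] at *
      linarith
    · rw [abs_of_nonpos h] at hxy
      have e : pw p y = -((-y) ^ p) := by
        rw [← pw_nonneg hp0 (show 0 ≤ -y by linarith), pw_neg, neg_neg]
      rw [pw_nonneg hp0 h0, e]
      have h1 := rpow_diff hβ hβ1 hp le_rfl h0 hx1
      have h2 := rpow_diff hβ hβ1 hp le_rfl (show 0 ≤ -y by linarith) (by linarith)
      rw [Real.zero_rpow hp0, sub_zero, sub_zero] at h1 h2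
      have h3 : x ^ β ≤ |x - y| ^ β := by
        apply Real.rpow_le_rpow h0 _ hβ.le
        rw [abs_of_nonneg (by linarith)]; linarith
      have h4 : (-y) ^ β ≤ |x - y| ^ β := by
        apply Real.rpow_le_rpow (by linarith) _ hβ.le
        rw [abs_of_nonneg (by linarith)]; linarith
      have h5 : 0 ≤ x ^ p := Real.rpow_nonneg h0 _
      have h6 : 0 ≤ (-y) ^ p := Real.rpow_nonneg (by linarith) _
      have h7 := mul_le_mul_of_nonneg_left h3 hm.le
      have h8 := mul_le_mul_of_nonneg_left h4 hm.le
      rw [abs_of_nonneg (by linarith)]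
      linarith
  have key2 : ∀ x y : ℝ, |x| ≤ 1 → |y| ≤ 1 → |y| ≤ |x| → |pw p x - pw p y| ≤ 2 * max p 1 * |x - y| ^ β := by
    intro x y hx hy hxy
    rcases le_total 0 x with h | h
    · exact key x y hx hy h (by rwa [abs_of_nonneg h] at hxy)
    · have := key (-x) (-y) (by rwa [abs_neg]) (by rwa [abs_neg]) (by linarith)
        (by rwa [abs_neg, ← abs_of_nonpos h])
      rw [pw_neg, pw_neg] at this
      rw [← abs_neg, ← abs_neg (x - y)]
      convert this using 2
      · ring
      · ring_nf
  rcases le_total |y| |x| with h | h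
  · exact key2 x y hx hy h
  · rw [abs_sub_comm, abs_sub_comm x y]; exact key2 y x hy hx h

theorem HolZ_comp {E E' E'' : Type*} [NormedAddCommGroup E] [NormedAddCommGroup E'] [NormedAddCommGroup E'']
    {f : E → E'} {g : E' → E''} {a b : ℝ} (hf : HolZ a f) (hg : HolZ b g) (f0 : f 0 = 0)
    (hc : Continuous f) (hb : 0 < b) : HolZ (a * b) (g ∘ f) := by
  obtain ⟨r, hr, K, hK⟩ := hf
  obtain ⟨r', hr', K', hK'⟩ := hg
  have : f ⁻¹' Metric.ball 0 r' ∈ 𝓝 (0 : E) := by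
    apply hc.continuousAt.preimage_mem_nhds
    rw [f0]; exact Metric.ball_mem_nhds _ hr'
  obtain ⟨δ, hδ, hsub⟩ := Metric.mem_nhds_iff.1 this
  refine ⟨min r δ, lt_min hr hδ, |K'| * |K| ^ b, fun x hx y hy => ?_⟩
  have hx1 := Metric.ball_subset_ball (min_le_left r δ) hx
  have hy1 := Metric.ball_subset_ball (min_le_left r δ) hy
  have hx2 := hsub (Metric.ball_subset_ball (min_le_right r δ) hx)
  have hy2 := hsub (Metric.ball_subset_ball (min_le_right r δ) hy)
  have h1 := hK x hx1 y hy1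
  have h2 := hK' _ hx2 _ hy2
  have hnn : 0 ≤ dist x y ^ a := Real.rpow_nonneg dist_nonneg _
  calc dist (g (f x)) (g (f y)) ≤ K' * dist (f x) (f y) ^ b := h2
    _ ≤ |K'| * (|K| * dist x y ^ a) ^ b := by
      refine mul_le_mul (le_abs_self _) ?_ (Real.rpow_nonneg dist_nonneg _) (abs_nonneg _)
      refine Real.rpow_le_rpow dist_nonneg (h1.trans ?_) hb.le
      gcongr; exact le_abs_self _
    _ = |K'| * |K| ^ b * dist x y ^ (a * b) := by
      rw [Real.mul_rpow (abs_nonneg _) hnn, ← Real.rpow_mul dist_nonneg, mul_assoc]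

theorem HolZ_clm {E E' : Type*} [NormedAddCommGroup E] [NormedAddCommGroup E'] [NormedSpace ℝ E]
    [NormedSpace ℝ E'] (f : E →L[ℝ] E') : HolZ 1 f := by
  refine ⟨1, one_pos, ‖f‖, fun x _ y _ => ?_⟩
  rw [Real.rpow_one, dist_eq_norm, dist_eq_norm, ← map_sub]
  exact f.le_opNorm _

/-- power homeomorphism -/
theorem power_homeo (p : Fin d → ℝ) {β : ℝ} (hβ : 0 < β) (hβ1 : β ≤ 1) (h1 : ∀ i, β ≤ p i)
    (h2 : ∀ i, p i * β ≤ 1) : ∃ q : (Fin d → ℝ) ≃ₜ (Fin d → ℝ), q 0 = 0 ∧ HolZ β q ∧ HolZ β q.symm ∧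
      ∀ x i, q x i = pw (p i) (x i) := by
  have hp : ∀ i, 0 < p i := fun i => hβ.trans_le (h1 i)
  have hpw0 : ∀ p, 0 < p → pw p 0 = 0 := fun p hp => by simp [pw]
  have hol : ∀ p : Fin d → ℝ, (∀ i, β ≤ p i) → HolZ β (fun (x : Fin d → ℝ) i => pw (p i) (x i)) := by
    intro p hp
    refine holZ_pi hβ fun i => ⟨1, one_pos, 2 * max (p i) 1, fun x hx y hy => ?_⟩
    rw [mem_ball_zero_iff] at hx hy
    rw [Real.dist_eq]
    refine (pw_diff hβ hβ1 (hp i) ((norm_le_pi_norm x i).trans hx.le)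
      ((norm_le_pi_norm y i).trans hy.le)).trans ?_
    have : |x i - y i| ^ β ≤ dist x y ^ β := by
      apply Real.rpow_le_rpow (abs_nonneg _) _ hβ.le
      rw [← Real.dist_eq]; exact dist_le_pi_dist x y i
    have : 0 < max (p i) 1 := lt_of_lt_of_le one_pos (le_max_right _ _)
    gcongr
  let q : (Fin d → ℝ) ≃ₜ (Fin d → ℝ) :=
    { toFun := fun x i => pw (p i) (x i)
      invFun := fun x i => pw (p i)⁻¹ (x i)
      left_inv := fun x => by
        ext i; exact pw_pw (hp i).ne' (mul_inv_cancel₀ (hp i).ne') _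
      right_inv := fun x => by
        ext i; exact pw_pw (inv_ne_zero (hp i).ne') (inv_mul_cancel₀ (hp i).ne') _
      continuous_toFun := continuous_pi fun i => (pw_cont (hp i)).comp (continuous_apply i)
      continuous_invFun := continuous_pi fun i =>
        (pw_cont (inv_pos.2 (hp i))).comp (continuous_apply i) }
  refine ⟨q, ?_, hol p h1, hol (fun i => (p i)⁻¹) ?_, fun x i => rfl⟩
  · ext i; exact hpw0 _ (hp i)
  · intro i
    rw [le_inv_comm₀ hβ (hp i), le_inv_comm₀ (hp i) hβ, ← one_div, le_div_iff₀ (hp i)]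
    linarith [h2 i]

/-- sufficiency for stable flows -/
theorem suff {A B : Matrix (Fin d) (Fin d) ℝ} {TA TB : Euc d ≃L[ℝ] (Fin d → ℝ)}
    {FA FB : ℝ → (Fin d → ℝ) →L[ℝ] (Fin d → ℝ)} {l m : Fin d → ℝ}
    (hFA : SFlow FA l) (hFB : SFlow FB m)
    (cA : ∀ t x, TA (linFlow A t x) = FA t (TA x)) (cB : ∀ t x, TB (linFlow B t x) = FB t (TB x))
    (hl : ∀ i, l i < 0) (hm : ∀ i, m i < 0) {α β : ℝ} (hα : 0 < α) (hβ : 0 < β) (hβ1 : β ≤ 1)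
    (h1 : ∀ i, β ≤ α * m i / l i) (h2 : ∀ i, α * m i / l i * β ≤ 1) :
    SimEquivWith (MemHBelow β) A B := by
  obtain ⟨kA, kA0, kAh, kAc⟩ := diagonalize hFA hl
  obtain ⟨kB, kB0, kBh, kBc⟩ := diagonalize hFB hm
  obtain ⟨q, q0, qh, qh', qc⟩ := power_homeo (fun i => α * m i / l i) hβ hβ1 h1 h2
  let h : Euc d ≃ₜ Euc d := TA.toHomeomorph.trans (kA.trans (q.trans (kB.symm.trans TB.symm.toHomeomorph)))
  have hdef : ∀ x, h x = TB.symm (kB.symm (q (kA (TA x)))) := fun x => rfl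
  have hdef' : ∀ x, h.symm x = TA.symm (kA.symm (q.symm (kB (TB x)))) := fun x => rfl
  have kB0' : kB.symm 0 = 0 := by rw [Homeomorph.symm_apply_eq, kB0]
  have kA0' : kA.symm 0 = 0 := by rw [Homeomorph.symm_apply_eq, kA0]
  have q0' : q.symm 0 = 0 := by rw [Homeomorph.symm_apply_eq, q0]
  have holder : ∀ γ, 0 < γ → γ < β → ∀ (T : Euc d ≃L[ℝ] (Fin d → ℝ)) (T' : Euc d ≃L[ℝ] (Fin d → ℝ))
      (k k' q : (Fin d → ℝ) ≃ₜ (Fin d → ℝ)), k 0 = 0 → k' 0 = 0 → q 0 = 0 → HolZ β q →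
      (∀ γ, 0 < γ → γ < 1 → HolZ γ k) → (∀ γ, 0 < γ → γ < 1 → HolZ γ k') →
      HolZ γ (fun x => T'.symm (k' (q (k (T x))))) := by
    intro γ h0 hlt T T' k k' q k0 k'0 q0 hq hk hk'
    set c := Real.sqrt (γ / β) with hc
    have hc0 : 0 < c := Real.sqrt_pos.2 (by positivity)
    have hcc : c * c = γ / β := Real.mul_self_sqrt (by positivity)
    have hc1 : c < 1 := by
      rw [hc, Real.sqrt_lt' one_pos, one_pow, div_lt_one hβ]; exact hlt
    have e1 := HolZ_comp (HolZ_clm (T : Euc d →L[ℝ] (Fin d → ℝ))) (hk c hc0 hc1) (by simp) T.continuous hc0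
    have e2 := HolZ_comp e1 hq (by simp [k0]) (k.continuous.comp T.continuous) hβ
    have e3 := HolZ_comp e2 (hk' c hc0 hc1) (by simp [k0, q0])
      (q.continuous.comp (k.continuous.comp T.continuous)) hc0
    have e4 := HolZ_comp e3 (HolZ_clm (T'.symm : (Fin d → ℝ) →L[ℝ] Euc d)) (by simp [k0, q0, k'0])
      (k'.continuous.comp (q.continuous.comp (k.continuous.comp T.continuous))) one_pos
    have e5 : 1 * c * β * c * 1 = γ := by
      have : 1 * c * β * c * 1 = c * c * β := by ring
      rw [this, hcc]; field_simp
    rw [e5] at e4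
    exact e4
  refine ⟨h, α, hα.ne', ?_, ?_⟩
  · intro γ h0 hlt
    refine ⟨?_, ?_, ?_⟩
    · rw [hdef, map_zero, kA0, q0, kB0', map_zero]
    · exact holder γ h0 hlt TA TB kA kB.symm q kA0 kB0' q0 qh (fun γ a b => (kAh γ a b).1)
        (fun γ a b => (kBh γ a b).2)
    · exact holder γ h0 hlt TB TA kB kA.symm q.symm kB0 kA0' q0' qh' (fun γ a b => (kBh γ a b).1)
        (fun γ a b => (kAh γ a b).2)
  · intro t x
    rw [hdef, hdef, cA]
    have e1 : q (kA (FA t (TA x))) = fun i => Real.exp (m i * (α * t)) * q (kA (TA x)) i := by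
      ext i
      rw [qc, qc, kAc, pw_exp]
      congr 2
      have := (hl i).ne
      field_simp
    have e2 : kB (FB (α * t) (kB.symm (q (kA (TA x))))) = q (kA (FA t (TA x))) := by
      rw [e1]; ext i
      rw [kBc, Homeomorph.apply_symm_apply]
    rw [← e2, Homeomorph.symm_apply_apply]
    have e3 := cB (α * t) (TB.symm (kB.symm (q (kA (TA x)))))
    rw [ContinuousLinearEquiv.apply_symm_apply] at e3
    rw [← e3, ContinuousLinearEquiv.symm_apply_apply]
end PieceN8

section PieceN9
open Filter Topology
variable {d : ℕ} {F : ℝ → (Fin d → ℝ) →L[ℝ] (Fin d → ℝ)} {l : Fin d → ℝ}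

theorem SFlow.coord (hF : SFlow F l) (t : ℝ) (x : Fin d → ℝ) (k : Fin d) :
    F t x k = F t (Pr l (l k) x) k := by
  rw [hF.comm]; simp [Pr]

theorem SFlow.cancel (hF : SFlow F l) (t : ℝ) (x : Fin d → ℝ) : F (-t) (F t x) = x := by
  rw [← hF.add, neg_add_cancel, hF.zero]

/-- coordinate projector on exponents in `S` -/
def QP (l : Fin d → ℝ) (S : ℝ → Prop) [DecidablePred S] (x : Fin d → ℝ) : Fin d → ℝ :=
  fun k => if S (l k) then x k else 0

theorem QP_sub (S : ℝ → Prop) [DecidablePred S] (x y : Fin d → ℝ) :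
    QP l S (x - y) = QP l S x - QP l S y := by
  ext k; simp only [QP, Pi.sub_apply]; split_ifs <;> simp

theorem QP_norm (S : ℝ → Prop) [DecidablePred S] (x : Fin d → ℝ) : ‖QP l S x‖ ≤ ‖x‖ := by
  rw [pi_norm_le_iff_of_nonneg (norm_nonneg _)]
  intro k
  simp only [QP]
  split_ifs
  · exact norm_le_pi_norm x k
  · simp

theorem QP_cont (S : ℝ → Prop) [DecidablePred S] : Continuous (QP l S) := by
  refine continuous_pi fun k => ?_
  simp only [QP]
  split_ifs <;> fun_prop

theorem QP_comm (hF : SFlow F l) (S : ℝ → Prop) [DecidablePred S] (t : ℝ) (x : Fin d → ℝ) :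
    F t (QP l S x) = QP l S (F t x) := by
  ext k
  rw [hF.coord]
  have e : Pr l (l k) (QP l S x) = if S (l k) then Pr l (l k) x else 0 := by
    ext j
    simp only [Pr, QP]
    by_cases hj : l j = l k
    · rw [if_pos hj, hj]
      split_ifs
      · rw [Pr, if_pos hj]
      · rfl
    · rw [if_neg hj]
      split_ifs
      · rw [Pr, if_neg hj]
      · rfl
  rw [e]
  simp only [QP]
  split_ifs
  · rw [← hF.coord]
  · rw [map_zero]; rfl

theorem gr_sup (hF : SFlow F l) {ε : ℝ} (hε : 0 < ε) : ∃ C > 0, ∀ t x R,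
    (∀ k, x k ≠ 0 → l k * t ≤ R) → ‖F t x‖ ≤ C * Real.exp (R + ε * |t|) * ‖x‖ := by
  obtain ⟨C, hC, h⟩ := hF.gr ε hε
  refine ⟨C, hC, fun t x R hR => ?_⟩
  rw [pi_norm_le_iff_of_nonneg (by positivity)]
  intro k
  rw [hF.coord]
  by_cases h0 : Pr l (l k) x = 0
  · rw [h0, map_zero]; simp; positivity
  have hk : l k * t ≤ R := by
    obtain ⟨j, hj⟩ := Function.ne_iff.1 h0
    simp only [Pr, Pi.zero_apply, ne_eq, ite_eq_right_iff, not_forall] at hj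
    obtain ⟨h1, h2⟩ := hj
    rw [← h1]; exact hR j h2
  refine (norm_le_pi_norm _ k).trans ((h t (l k) x).trans ?_)
  gcongr
  exact Pr_norm _ _ _

theorem gr_low (hF : SFlow F l) {ε : ℝ} (hε : 0 < ε) {x : Fin d → ℝ} {k : Fin d} (hk : x k ≠ 0) :
    ∃ c > 0, ∀ t, 0 ≤ t → c * Real.exp ((l k - ε) * t) ≤ ‖F t x‖ := by
  obtain ⟨C, hC, h⟩ := hF.gr ε hε
  have hz : 0 < ‖Pr l (l k) x‖ := by
    rw [norm_pos_iff]; intro h0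
    have := congrFun h0 k
    simp [Pr] at this
    exact hk this
  refine ⟨‖Pr l (l k) x‖ / C, by positivity, fun t ht => ?_⟩
  have h1 := h (-t) (l k) (F t x)
  rw [← hF.comm, hF.cancel, abs_neg, abs_of_nonneg ht, hF.comm] at h1
  have h2 : Real.exp (l k * -t + ε * t) * Real.exp ((l k - ε) * t) = 1 := by
    rw [← Real.exp_add, Real.exp_eq_one_iff]; ring
  have h3 := Pr_norm l (l k) (F t x)
  rw [div_mul_eq_mul_div, div_le_iff₀ hC]
  calc ‖Pr l (l k) x‖ * Real.exp ((l k - ε) * t) ≤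
      (C * Real.exp (l k * -t + ε * t) * ‖F t x‖) * Real.exp ((l k - ε) * t) := by
        gcongr; exact h1.trans (by gcongr)
    _ = C * (Real.exp (l k * -t + ε * t) * Real.exp ((l k - ε) * t)) * ‖F t x‖ := by ring
    _ = _ := by rw [h2]; ring

theorem exists_eta (hl : ∀ i, l i < 0) : ∃ η > 0, ∀ i, l i ≤ -(2 * η) := by
  by_cases hn : Nonempty (Fin d)
  · obtain ⟨i, hi⟩ := Finite.exists_max l
    exact ⟨-l i / 2, by linarith [hl i], fun j => by linarith [hi j]⟩
  · exact ⟨1, one_pos, fun i => absurd ⟨i⟩ hn⟩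

theorem SFlow.pre (hF : SFlow F l) (hl : ∀ i, l i < 0) :
    ∃ η > 0, ∃ C > 0, PreF (fun t x => F t x) η C := by
  obtain ⟨η, hη, h⟩ := exists_eta hl
  obtain ⟨C, hC, hg⟩ := gr_sup hF hη
  refine ⟨η, hη, C, hC, hF.zero, hF.add, fun t x y => map_sub _ _ _, fun t c x => map_smul _ _ _, ?_⟩
  intro t ht x
  have := hg t x (-(2 * η) * t) (fun k _ => by have := h k; nlinarith)
  rw [abs_of_nonneg ht] at this
  calc Real.exp (η * t) * ‖F t x‖ ≤ Real.exp (η * t) * (C * Real.exp (-(2 * η) * t + η * t) * ‖x‖) := by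
        gcongr
    _ = C * (Real.exp (η * t) * Real.exp (-(2 * η) * t + η * t)) * ‖x‖ := by ring
    _ = C * ‖x‖ := by
      rw [← Real.exp_add, show η * t + (-(2 * η) * t + η * t) = 0 by ring, Real.exp_zero, mul_one]

theorem SFlow.N (hF : SFlow F l) (hl : ∀ i, l i < 0) :
    ∃ (N : (Fin d → ℝ) → ℝ) (η : ℝ), 0 < η ∧ Continuous N ∧ (∀ x, x ≠ 0 → 0 < N x) ∧
      ∀ x τ, 0 ≤ τ → N (F τ x) ≤ Real.exp (-(η * τ)) * N x := by
  obtain ⟨η, hη, C, hC, hp⟩ := hF.pre hl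
  have a1 : Adp (AN (fun t x => F t x) η) (fun t x => F t x) η C :=
    ⟨AN_norm hp, AN_up hp, AN_tri hp, fun x τ hτ => AN_dec hp x hτ⟩
  exact ⟨_, η, hη, a1.cont, fun x hx => (norm_pos_iff.2 hx).trans_le (AN_norm hp x), a1.dec⟩

theorem SFlow.ne (hF : SFlow F l) (t : ℝ) {x : Fin d → ℝ} (hx : x ≠ 0) : F t x ≠ 0 := by
  intro h0
  have := hF.cancel t x
  rw [h0, map_zero] at this
  exact hx this.symm

theorem N_strict (hF : SFlow F l) {N : (Fin d → ℝ) → ℝ} {η : ℝ} (hη : 0 < η)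
    (hpos : ∀ x, x ≠ 0 → 0 < N x) (hdec : ∀ x τ, 0 ≤ τ → N (F τ x) ≤ Real.exp (-(η * τ)) * N x)
    {x : Fin d → ℝ} (hx : x ≠ 0) : StrictAnti fun t => N (F t x) := by
  intro t t' htt
  have := hdec (F t x) (t' - t) (by linarith)
  rw [← hF.add, sub_add_cancel] at this
  have hp := hpos _ (hF.ne t hx)
  have hlt : Real.exp (-(η * (t' - t))) < 1 := by
    rw [Real.exp_lt_one_iff]; nlinarith
  show N (F t' x) < N (F t x)
  nlinarith

theorem SFlow.joint (hF : SFlow F l) : Continuous fun p : ℝ × (Fin d → ℝ) => F p.1 p.2 := by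
  obtain ⟨C, hC, hb⟩ := hF.lip
  refine continuous_iff_continuousAt.2 fun ⟨s, y⟩ => ?_
  have e : (fun p : ℝ × (Fin d → ℝ) => F p.1 p.2) = fun p => F s (F (p.1 - s) p.2) := by
    ext1 p; rw [← hF.add, add_sub_cancel]
  rw [e]
  have h1 : Tendsto (fun p : ℝ × (Fin d → ℝ) => F (p.1 - s) p.2) (𝓝 (s, y)) (𝓝 y) := by
    rw [tendsto_iff_norm_sub_tendsto_zero]
    refine squeeze_zero' (Eventually.of_forall fun _ => norm_nonneg _)
      (g := fun p => C * |p.1 - s| * ‖p.2‖ + ‖p.2 - y‖) ?_ ?_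
    · filter_upwards [Metric.ball_mem_nhds (s, y) one_pos] with p hp
      have hp1 : |p.1 - s| ≤ 1 := by
        rw [← Real.dist_eq]
        exact (le_max_left _ _).trans (Metric.mem_ball.1 hp).le
      calc ‖F (p.1 - s) p.2 - y‖ = ‖(F (p.1 - s) p.2 - p.2) + (p.2 - y)‖ := by congr 1; abel
        _ ≤ _ := norm_add_le _ _
        _ ≤ _ := by gcongr; exact hb _ _ hp1
    · have : Continuous fun p : ℝ × (Fin d → ℝ) => C * |p.1 - s| * ‖p.2‖ + ‖p.2 - y‖ := by fun_prop
      have := this.tendsto (s, y)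
      simpa using this
  have h2 : F (s - s) y = y := by rw [sub_self, hF.zero]
  rw [ContinuousAt, h2]
  exact ((F s).continuous.tendsto y).comp h1

theorem SFlow.cont_t (hF : SFlow F l) (x : Fin d → ℝ) : Continuous fun t => F t x :=
  hF.joint.comp (continuous_id.prodMk continuous_const)

theorem SFlow.tend (hF : SFlow F l) (hl : ∀ i, l i < 0) (x : Fin d → ℝ) :
    Tendsto (fun t => F t x) atTop (𝓝 0) := by
  obtain ⟨η, hη, C, hC, hp⟩ := hF.pre hl
  rw [tendsto_zero_iff_norm_tendsto_zero]
  refine squeeze_zero' (Eventually.of_forall fun _ => norm_nonneg _)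
    (g := fun t => Real.exp (-η * t) * (C * ‖x‖)) ?_ ?_
  · filter_upwards [eventually_ge_atTop 0] with t ht
    have := hp.bd t ht x
    rw [neg_mul, Real.exp_neg, ← div_eq_inv_mul, le_div_iff₀ (Real.exp_pos _)]
    linarith
  · have : Tendsto (fun t => Real.exp (-η * t) * (C * ‖x‖)) atTop (𝓝 (0 * (C * ‖x‖))) :=
      (Real.tendsto_exp_atBot.comp (tendsto_id.const_mul_atTop_of_neg (by linarith))).mul_const _
    simpa using this

theorem orbit_closed (hF : SFlow F l) (hl : ∀ i, l i < 0) {z w : Fin d → ℝ} (hw : w ≠ 0)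
    (h : ∀ ε > 0, ∃ σ, ‖F σ z - w‖ < ε) : ∃ σ, F σ z = w := by
  obtain ⟨N, η, hη, hc, hpos, hdec⟩ := hF.N hl
  have hz : z ≠ 0 := by
    rintro rfl
    obtain ⟨σ, hσ⟩ := h ‖w‖ (norm_pos_iff.2 hw)
    rw [map_zero, zero_sub, norm_neg] at hσ
    exact lt_irrefl _ hσ
  have hNw := hpos w hw
  have hNz := hpos z hz
  obtain ⟨ε0, hε0, hball⟩ : ∃ ε0 > 0, ∀ v, ‖v - w‖ < ε0 → N w / 2 < N v ∧ N v < 2 * N w := by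
    have h1 : ∀ᶠ v in 𝓝 w, N w / 2 < N v := (hc.tendsto w).eventually (lt_mem_nhds (by linarith))
    have h2 : ∀ᶠ v in 𝓝 w, N v < 2 * N w := (hc.tendsto w).eventually (gt_mem_nhds (by linarith))
    obtain ⟨ε0, hε0, hb⟩ := Metric.eventually_nhds_iff.1 (h1.and h2)
    exact ⟨ε0, hε0, fun v hv => hb (by rwa [dist_eq_norm])⟩
  set S := |Real.log (2 * N z / N w)| / η + |Real.log (2 * N w / N z)| / η with hS
  have hbd : ∀ σ, ‖F σ z - w‖ < ε0 → σ ∈ Set.Icc (-S) S := by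
    intro σ hσ
    obtain ⟨h1, h2⟩ := hball _ hσ
    have hS1 : 0 ≤ |Real.log (2 * N z / N w)| / η := by positivity
    have hS2 : 0 ≤ |Real.log (2 * N w / N z)| / η := by positivity
    rcases le_total 0 σ with h0 | h0
    · refine ⟨by linarith, ?_⟩
      have h3 := hdec z σ h0
      have h4 : Real.exp (η * σ) ≤ 2 * N z / N w := by
        rw [le_div_iff₀ hNw]
        rw [Real.exp_neg, ← div_eq_inv_mul, le_div_iff₀ (Real.exp_pos _)] at h3
        nlinarith [Real.exp_pos (η * σ)]
      have h5 := (Real.le_log_iff_exp_le (by positivity)).2 h4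
      have h6 : σ ≤ |Real.log (2 * N z / N w)| / η := by
        rw [le_div_iff₀ hη]; linarith [le_abs_self (Real.log (2 * N z / N w))]
      linarith
    · refine ⟨?_, by linarith⟩
      have h3 := hdec (F σ z) (-σ) (by linarith)
      rw [hF.cancel] at h3
      have h4 : Real.exp (η * -σ) ≤ 2 * N w / N z := by
        rw [le_div_iff₀ hNz]
        rw [Real.exp_neg, ← div_eq_inv_mul, le_div_iff₀ (Real.exp_pos _)] at h3
        nlinarith [Real.exp_pos (η * -σ)]
      have h5 := (Real.le_log_iff_exp_le (by positivity)).2 h4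
      have h6 : -σ ≤ |Real.log (2 * N w / N z)| / η := by
        rw [le_div_iff₀ hη]; linarith [le_abs_self (Real.log (2 * N w / N z))]
      linarith
  have hK : IsClosed ((fun t => F t z) '' Set.Icc (-S) S) :=
    (isCompact_Icc.image (hF.cont_t z)).isClosed
  have : w ∈ closure ((fun t => F t z) '' Set.Icc (-S) S) := by
    rw [Metric.mem_closure_iff]
    intro ε hε
    obtain ⟨σ, hσ⟩ := h (min ε ε0) (lt_min hε hε0)
    refine ⟨F σ z, ⟨σ, hbd σ (hσ.trans_le (min_le_right _ _)), rfl⟩, ?_⟩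
    rw [dist_comm, dist_eq_norm]; exact hσ.trans_le (min_le_left _ _)
  rw [hK.closure_eq] at this
  obtain ⟨σ, -, hσ⟩ := this
  exact ⟨σ, hσ⟩
end PieceN9

section PieceN10
open Filter Topology
variable {d : ℕ} {F G : ℝ → (Fin d → ℝ) →L[ℝ] (Fin d → ℝ)} {l m : Fin d → ℝ}

/-- extension by zero -/
def ext0 (S : Fin d → Prop) [DecidablePred S] (u : {k // S k} → ℝ) : Fin d → ℝ :=
  fun k => if hk : S k then u ⟨k, hk⟩ else 0

theorem ext0_cont (S : Fin d → Prop) [DecidablePred S] : Continuous (ext0 S) := by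
  refine continuous_pi fun k => ?_
  simp only [ext0]
  split_ifs <;> fun_prop

theorem ext0_inj (S : Fin d → Prop) [DecidablePred S] : Function.Injective (ext0 S) := by
  intro u v h
  ext ⟨k, hk⟩
  have := congrFun h k
  simpa [ext0, hk] using this

theorem card_le (j : Fin d) : Module.finrank ℝ ({k : Fin d // k ≤ j} → ℝ) = j + 1 := by
  rw [Module.finrank_fintype_fun_eq_card, Fintype.card_subtype,
    show Finset.univ.filter (fun i : Fin d => i ≤ j) = Finset.Iic j by
      ext; rw [Finset.mem_filter, Finset.mem_Iic]; simp only [Finset.mem_univ, true_and], Fin.card_Iic]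

theorem card_lt (j : Fin d) : Module.finrank ℝ ({k : Fin d // k < j} → ℝ) = j := by
  rw [Module.finrank_fintype_fun_eq_card, Fintype.card_subtype,
    show Finset.univ.filter (fun i : Fin d => i < j) = Finset.Iio j by
      ext; rw [Finset.mem_filter, Finset.mem_Iio]; simp only [Finset.mem_univ, true_and], Fin.card_Iio]

theorem stepA (g : (Fin d → ℝ) ≃ₜ (Fin d → ℝ)) {i j : Fin d} (hij : i ≤ j) :
    ∃ p : Fin d → ℝ, p i ≠ 0 ∧ (∀ k, p k ≠ 0 → k ≤ j) ∧ ∃ k, j ≤ k ∧ g p k ≠ 0 := by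
  by_contra hne
  push Not at hne
  let u0 : {k : Fin d // k ≤ j} → ℝ := fun k => if k.1 = i then 1 else 0
  have hz : ∀ u ∈ Metric.closedBall u0 (1/2), ∀ k, j ≤ k → g (ext0 (· ≤ j) u) k = 0 := by
    intro u hu k hk
    refine hne (ext0 (· ≤ j) u) ?_ ?_ k hk
    · simp only [ext0, hij, dif_pos]
      have h1 := (dist_le_pi_dist u u0 ⟨i, hij⟩).trans hu
      intro h0
      rw [h0] at h1
      simp [u0] at h1
      norm_num at h1
    · intro k hk
      by_contra h
      exact hk (by simp [ext0, h])
  have := dim_le_of_injOn (fun u : {k : Fin d // k ≤ j} → ℝ =>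
    (fun k : {k : Fin d // k < j} => g (ext0 (· ≤ j) u) k.1)) u0 (1/2) (by norm_num)
    (by
      refine Continuous.continuousOn (continuous_pi fun k => ?_)
      exact (continuous_apply _).comp (g.continuous.comp (ext0_cont _))) (by
      intro u hu v hv huv
      apply ext0_inj (· ≤ j)
      apply g.injective
      ext k
      by_cases hk : k < j
      · exact congrFun huv ⟨k, hk⟩
      · rw [hz u hu k (not_lt.1 hk), hz v hv k (not_lt.1 hk)])
  rw [card_le, card_lt] at this
  omega

theorem stepE (hF : SFlow F l) (hG : SFlow G m) (hl : ∀ i, l i < 0) (hm : ∀ i, m i < 0)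
    (hlm : Monotone l) (hmm : Monotone m) (h : (Fin d → ℝ) ≃ₜ (Fin d → ℝ))
    (orb : ∀ x t, ∃ σ, h (F t x) = G σ (h x)) {i k0 : Fin d} {x w : Fin d → ℝ} (hk : l i < l k0)
    (hx : x k0 ≠ 0) (hw : w ≠ 0)
    (H : ∀ v : Fin d → ℝ, (∀ k, v k ≠ 0 → k ≤ i) →
      ∃ σ, G σ (QP m (fun s => m i ≤ s) (h (x + v))) = w) : False := by
  obtain ⟨N, η, hη, hc, hpos, hdec⟩ := hG.N hm
  obtain ⟨N', η', hη', hc', hpos', hdec'⟩ := hF.N hl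
  have hsup : ∀ u : {k : Fin d // k ≤ i} → ℝ, ∀ k, ext0 (· ≤ i) u k ≠ 0 → k ≤ i := by
    intro u k hk
    by_contra h
    exact hk (by simp [ext0, h])
  let Y : ℝ × ({k : Fin d // k ≤ i} → ℝ) → Fin d → ℝ := fun q => h (F q.1 (x + ext0 (· ≤ i) q.2))
  have Yc : Continuous Y := by
    refine h.continuous.comp (hF.joint.comp (continuous_fst.prodMk ?_))
    exact continuous_const.add ((ext0_cont _).comp continuous_snd)
  have Yo : ∀ q, ∃ σ, QP m (fun s => m i ≤ s) (Y q) = G σ w := by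
    intro q
    obtain ⟨σ, hσ⟩ := H _ (hsup q.2)
    obtain ⟨τ, hτ⟩ := orb (x + ext0 (· ≤ i) q.2) q.1
    refine ⟨τ - σ, ?_⟩
    rw [← hσ, ← hG.add, sub_add_cancel]
    simp only [Y]
    rw [hτ, QP_comm hG]
  have := dim_le_of_injOn (fun q : ℝ × ({k : Fin d // k ≤ i} → ℝ) =>
    (N (QP m (fun s => m i ≤ s) (Y q)), (fun k : {k : Fin d // k < i} => Y q k.1))) 0 1 one_pos
    (by
      refine Continuous.continuousOn ?_
      refine (hc.comp ((QP_cont _).comp Yc)).prodMk (continuous_pi fun k => ?_)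
      exact (continuous_apply _).comp Yc) (by
      intro q _ q' _ hqq
      obtain ⟨σ, hσ⟩ := Yo q
      obtain ⟨σ', hσ'⟩ := Yo q'
      have e1 := congrArg Prod.fst hqq
      have e2 := congrArg Prod.snd hqq
      simp only at e1 e2
      rw [hσ, hσ'] at e1
      have e3 : σ = σ' := (N_strict hG hη hpos hdec hw).injective e1
      have e4 : QP m (fun s => m i ≤ s) (Y q) = QP m (fun s => m i ≤ s) (Y q') := by
        rw [hσ, hσ', e3]
      have e5 : Y q = Y q' := by
        ext k
        by_cases hk : k < i
        · exact congrFun e2 ⟨k, hk⟩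
        · have := congrFun e4 k
          simpa [QP, hmm (not_lt.1 hk)] using this
      have e6 := h.injective e5
      have Q1 : ∀ u : {k : Fin d // k ≤ i} → ℝ, QP l (fun s => l i < s) (x + ext0 (· ≤ i) u) =
          QP l (fun s => l i < s) x := by
        intro u
        ext k
        simp only [QP]
        split_ifs with hk
        · have : ¬ k ≤ i := fun h => absurd (hlm h) (not_le.2 hk)
          simp [ext0, this]
        · rfl
      have e7 := congrArg (QP l (fun s => l i < s)) e6
      rw [← QP_comm hF, ← QP_comm hF, Q1, Q1] at e7
      have hne : QP l (fun s => l i < s) x ≠ 0 := by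
        intro h0
        have := congrFun h0 k0
        simp [QP, hk, hx] at this
      have e8 : q.1 = q'.1 := (N_strict hF hη' hpos' hdec' hne).injective (congrArg N' e7)
      rw [e8] at e6
      have e9 := congrArg (F (-q'.1)) e6
      rw [hF.cancel, hF.cancel] at e9
      exact Prod.ext e8 (ext0_inj _ (add_left_cancel e9)))
  rw [Module.finrank_prod, Module.finrank_prod, card_le, card_lt] at this
  omega

theorem stepB (hF : SFlow F l) (hG : SFlow G m) (hl : ∀ i, l i < 0) (hm : ∀ i, m i < 0)
    (hlm : Monotone l) (hmm : Monotone m) (h : (Fin d → ℝ) ≃ₜ (Fin d → ℝ)) (h0 : h 0 = 0)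
    {γ : ℝ} (hγ : 0 < γ) (hh' : HolZ γ h.symm) {j k0 : Fin d}
    {x p : Fin d → ℝ} (hk : j ≤ k0) (hx : x k0 ≠ 0) (hp0 : p ≠ 0) (hp : ∀ k, p k ≠ 0 → k ≤ j)
    {ε : ℝ} (hε : 0 < ε) :
    ∃ C1 : ℝ, ∀ᶠ t in atTop, ∀ τ, h (F t x) = G τ p →
      0 ≤ τ ∧ γ * (-m j - ε) * τ ≤ (-l j + ε) * t + C1 := by
  obtain ⟨η, hη, C, hC, hpre⟩ := hG.pre hm
  obtain ⟨r, hr, K, hK⟩ := hh'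
  obtain ⟨c', hc', hlow⟩ := gr_low hF hε hx
  obtain ⟨C2, hC2, hsup⟩ := gr_sup hG hε
  have hpn : 0 < ‖p‖ := norm_pos_iff.2 hp0
  have T : Tendsto (fun t => h (F t x)) atTop (𝓝 0) := by
    have := (h.continuous.tendsto 0).comp (hF.tend hl x)
    rwa [h0] at this
  have hs0 : h.symm 0 = 0 := by rw [h.symm_apply_eq, h0]
  set M := (|K| + 1) * (C2 * ‖p‖) ^ γ with hM
  have hMp : 0 < M := by positivity
  refine ⟨Real.log (M / c'), ?_⟩
  have ev1 := T.eventually (Metric.ball_mem_nhds 0 hr)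
  have ev2 := T.eventually (Metric.ball_mem_nhds (0 : Fin d → ℝ) (div_pos hpn hC))
  filter_upwards [ev1, ev2, eventually_ge_atTop 0] with t h1 h2 ht τ hτ
  have hτ0 : 0 ≤ τ := by
    by_contra hneg
    push Not at hneg
    have hb := hpre.bd (-τ) (by linarith) (G τ p)
    simp only [hG.cancel] at hb
    rw [← hτ] at hb
    have he : 1 ≤ Real.exp (η * -τ) := Real.one_le_exp (by nlinarith)
    rw [dist_zero_right, lt_div_iff₀ hC] at h2
    nlinarith
  refine ⟨hτ0, ?_⟩
  have e1 := hK _ h1 0 (Metric.mem_ball_self hr)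
  rw [hs0, dist_zero_right, dist_zero_right, h.symm_apply_apply, hτ] at e1
  have e2 := hlow t ht
  have e3 := hsup τ p (m j * τ) (fun k hk => mul_le_mul_of_nonneg_right (hmm (hp k hk)) hτ0)
  rw [abs_of_nonneg hτ0] at e3
  have e4 : c' * Real.exp ((l j - ε) * t) ≤ M * Real.exp ((m j * τ + ε * τ) * γ) := by
    calc c' * Real.exp ((l j - ε) * t) ≤ c' * Real.exp ((l k0 - ε) * t) := by
          have := hlm hk
          gcongr
      _ ≤ ‖F t x‖ := e2
      _ ≤ K * ‖G τ p‖ ^ γ := e1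
      _ ≤ (|K| + 1) * ‖G τ p‖ ^ γ := by
          gcongr; linarith [le_abs_self K]
      _ ≤ (|K| + 1) * (C2 * Real.exp (m j * τ + ε * τ) * ‖p‖) ^ γ := by gcongr
      _ = M * Real.exp ((m j * τ + ε * τ) * γ) := by
          rw [show C2 * Real.exp (m j * τ + ε * τ) * ‖p‖ = C2 * ‖p‖ * Real.exp (m j * τ + ε * τ) by ring,
            Real.mul_rpow (by positivity) (by positivity), ← Real.exp_mul, hM]
          ring
  have e5 := Real.log_le_log (by positivity) e4
  rw [Real.log_mul hc'.ne' (Real.exp_ne_zero _), Real.log_mul hMp.ne' (Real.exp_ne_zero _),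
    Real.log_exp, Real.log_exp] at e5
  rw [Real.log_div hMp.ne' hc'.ne']
  linarith

theorem stepD (hF : SFlow F l) (hG : SFlow G m) (hl : ∀ i, l i < 0) (hm : ∀ i, m i < 0)
    (hlm : Monotone l) (hmm : Monotone m) (h : (Fin d → ℝ) ≃ₜ (Fin d → ℝ)) (h0 : h 0 = 0)
    (orb : ∀ x t, ∃ σ, h (F t x) = G σ (h x))
    {γ : ℝ} (hγ : 0 < γ) (hh : HolZ γ h) (hh' : HolZ γ h.symm) {i j k0 : Fin d}
    {x p : Fin d → ℝ} (hk : j ≤ k0) (hx : x k0 ≠ 0) (hp : ∀ k, p k ≠ 0 → k ≤ j)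
    (hpi : p i ≠ 0) (hxp : h x = p)
    {ε : ℝ} (hε : 0 < ε) (hb : 0 < -m j - ε)
    (hlt : (-m i + ε) * (-l j + ε) < γ ^ 2 * (-l i - ε) * (-m j - ε))
    (v : Fin d → ℝ) (hv : ∀ k, v k ≠ 0 → k ≤ i) :
    ∃ σ, G σ (QP m (fun s => m i ≤ s) (h (x + v))) = QP m (fun s => m i ≤ s) p := by
  have hp0 : p ≠ 0 := fun h => hpi (congrFun h i)
  have hQp : QP m (fun s => m i ≤ s) p ≠ 0 := by
    intro h
    have := congrFun h i
    simp [QP, hpi] at this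
  refine orbit_closed hG hm hQp ?_
  obtain ⟨C1, hC1⟩ := stepB hF hG hl hm hlm hmm h h0 hγ hh' hk hx hp0 hp hε
  obtain ⟨C2, hC2, hsup⟩ := gr_sup hF hε
  obtain ⟨C3, hC3, hsup'⟩ := gr_sup hG hε
  obtain ⟨r, hr, K, hK⟩ := hh
  set b := -m j - ε with hbdef
  set e := -m i + ε with he
  have he0 : 0 < e := by have := hm i; linarith
  set M := C3 * ((|K| + 1) * (C2 * ‖v‖) ^ γ) with hM
  set c := -l j + ε with hc
  set a := -l i - ε with ha
  set ω := (γ ^ 2 * a * b - e * c) / (γ * b) with hω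
  have hω0 : 0 < ω := by
    apply div_pos <;> [linarith; positivity]
  have key : ∀ᶠ t in atTop, ∃ σ, ‖G σ (QP m (fun s => m i ≤ s) (h (x + v))) -
      QP m (fun s => m i ≤ s) p‖ ≤ M * Real.exp (e * C1 / (γ * b) + -(ω * t)) := by
    have ev1 := (hF.tend hl x).eventually (Metric.ball_mem_nhds 0 hr)
    have ev2 := (hF.tend hl (x + v)).eventually (Metric.ball_mem_nhds 0 hr)
    filter_upwards [ev1, ev2, hC1, eventually_ge_atTop 0] with t h1 h2 h3 ht
    obtain ⟨τ, hτ⟩ := orb x t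
    obtain ⟨τ', hτ'⟩ := orb (x + v) t
    rw [hxp] at hτ
    obtain ⟨hτ0, h4⟩ := h3 τ hτ
    refine ⟨τ' - τ, ?_⟩
    have id1 : G (τ' - τ) (QP m (fun s => m i ≤ s) (h (x + v))) - QP m (fun s => m i ≤ s) p =
        G (-τ) (QP m (fun s => m i ≤ s) (h (F t (x + v)) - h (F t x))) := by
      rw [hτ, hτ', QP_sub, map_sub, ← QP_comm hG, ← QP_comm hG, ← hG.add, hG.cancel]
      congr 3; ring
    rw [id1]
    have e1 := hsup' (-τ) (QP m (fun s => m i ≤ s) (h (F t (x + v)) - h (F t x))) (m i * (-τ)) (by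
      intro k hk
      have : m i ≤ m k := by
        by_contra hn
        simp [QP, hn] at hk
      nlinarith)
    rw [abs_neg, abs_of_nonneg hτ0] at e1
    have e2 := hK _ h2 _ h1
    rw [dist_eq_norm, dist_eq_norm, ← map_sub (F t), add_sub_cancel_left] at e2
    have e3 := hsup t v (l i * t) (fun k hk => mul_le_mul_of_nonneg_right (hlm (hv k hk)) ht)
    rw [abs_of_nonneg ht] at e3
    have e4 : ‖QP m (fun s => m i ≤ s) (h (F t (x + v)) - h (F t x))‖ ≤
        (|K| + 1) * (C2 * ‖v‖) ^ γ * Real.exp (-(a * t) * γ) := by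
      calc _ ≤ ‖h (F t (x + v)) - h (F t x)‖ := QP_norm _ _
        _ ≤ K * ‖F t v‖ ^ γ := e2
        _ ≤ (|K| + 1) * ‖F t v‖ ^ γ := by gcongr; linarith [le_abs_self K]
        _ ≤ (|K| + 1) * (C2 * Real.exp (l i * t + ε * t) * ‖v‖) ^ γ := by gcongr
        _ = _ := by
          rw [show C2 * Real.exp (l i * t + ε * t) * ‖v‖ = C2 * ‖v‖ * Real.exp (l i * t + ε * t) by ring,
            Real.mul_rpow (by positivity) (by positivity), ← Real.exp_mul,
            show l i * t + ε * t = -(a * t) by rw [ha]; ring]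
          ring
    have e5 : e * τ + -(a * t) * γ ≤ e * C1 / (γ * b) + -(ω * t) := by
      have : τ ≤ (c * t + C1) / (γ * b) := by
        rw [le_div_iff₀ (by positivity)]; linarith
      have h6 := mul_le_mul_of_nonneg_left this he0.le
      have h7 : e * ((c * t + C1) / (γ * b)) + -(a * t) * γ = e * C1 / (γ * b) + -(ω * t) := by
        rw [hω]; field_simp; ring
      linarith
    calc _ ≤ C3 * Real.exp (m i * -τ + ε * τ) *
          ((|K| + 1) * (C2 * ‖v‖) ^ γ * Real.exp (-(a * t) * γ)) := e1.trans (by gcongr)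
      _ = M * Real.exp (e * τ + -(a * t) * γ) := by
          rw [hM, Real.exp_add (e * τ), show m i * -τ + ε * τ = e * τ by rw [he]; ring]
          ring
      _ ≤ _ := by gcongr
  have lim : Tendsto (fun t => M * Real.exp (e * C1 / (γ * b) + -(ω * t))) atTop (𝓝 0) := by
    have h1 : Tendsto (fun t : ℝ => e * C1 / (γ * b) + -(ω * t)) atTop atBot := by
      refine tendsto_atBot_add_const_left _ _ ?_
      exact tendsto_neg_atTop_atBot.comp (tendsto_id.const_mul_atTop hω0)
    simpa using (Real.tendsto_exp_atBot.comp h1).const_mul M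
  intro δ hδ
  obtain ⟨t, ⟨σ, h1⟩, h2⟩ := (key.and (lim.eventually (gt_mem_nhds hδ))).exists
  exact ⟨σ, h1.trans_lt h2⟩

theorem nec_main (hF : SFlow F l) (hG : SFlow G m) (hl : ∀ i, l i < 0) (hm : ∀ i, m i < 0)
    (hlm : Monotone l) (hmm : Monotone m) (h : (Fin d → ℝ) ≃ₜ (Fin d → ℝ)) (h0 : h 0 = 0)
    (orb : ∀ x t, ∃ σ, h (F t x) = G σ (h x))
    {γ : ℝ} (hγ : 0 < γ) (hγ1 : γ ≤ 1) (hh : HolZ γ h) (hh' : HolZ γ h.symm) {i j : Fin d}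
    (hij : i < j) : γ ^ 2 * (l i * m j) ≤ l j * m i := by
  by_contra hcon
  push Not at hcon
  have hlij : l i < l j := by
    have h1 := hmm hij.le
    have h2 := hl i
    have h3 := hl j
    have h4 := hm j
    have h5 : γ ^ 2 ≤ 1 := by nlinarith
    have h6 : 0 < l i * m j := mul_pos_of_neg_of_neg h2 h4
    have : l j * m i < l i * m j := by nlinarith
    nlinarith
  obtain ⟨p, hpi, hp, k0, hk, hx⟩ := stepA h.symm hij.le
  have ev : ∀ᶠ ε in 𝓝[>] (0:ℝ), 0 < ε ∧ 0 < -m j - ε ∧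
      (-m i + ε) * (-l j + ε) < γ ^ 2 * (-l i - ε) * (-m j - ε) := by
    refine (eventually_mem_nhdsWithin).and (Eventually.and ?_ ?_) <;>
      refine Filter.Eventually.filter_mono nhdsWithin_le_nhds ?_
    · have : ContinuousAt (fun ε : ℝ => -m j - ε) 0 := by fun_prop
      exact this.eventually (lt_mem_nhds (by simpa using hm j))
    · have c1 : ContinuousAt (fun ε : ℝ => (-m i + ε) * (-l j + ε)) 0 := by fun_prop
      have c2 : ContinuousAt (fun ε : ℝ => γ ^ 2 * (-l i - ε) * (-m j - ε)) 0 := by fun_prop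
      exact c1.eventually_lt c2 (by simp; nlinarith)
  obtain ⟨ε, hε, hb, hlt⟩ := ev.exists
  have hQp : QP m (fun s => m i ≤ s) p ≠ 0 := by
    intro h
    have := congrFun h i
    simp [QP, hpi] at this
  exact stepE hF hG hl hm hlm hmm h orb (x := h.symm p) (hlij.trans_le (hlm hk)) hx hQp
    (fun v hv => stepD hF hG hl hm hlm hmm h h0 orb hγ hh hh' hk hx hp hpi (by simp) hε hb hlt v hv)

theorem nec_all (hF : SFlow F l) (hG : SFlow G m) (hl : ∀ i, l i < 0) (hm : ∀ i, m i < 0)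
    (hlm : Monotone l) (hmm : Monotone m) (h : (Fin d → ℝ) ≃ₜ (Fin d → ℝ)) (h0 : h 0 = 0)
    (orb : ∀ x t, ∃ σ, h (F t x) = G σ (h x)) (orb' : ∀ x t, ∃ σ, h.symm (G t x) = F σ (h.symm x))
    {γ : ℝ} (hγ : 0 < γ) (hγ1 : γ ≤ 1) (hh : HolZ γ h) (hh' : HolZ γ h.symm) (i j : Fin d) :
    γ ^ 2 * (l i * m j) ≤ l j * m i := by
  rcases lt_trichotomy i j with hij | rfl | hij
  · exact nec_main hF hG hl hm hlm hmm h h0 orb hγ hγ1 hh hh' hij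
  · have h6 : 0 < l i * m i := mul_pos_of_neg_of_neg (hl i) (hm i)
    have h5 : γ ^ 2 ≤ 1 := by nlinarith
    nlinarith
  · have hs0 : h.symm 0 = 0 := by rw [h.symm_apply_eq, h0]
    have := nec_main hG hF hm hl hmm hlm h.symm hs0 orb' hγ hγ1 hh' (by simpa using hh) hij
    linarith
end PieceN10

section PieceN11
open Filter Topology
variable {d : ℕ}

theorem linFlow_neg (A : Matrix (Fin d) (Fin d) ℝ) (t : ℝ) (x : Euc d) :
    linFlow (-A) t x = linFlow A (-t) x := by
  simp [linFlow]

theorem flowOrbit_neg (A : Matrix (Fin d) (Fin d) ℝ) (x : Euc d) :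
    flowOrbit (-A) x = flowOrbit A x := by
  ext y
  simp only [flowOrbit, Set.mem_range, linFlow_neg]
  exact ⟨fun ⟨t, h⟩ => ⟨-t, h⟩, fun ⟨t, h⟩ => ⟨-t, by rwa [neg_neg]⟩⟩

theorem rel_neg_left (P : (Euc d ≃ₜ Euc d) → Prop) (A B : Matrix (Fin d) (Fin d) ℝ) :
    RelEquivWith P (-A) B ↔ RelEquivWith P A B := by
  simp only [RelEquivWith, IsOrbitEquiv, flowOrbit_neg]

theorem rel_neg_right (P : (Euc d ≃ₜ Euc d) → Prop) (A B : Matrix (Fin d) (Fin d) ℝ) :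
    RelEquivWith P A (-B) ↔ RelEquivWith P A B := by
  simp only [RelEquivWith, IsOrbitEquiv, flowOrbit_neg]

theorem sim_neg_right_aux {P : (Euc d ≃ₜ Euc d) → Prop} {A B : Matrix (Fin d) (Fin d) ℝ}
    (h : SimEquivWith P A B) : SimEquivWith P A (-B) := by
  obtain ⟨h, α, hα, hP, H⟩ := h
  refine ⟨h, -α, neg_ne_zero.2 hα, hP, fun t x => ?_⟩
  rw [linFlow_neg, H]; congr 1; ring

theorem sim_neg_left_aux {P : (Euc d ≃ₜ Euc d) → Prop} {A B : Matrix (Fin d) (Fin d) ℝ}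
    (h : SimEquivWith P A B) : SimEquivWith P (-A) B := by
  obtain ⟨h, α, hα, hP, H⟩ := h
  refine ⟨h, -α, neg_ne_zero.2 hα, hP, fun t x => ?_⟩
  rw [linFlow_neg, H]; congr 1; ring

theorem sim_neg_right (P : (Euc d ≃ₜ Euc d) → Prop) (A B : Matrix (Fin d) (Fin d) ℝ) :
    SimEquivWith P A (-B) ↔ SimEquivWith P A B :=
  ⟨fun h => by simpa using sim_neg_right_aux h, sim_neg_right_aux⟩

theorem sim_neg_left (P : (Euc d ≃ₜ Euc d) → Prop) (A B : Matrix (Fin d) (Fin d) ℝ) :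
    SimEquivWith P (-A) B ↔ SimEquivWith P A B :=
  ⟨fun h => by simpa using sim_neg_left_aux h, sim_neg_left_aux⟩

theorem sim_rel {P : (Euc d ≃ₜ Euc d) → Prop} {A B : Matrix (Fin d) (Fin d) ℝ}
    (h : SimEquivWith P A B) : RelEquivWith P A B := by
  obtain ⟨h, α, hα, hP, H⟩ := h
  refine ⟨h, hP, fun x => ?_⟩
  ext y
  simp only [flowOrbit, Set.mem_image, Set.mem_range, exists_exists_eq_and, H]
  exact ⟨fun ⟨t, h⟩ => ⟨_, h⟩, fun ⟨t, h⟩ => ⟨α⁻¹ * t, by rwa [mul_inv_cancel_left₀ hα]⟩⟩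

theorem isStable_neg {A : Matrix (Fin d) (Fin d) ℝ} (h : IsUnstable A) : IsStable (-A) := by
  intro x
  have := (show Tendsto (fun t : ℝ => linFlow A t x) atBot (𝓝 0) from h x).comp
    tendsto_neg_atTop_atBot
  show Tendsto (fun t : ℝ => linFlow (-A) t x) atTop (𝓝 0)
  exact this.congr fun t => (linFlow_neg A t x).symm

theorem rhoPlus_neg_right (A B : Matrix (Fin d) (Fin d) ℝ) : rhoPlus A (-B) = rhoPlus (-A) B := by
  have e : (fun j : Fin d => lyapExp A j / lyapExp (-B) j) =
      (fun j : Fin d => lyapExp (-A) j / lyapExp B j) ∘ Fin.revPerm := by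
    ext j
    simp only [Function.comp_apply, Fin.revPerm_apply, lyapExp_neg, Fin.rev_rev, div_neg, neg_div]
  unfold rhoPlus
  rw [show (⨅ j : Fin d, lyapExp A j / lyapExp (-B) j) = ⨅ j : Fin d, lyapExp (-A) j / lyapExp B j by
      rw [e]; exact Fin.revPerm.surjective.iInf_comp (fun j : Fin d => lyapExp (-A) j / lyapExp B j),
    show (⨆ j : Fin d, lyapExp A j / lyapExp (-B) j) = ⨆ j : Fin d, lyapExp (-A) j / lyapExp B j by
      rw [e]; exact Fin.revPerm.surjective.iSup_comp (fun j : Fin d => lyapExp (-A) j / lyapExp B j)]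

theorem rho_neg_left (A B : Matrix (Fin d) (Fin d) ℝ) : rho (-A) B = rho A B := by
  rw [rho, rho, neg_neg, max_comm]

theorem rho_neg_right (A B : Matrix (Fin d) (Fin d) ℝ) : rho A (-B) = rho A B := by
  rw [rho, rho, rhoPlus_neg_right, rhoPlus_neg_right, neg_neg, max_comm]

theorem HolZ_mono {E E' : Type*} [NormedAddCommGroup E] [NormedAddCommGroup E'] {f : E → E'}
    {a b : ℝ} (h : HolZ a f) (hb : 0 < b) (hba : b ≤ a) : HolZ b f := by
  obtain ⟨r, hr, K, hK⟩ := h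
  refine ⟨min r (1/2), by positivity, |K|, fun x hx y hy => ?_⟩
  have h1 := hK x (Metric.ball_subset_ball (min_le_left _ _) hx) y
    (Metric.ball_subset_ball (min_le_left _ _) hy)
  have h2 : dist x y ≤ 1 := by
    have e1 := (Metric.mem_ball.1 hx).trans_le (min_le_right _ _)
    have e2 := (Metric.mem_ball.1 hy).trans_le (min_le_right _ _)
    have := dist_triangle_right x y 0
    linarith
  refine h1.trans ?_
  refine mul_le_mul (le_abs_self K) ?_ (Real.rpow_nonneg dist_nonneg _) (abs_nonneg _)
  rcases eq_or_lt_of_le (dist_nonneg (x := x) (y := y)) with h0 | h0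
  · rw [← h0, Real.zero_rpow hb.ne', Real.zero_rpow (hb.trans_le hba).ne']
  · exact Real.rpow_le_rpow_of_exponent_ge h0 h2 hba

theorem class_mono {h : Euc d ≃ₜ Euc d} {a b : ℝ} (H : MemHolderClass a h) (hb : 0 < b)
    (hba : b ≤ a) : MemHolderClass b h :=
  ⟨H.1, HolZ_mono (f := h) H.2.1 hb hba, HolZ_mono (f := h.symm) H.2.2 hb hba⟩

theorem HolZ_conj {h : Euc d → Euc d} (TA TB : Euc d ≃L[ℝ] (Fin d → ℝ)) (h0 : h 0 = 0)
    (hc : Continuous h) {γ : ℝ} (hγ : 0 < γ) (H : HolZ γ h) :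
    HolZ γ (fun x => TB (h (TA.symm x))) := by
  have h1 := HolZ_comp (HolZ_clm (TA.symm : (Fin d → ℝ) →L[ℝ] Euc d)) H (map_zero _)
    (ContinuousLinearMap.continuous _) hγ
  have h2 := HolZ_comp h1 (HolZ_clm (TB : Euc d →L[ℝ] (Fin d → ℝ))) (by simp [h0])
    (hc.comp (ContinuousLinearMap.continuous _)) one_pos
  rw [one_mul, mul_one] at h2
  exact h2

theorem nec_fin {A B : Matrix (Fin d) (Fin d) ℝ} (hA : IsStable A) (hB : IsStable B)
    {γ : ℝ} (hγ : 0 < γ) (hγ1 : γ ≤ 1) {h : Euc d ≃ₜ Euc d} (H : MemHolderClass γ h)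
    (ho : IsOrbitEquiv A B h) (i j : Fin d) :
    γ ^ 2 * (lyapExp A i * lyapExp B j) ≤ lyapExp A j * lyapExp B i := by
  obtain ⟨TA, FA, l, lm, lA, hFA, cA⟩ := exists_SFlow A
  obtain ⟨TB, FB, m, mm, mB, hFB, cB⟩ := exists_SFlow B
  rw [lA, lA, mB, mB]
  have st : ∀ {A : Matrix (Fin d) (Fin d) ℝ} {T : Euc d ≃L[ℝ] (Fin d → ℝ)} 
      {F : ℝ → (Fin d → ℝ) →L[ℝ] (Fin d → ℝ)}, IsStable A → (∀ t x, T (linFlow A t x) = F t (T x)) →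
      ∀ x, Tendsto (fun t => F t x) atTop (𝓝 0) := by
    intro A T F hA c x
    have h1 := (T.continuous.tendsto 0).comp
      (show Tendsto (fun t : ℝ => linFlow A t (T.symm x)) atTop (𝓝 0) from hA _)
    rw [map_zero] at h1
    refine h1.congr fun t => ?_
    simp [c]
  have hl := SFlow_neg hFA (st hA cA)
  have hm := SFlow_neg hFB (st hB cB)
  obtain ⟨h0, H1, H2⟩ := H
  have hs0 : h.symm 0 = 0 := by rw [h.symm_apply_eq, h0]
  let g : (Fin d → ℝ) ≃ₜ (Fin d → ℝ) := (TA.symm.toHomeomorph.trans h).trans TB.toHomeomorph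
  have hg : ∀ x, g x = TB (h (TA.symm x)) := fun x => rfl
  have hg' : ∀ x, g.symm x = TA (h.symm (TB.symm x)) := fun x => rfl
  have fA : ∀ t x, TA.symm (FA t x) = linFlow A t (TA.symm x) := by
    intro t x
    rw [TA.symm_apply_eq, cA, TA.apply_symm_apply]
  have fB : ∀ t x, TB.symm (FB t x) = linFlow B t (TB.symm x) := by
    intro t x
    rw [TB.symm_apply_eq, cB, TB.apply_symm_apply]
  refine nec_all hFA hFB hl hm lm mm g (by simp [hg, h0]) ?_ ?_ hγ hγ1
    (HolZ_conj TA TB h0 h.continuous hγ H1) (HolZ_conj TB TA hs0 h.symm.continuous hγ H2) i j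
  · intro x t
    have : h (linFlow A t (TA.symm x)) ∈ flowOrbit B (h (TA.symm x)) := by
      rw [← ho]; exact ⟨_, ⟨t, rfl⟩, rfl⟩
    obtain ⟨σ, hσ⟩ := this
    refine ⟨σ, ?_⟩
    simp only at hσ
    rw [hg, hg, fA, ← hσ, cB]
  · intro x t
    have : linFlow B t (TB.symm x) ∈ h '' flowOrbit A (h.symm (TB.symm x)) := by
      rw [ho, h.apply_symm_apply]; exact ⟨t, rfl⟩
    obtain ⟨_, ⟨σ, rfl⟩, hσ⟩ := this
    refine ⟨σ, ?_⟩
    simp only at hσ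
    rw [hg', hg', fB, ← hσ, h.symm_apply_apply, cA]

theorem suff_fin {A B : Matrix (Fin d) (Fin d) ℝ} (hl : ∀ i : Fin d, lyapExp A i < 0)
    (hm : ∀ i : Fin d, lyapExp B i < 0) {α β : ℝ} (hα : 0 < α) (hβ : 0 < β) (hβ1 : β ≤ 1)
    (h1 : ∀ i : Fin d, β ≤ α * lyapExp B i / lyapExp A i)
    (h2 : ∀ i : Fin d, α * lyapExp B i / lyapExp A i * β ≤ 1) :
    SimEquivWith (MemHBelow β) A B := by
  obtain ⟨TA, FA, l, lm, lA, hFA, cA⟩ := exists_SFlow A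
  obtain ⟨TB, FB, m, mm, mB, hFB, cB⟩ := exists_SFlow B
  simp only [lA, mB] at hl hm h1 h2
  exact suff hFA hFB cA cB hl hm hα hβ hβ1 h1 h2

theorem lyapExp_lt {A : Matrix (Fin d) (Fin d) ℝ} (hA : IsStable A) (i : Fin d) :
    lyapExp A i < 0 := by
  obtain ⟨T, F, l, lm, lA, hF, c⟩ := exists_SFlow A
  rw [lA]
  refine SFlow_neg hF (fun x => ?_) i
  have h1 := (T.continuous.tendsto 0).comp
    (show Tendsto (fun t : ℝ => linFlow A t (T.symm x)) atTop (𝓝 0) from hA _)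
  rw [map_zero] at h1
  refine h1.congr fun t => ?_
  simp [c]

theorem rho_stable (hd : 0 < d) {A B : Matrix (Fin d) (Fin d) ℝ} (hA : IsStable A)
    (hB : IsStable B) : ∃ i j : Fin d, rho A B =
      (lyapExp A i / lyapExp B i) / (lyapExp A j / lyapExp B j) ∧
      (∀ k : Fin d, lyapExp A i / lyapExp B i ≤ lyapExp A k / lyapExp B k) ∧
      (∀ k : Fin d, lyapExp A k / lyapExp B k ≤ lyapExp A j / lyapExp B j) := by
  have : Nonempty (Fin d) := ⟨⟨0, hd⟩⟩
  obtain ⟨i, hi⟩ := Finite.exists_min (fun k : Fin d => lyapExp A k / lyapExp B k)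
  obtain ⟨j, hj⟩ := Finite.exists_max (fun k : Fin d => lyapExp A k / lyapExp B k)
  refine ⟨i, j, ?_, hi, hj⟩
  have pos : ∀ k : Fin d, 0 < lyapExp A k / lyapExp B k := fun k =>
    div_pos_of_neg_of_neg (lyapExp_lt hA k) (lyapExp_lt hB k)
  have e1 : (⨅ k : Fin d, lyapExp A k / lyapExp B k) = lyapExp A i / lyapExp B i :=
    le_antisymm (ciInf_le (Finite.bddBelow_range _) i) (le_ciInf hi)
  have e2 : (⨆ k : Fin d, lyapExp A k / lyapExp B k) = lyapExp A j / lyapExp B j :=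
    le_antisymm (ciSup_le hj) (le_ciSup (f := fun k : Fin d => lyapExp A k / lyapExp B k)
      (Finite.bddAbove_range _) j)
  have e3 : rhoPlus A B = (lyapExp A i / lyapExp B i) / (lyapExp A j / lyapExp B j) := by
    rw [rhoPlus, e1, e2, abs_of_pos (pos j)]
  have e4 : rhoPlus (-A) B ≤ 0 := by
    rw [rhoPlus]
    refine div_nonpos_of_nonpos_of_nonneg ?_ (abs_nonneg _)
    refine (ciInf_le (Finite.bddBelow_range _) i).trans ?_
    rw [lyapExp_neg]
    exact div_nonpos_of_nonneg_of_nonpos (by linarith [lyapExp_lt hA (Fin.rev i)])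
      (lyapExp_lt hB i).le
  rw [rho, max_eq_left, e3]
  exact e4.trans (by rw [e3]; exact (div_pos (pos i) (pos j)).le)

theorem rho_nec (hd : 0 < d) {A B : Matrix (Fin d) (Fin d) ℝ} (hA : IsStable A)
    (hB : IsStable B) {γ : ℝ} (hγ : 0 < γ) (hγ1 : γ ≤ 1) {h : Euc d ≃ₜ Euc d}
    (H : MemHolderClass γ h) (ho : IsOrbitEquiv A B h) : γ ^ 2 ≤ rho A B := by
  obtain ⟨i, j, e, -, -⟩ := rho_stable hd hA hB
  have := nec_fin hA hB hγ hγ1 H ho j i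
  have pos : ∀ k : Fin d, 0 < lyapExp A k / lyapExp B k := fun k =>
    div_pos_of_neg_of_neg (lyapExp_lt hA k) (lyapExp_lt hB k)
  have hi := lyapExp_lt hB i
  have hj := lyapExp_lt hB j
  rw [e, le_div_iff₀ (pos j), ← sub_nonneg]
  have : lyapExp A i / lyapExp B i - γ ^ 2 * (lyapExp A j / lyapExp B j) =
    (lyapExp A i * lyapExp B j - γ ^ 2 * (lyapExp A j * lyapExp B i)) / (lyapExp B i * lyapExp B j) := by
    field_simp [hi.ne, hj.ne]
  rw [this]
  exact div_nonneg (by linarith) (mul_pos_of_neg_of_neg hi hj).le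

theorem rho_suff (hd : 0 < d) {A B : Matrix (Fin d) (Fin d) ℝ} (hA : IsStable A)
    (hB : IsStable B) : 0 < rho A B ∧ SimEquivWith (MemHBelow (√(rho A B))) A B := by
  obtain ⟨i, j, e, hi, hj⟩ := rho_stable hd hA hB
  have pos : ∀ k : Fin d, 0 < lyapExp A k / lyapExp B k := fun k =>
    div_pos_of_neg_of_neg (lyapExp_lt hA k) (lyapExp_lt hB k)
  have hp : 0 < rho A B := by rw [e]; exact div_pos (pos i) (pos j)
  refine ⟨hp, ?_⟩
  set a := lyapExp A i / lyapExp B i with ha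
  set b := lyapExp A j / lyapExp B j with hb
  have a0 : 0 < a := pos i
  have b0 : 0 < b := pos j
  have inv : ∀ k : Fin d, √(a * b) * lyapExp B k / lyapExp A k =
      √a * √b / (lyapExp A k / lyapExp B k) := by
    intro k
    rw [Real.sqrt_mul a0.le]
    field_simp
  have ea : √a * √a = a := Real.mul_self_sqrt a0.le
  have eb : √b * √b = b := Real.mul_self_sqrt b0.le
  have sa : 0 < √a := Real.sqrt_pos.2 a0
  have sb : 0 < √b := Real.sqrt_pos.2 b0
  have er : √(rho A B) = √a / √b := by rw [e, Real.sqrt_div a0.le]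
  refine suff_fin (lyapExp_lt hA) (lyapExp_lt hB) (α := √(a * b)) (Real.sqrt_pos.2 (mul_pos a0 b0))
    (Real.sqrt_pos.2 hp) ?_ (fun k => ?_) (fun k => ?_)
  · rw [Real.sqrt_le_one, e]
    exact div_le_one_of_le₀ (hj i) b0.le
  · rw [inv, er, div_le_div_iff₀ sb (pos k)]
    have := mul_le_mul_of_nonneg_left (hj k) sa.le
    calc _ ≤ √a * b := this
      _ = √a * (√b * √b) := by rw [eb]
      _ = _ := by ring
  · rw [inv, er, div_mul_div_comm, div_le_one (mul_pos (pos k) sb)]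
    have := mul_le_mul_of_nonneg_right (hi k) sb.le
    calc _ = (√a * √a) * √b := by ring
      _ = a * √b := by rw [ea]
      _ ≤ _ := this

theorem sim_mono {P Q : (Euc d ≃ₜ Euc d) → Prop} (hPQ : ∀ h, P h → Q h)
    {A B : Matrix (Fin d) (Fin d) ℝ} (h : SimEquivWith P A B) : SimEquivWith Q A B := by
  obtain ⟨h, α, hα, hP, H⟩ := h
  exact ⟨h, α, hα, hPQ h hP, H⟩

theorem below_stable (hd : 0 < d) {A B : Matrix (Fin d) (Fin d) ℝ} (hA : IsStable A)
    (hB : IsStable B) {β : ℝ} (hβ0 : 0 < β) (hβ1 : β < 1) :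
    (SimEquivWith (MemHBelow β) A B ↔ RelEquivWith (MemHBelow β) A B) ∧
    (RelEquivWith (MemHBelow β) A B ↔ β ^ 2 ≤ rho A B) := by
  have h1 : RelEquivWith (MemHBelow β) A B → β ^ 2 ≤ rho A B := by
    rintro ⟨h, hP, ho⟩
    have hlim : Tendsto (fun γ : ℝ => γ ^ 2) (𝓝[<] β) (𝓝 (β ^ 2)) :=
      (Continuous.tendsto (by fun_prop) β).mono_left nhdsWithin_le_nhds
    refine le_of_tendsto hlim ?_
    filter_upwards [Ioo_mem_nhdsLT hβ0] with γ hγ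
    exact rho_nec hd hA hB hγ.1 (hγ.2.trans hβ1).le (hP γ hγ.1 hγ.2) ho
  have h2 : β ^ 2 ≤ rho A B → SimEquivWith (MemHBelow β) A B := by
    intro h
    refine sim_mono (fun g hg γ hγ0 hγ => hg γ hγ0 ?_) (rho_suff hd hA hB).2
    exact hγ.trans_le (Real.le_sqrt_of_sq_le h)
  exact ⟨⟨sim_rel, fun h => h2 (h1 h)⟩, ⟨h1, fun h => sim_rel (h2 h)⟩⟩

theorem above_stable (hd : 0 < d) {A B : Matrix (Fin d) (Fin d) ℝ} (hA : IsStable A)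
    (hB : IsStable B) {β : ℝ} (hβ0 : 0 < β) (hβ1 : β < 1) :
    (SimEquivWith (MemHAbove β) A B ↔ RelEquivWith (MemHAbove β) A B) ∧
    (RelEquivWith (MemHAbove β) A B ↔ β ^ 2 < rho A B) := by
  have h1 : RelEquivWith (MemHAbove β) A B → β ^ 2 < rho A B := by
    rintro ⟨h, ⟨γ, hγ, hP⟩, ho⟩
    have hlt : β < min γ 1 := lt_min hγ hβ1
    have := rho_nec hd hA hB (hβ0.trans hlt) (min_le_right _ _)
      (class_mono hP (hβ0.trans hlt) (min_le_left _ _)) ho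
    nlinarith
  have h2 : β ^ 2 < rho A B → SimEquivWith (MemHAbove β) A B := by
    intro h
    have : β < √(rho A B) := Real.lt_sqrt_of_sq_lt h
    obtain ⟨γ, g1, g2⟩ := exists_between this
    exact sim_mono (fun g hg => ⟨γ, g1, hg γ (hβ0.trans g1) g2⟩) (rho_suff hd hA hB).2
  exact ⟨⟨sim_rel, fun h => h2 (h1 h)⟩, ⟨h1, fun h => sim_rel (h2 h)⟩⟩

theorem reduce_stable {Q : Matrix (Fin d) (Fin d) ℝ → Matrix (Fin d) (Fin d) ℝ → Prop}
    (hl : ∀ A B, Q (-A) B ↔ Q A B) (hr : ∀ A B, Q A (-B) ↔ Q A B)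
    (hs : ∀ A B, IsStable A → IsStable B → Q A B) {A B : Matrix (Fin d) (Fin d) ℝ}
    (hA : IsStable A ∨ IsUnstable A) (hB : IsStable B ∨ IsUnstable B) : Q A B := by
  rcases hA with hA | hA <;> rcases hB with hB | hB
  · exact hs _ _ hA hB
  · exact (hr _ _).1 (hs _ _ hA (isStable_neg hB))
  · exact (hl _ _).1 (hs _ _ (isStable_neg hA) hB)
  · exact (hl _ _).1 ((hr _ _).1 (hs _ _ (isStable_neg hA) (isStable_neg hB)))
end PieceN11

/-- **Corollary 4.8**: for flows `Φ`, `Ψ` each of which is stable or unstable, and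
`0 < β < 1`: (i) `Φ ≃^{β⁻} Ψ ↔ Φ ~^{β⁻} Ψ ↔ β² ≤ ρ(Φ,Ψ)`;
(ii) `Φ ≃^{β⁺} Ψ ↔ Φ ~^{β⁺} Ψ ↔ β² < ρ(Φ,Ψ)`. -/
theorem stable_unstable_crossratio_classification {d : ℕ} (hd : 0 < d)
    (A B : Matrix (Fin d) (Fin d) ℝ)
    (hA : IsStable A ∨ IsUnstable A) (hB : IsStable B ∨ IsUnstable B)
    (β : ℝ) (hβ0 : 0 < β) (hβ1 : β < 1) :
    ((SimEquivWith (MemHBelow β) A B ↔ RelEquivWith (MemHBelow β) A B) ∧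
      (RelEquivWith (MemHBelow β) A B ↔ β ^ 2 ≤ rho A B)) ∧
    ((SimEquivWith (MemHAbove β) A B ↔ RelEquivWith (MemHAbove β) A B) ∧
      (RelEquivWith (MemHAbove β) A B ↔ β ^ 2 < rho A B)) := by
  refine ⟨reduce_stable (Q := fun A B =>
      (SimEquivWith (MemHBelow β) A B ↔ RelEquivWith (MemHBelow β) A B) ∧
      (RelEquivWith (MemHBelow β) A B ↔ β ^ 2 ≤ rho A B)) ?_ ?_ ?_ hA hB,
    reduce_stable (Q := fun A B =>
      (SimEquivWith (MemHAbove β) A B ↔ RelEquivWith (MemHAbove β) A B) ∧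
      (RelEquivWith (MemHAbove β) A B ↔ β ^ 2 < rho A B)) ?_ ?_ ?_ hA hB⟩
  · intro A B
    simp only [sim_neg_left, rel_neg_left, rho_neg_left]
  · intro A B
    simp only [sim_neg_right, rel_neg_right, rho_neg_right]
  · intro A B hA hB
    exact below_stable hd hA hB hβ0 hβ1
  · intro A B
    simp only [sim_neg_left, rel_neg_left, rho_neg_left]
  · intro A B
    simp only [sim_neg_right, rel_neg_right, rho_neg_right]
  · intro A B hA hB
    exact above_stable hd hA hB hβ0 hβ1

end LF
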